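/- Let R be a principal ideal domain, let Q be a cancellative, torsion-free, seminormal commutative monoid (possibly having nontrivial units), let P be a finitely generated abelian group, and let u: Q → P be a monoid homomorphism, giving A = R[Q] the induced P-grading. Then every finitely generated projective module over A is free, and every finitely generated projective module over the degree-zero subring A^G = A_0 = R[ker u] is free. -/

import Mathlib

open scoped TensorProduct

universe u

/-! ### Properties of commutative (additive) monoids -/

/-- `Q` is cancellative: `a + x = a + y → x = y`. -/
def IsCancellativeAddMonoid (Q : Type*) [AddCommMonoid Q] : Prop :=
  ∀ a x y : Q, a + x = a + y → x = y

/-- `Q` is torsion-free: `n • x = n • y` for some `n > 0` implies `x = y`. -/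
def IsTorsionFreeAddMonoid (Q : Type*) [AddCommMonoid Q] : Prop :=
  ∀ n : ℕ, 0 < n → ∀ x y : Q, n • x = n • y → x = y

/-- `Q` is seminormal: an element `x = a - b` of the Grothendieck group with
`2x, 3x ∈ Q` lies in `Q` (stated elementwise via representatives). -/
def IsSeminormalAddMonoid (Q : Type*) [AddCommMonoid Q] : Prop :=
  ∀ a b : Q, (∃ y : Q, a + a = b + b + y) → (∃ z : Q, a + a + a = b + b + b + z) →
    ∃ w : Q, a = b + w

/-- `Q` is normal: an element `x = a - b` of the Grothendieck group with
`n • x ∈ Q` for some `n > 0` lies in `Q` (stated elementwise via representatives). -/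
def IsNormalAddMonoid (Q : Type*) [AddCommMonoid Q] : Prop :=
  ∀ a b : Q, (∃ n : ℕ, 0 < n ∧ ∃ y : Q, n • a = n • b + y) → ∃ w : Q, a = b + w

/-- `Q` has no nontrivial unit: `x + y = 0 → x = 0`. -/
def HasNoNontrivialAddUnits (Q : Type*) [AddCommMonoid Q] : Prop :=
  ∀ x y : Q, x + y = 0 → x = 0

/-! ### Freeness/extension conditions on rings -/

/-- Every (not necessarily finitely generated) projective `R`-module is free. -/
def AllProjectiveFree (R : Type u) [CommRing R] : Prop :=
  ∀ (M : Type u) [AddCommGroup M] [Module R M], Module.Projective R M → Module.Free R M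

/-- Every finitely generated projective `B`-module is free. -/
def AllFGProjectiveFree (B : Type u) [CommRing B] : Prop :=
  ∀ (M : Type u) [AddCommGroup M] [Module B M],
    Module.Finite B M → Module.Projective B M → Module.Free B M

/-- Every finitely generated projective `B`-module is extended from `R`, i.e. of the form
`B ⊗_R F` for a finitely generated projective `R`-module `F`. -/
def AllFGProjectiveExtended (R B : Type u) [CommRing R] [CommRing B] [Algebra R B] : Prop :=
  ∀ (M : Type u) [AddCommGroup M] [Module B M],
    Module.Finite B M → Module.Projective B M →
    ∃ (F : Type u) (_ : AddCommGroup F) (_ : Module R F),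
      Module.Finite R F ∧ Module.Projective R F ∧ Nonempty (M ≃ₗ[B] B ⊗[R] F)

/-- Condition (†): every projective `R`-module is free and every finitely generated
projective module over the group algebra `R[Q]` of a torsion-free abelian group `Q`
is extended from `R`. -/
def CondDagger (R : Type u) [CommRing R] : Prop :=
  AllProjectiveFree R ∧
  ∀ (Q : Type u) [AddCommGroup Q], IsTorsionFreeAddMonoid Q →
    AllFGProjectiveExtended R (AddMonoidAlgebra R Q)

/-- Condition (††): every projective `R`-module is free and every finitely generated
projective module over `R[Q × ℤ^n]` is extended from `R`, whenever `Q` is torsion-free,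
seminormal, cancellative and has no nontrivial unit. -/
def CondDaggerDagger (R : Type u) [CommRing R] : Prop :=
  AllProjectiveFree R ∧
  ∀ (n : ℕ) (Q : Type u) [AddCommMonoid Q],
    IsCancellativeAddMonoid Q → IsTorsionFreeAddMonoid Q → IsSeminormalAddMonoid Q →
    HasNoNontrivialAddUnits Q →
    AllFGProjectiveExtended R (AddMonoidAlgebra R (Q × (Fin n → ℤ)))

/-! ### Gradings -/

/-- A map `f` is degree-preserving for the gradings `ℳ`, `𝒩`. -/
def MapsGraded {P M N : Type*} {R : Type*} [Semiring R] [AddCommMonoid M] [AddCommMonoid N]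
    [Module R M] [Module R N] (f : M → N)
    (ℳ : P → Submodule R M) (𝒩 : P → Submodule R N) : Prop :=
  ∀ c : P, ∀ m ∈ ℳ c, f m ∈ 𝒩 c

/-- `𝒜` is a `P`-grading of the `R`-algebra `A`:
`A = ⊕_{a ∈ P} A_a`, `A_a · A_b ⊆ A_{a+b}`, `1 ∈ A_0`. -/
structure IsGradedRing {R A P : Type*} [CommRing R] [Ring A] [Algebra R A]
    [AddCommGroup P] [DecidableEq P] (𝒜 : P → Submodule R A) : Prop where
  is_internal : DirectSum.IsInternal 𝒜
  one_mem : (1 : A) ∈ 𝒜 0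
  mul_mem : ∀ {a b : P} {x y : A}, x ∈ 𝒜 a → y ∈ 𝒜 b → x * y ∈ 𝒜 (a + b)

/-- `ℳ` is a `P`-grading of the `A`-module `M`, compatible with the grading `𝒜` of `A`:
`M = ⊕_{a ∈ P} M_a` and `A_a • M_b ⊆ M_{a+b}`. -/
structure IsGradedModule {R A P M : Type*} [CommRing R] [Ring A] [Algebra R A]
    [AddCommGroup P] [DecidableEq P] [AddCommGroup M] [Module R M] [Module A M]
    [IsScalarTower R A M] (𝒜 : P → Submodule R A) (ℳ : P → Submodule R M) : Prop where
  is_internal : DirectSum.IsInternal ℳ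
  smul_mem : ∀ {a b : P} {x : A} {m : M}, x ∈ 𝒜 a → m ∈ ℳ b → x • m ∈ ℳ (a + b)

/-- The natural `P`-grading on `B ⊗[R] F`: `(B ⊗ F)_c = ⊕_{a+b=c} B_a ⊗ F_b`. -/
noncomputable def tensorGrading {R B F P : Type*} [CommRing R] [CommRing B] [Algebra R B]
    [AddCommGroup P] [AddCommGroup F] [Module R F]
    (ℬ : P → Submodule R B) (ℱ : P → Submodule R F) : P → Submodule R (B ⊗[R] F) :=
  fun c => Submodule.span R
    {z | ∃ a b : P, a + b = c ∧ ∃ x ∈ ℬ a, ∃ f ∈ ℱ b, z = x ⊗ₜ[R] f}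

/-- A `P`-graded `A`-module `(M, ℳ)` is (equivariantly) extended from `R`, i.e. trivial:
it is isomorphic, as a `P`-graded `A`-module, to `A ⊗_R F` for some `P`-graded `R`-module
`F` which is finitely generated and projective over `R`. -/
def IsGradedExtendedFrom (R : Type u) {A P : Type u} [CommRing R] [CommRing A]
    [Algebra R A] [AddCommGroup P] [DecidableEq P] (𝒜 : P → Submodule R A)
    (M : Type u) [AddCommGroup M] [Module R M] [Module A M] [IsScalarTower R A M]
    (ℳ : P → Submodule R M) : Prop :=
  ∃ (F : Type u) (_ : AddCommGroup F) (_ : Module R F) (ℱ : P → Submodule R F),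
    DirectSum.IsInternal ℱ ∧ Module.Finite R F ∧ Module.Projective R F ∧
    ∃ e : M ≃ₗ[A] A ⊗[R] F,
      MapsGraded (⇑e) ℳ (tensorGrading 𝒜 ℱ) ∧ MapsGraded (⇑e.symm) (tensorGrading 𝒜 ℱ) ℳ

/-! ### Monoid algebras, cones and faces -/

/-- The grading of a monoid algebra `R[Λ]` induced by a degree function `deg : Λ → P`:
the piece of degree `p` is spanned by the monomials `e_s` with `deg s = p`. -/
noncomputable def monAlgGrading (R : Type*) [CommRing R] {Λ P : Type*} [AddCommMonoid Λ]
    (deg : Λ → P) : P → Submodule R (AddMonoidAlgebra R Λ) :=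
  fun p => Submodule.span R {x | ∃ s : Λ, deg s = p ∧ x = AddMonoidAlgebra.single s 1}

/-- The lattice points `σ ∩ L` of the rational polyhedral cone
`σ = ⋂ᵢ (l i)⁻¹(ℚ≥0)` in `L ⊗ ℚ`. -/
def coneLatticePoints {L : Type*} [AddCommGroup L] {q : ℕ} (l : Fin q → L →+ ℚ) :
    AddSubmonoid L where
  carrier := {m | ∀ i, 0 ≤ l i m}
  zero_mem' := fun i => by simp
  add_mem' := by
    intro a b ha hb i
    rw [map_add]
    exact add_nonneg (ha i) (hb i)

/-- The lattice points `τ ∩ L` of the face `τ = σ ∩ l'⁻¹(0)` of the cone `σ`. -/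
def faceLatticePoints {L : Type*} [AddCommGroup L] {q : ℕ} (l : Fin q → L →+ ℚ)
    (l' : L →+ ℚ) : AddSubmonoid L where
  carrier := {m | (∀ i, 0 ≤ l i m) ∧ l' m = 0}
  zero_mem' := ⟨fun i => by simp, by simp⟩
  add_mem' := by
    intro a b ha hb
    refine ⟨fun i => ?_, ?_⟩
    · rw [map_add]; exact add_nonneg (ha.1 i) (hb.1 i)
    · rw [map_add, ha.2, hb.2, add_zero]

/-- The submonoid of elements of a submonoid `S ⊆ L` killed by `ψ : L →+ P`
(the "invariant" part of `S`). -/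
def kerSubmonoidIn {L P : Type*} [AddCommMonoid L] [AddCommMonoid P]
    (S : AddSubmonoid L) (ψ : L →+ P) : AddSubmonoid L where
  carrier := {m | m ∈ S ∧ ψ m = 0}
  zero_mem' := ⟨S.zero_mem, map_zero ψ⟩
  add_mem' := by
    intro a b ha hb
    exact ⟨S.add_mem ha.1 hb.1, by rw [map_add, ha.2, hb.2, add_zero]⟩

/-- The kernel submonoid `{q ∈ Q | u q = 0}` of a monoid homomorphism `u : Q →+ P`. -/
def kerSubmonoid {Q P : Type*} [AddCommMonoid Q] [AddCommMonoid P] (u : Q →+ P) :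
    AddSubmonoid Q where
  carrier := {q | u q = 0}
  zero_mem' := map_zero u
  add_mem' := by
    intro a b ha hb
    simp only [Set.mem_setOf_eq] at *
    rw [map_add, ha, hb, add_zero]

/-- `S` spans `L ⊗ ℚ`: a positive multiple of every lattice element is a difference of
elements of `S` (this expresses that the cone is "strongly convex", i.e. spans `L_ℚ`). -/
def SpansLattice {L : Type*} [AddCommGroup L] (S : AddSubmonoid L) : Prop :=
  ∀ m : L, ∃ n : ℕ, 0 < n ∧ ∃ x ∈ S, ∃ y ∈ S, (n : ℤ) • m = x - y

section

open Matrix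

/-! ### Idempotent matrices over subrings -/

/-- All entries of the matrix `X` lie in `S`. -/
def MatIn {K σ m n : Type*} [SetLike σ K] (S : σ) (X : Matrix m n K) : Prop :=
  ∀ i j, X i j ∈ S

namespace MatIn

variable {K σ l m n : Type*} [SetLike σ K] {S : σ}

theorem add [CommRing K] [AddMemClass σ K] {X Y : Matrix m n K} (hX : MatIn S X)
    (hY : MatIn S Y) : MatIn S (X + Y) := fun i j => add_mem (hX i j) (hY i j)

theorem sub [CommRing K] [AddSubgroupClass σ K] {X Y : Matrix m n K} (hX : MatIn S X)
    (hY : MatIn S Y) : MatIn S (X - Y) := fun i j => sub_mem (hX i j) (hY i j)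

theorem mul [CommRing K] [SubringClass σ K] [Fintype m] {X : Matrix l m K} {Y : Matrix m n K}
    (hX : MatIn S X) (hY : MatIn S Y) : MatIn S (X * Y) := fun i j => by
  rw [Matrix.mul_apply]
  exact sum_mem fun k _ => mul_mem (hX i k) (hY k j)

theorem one [CommRing K] [SubringClass σ K] [DecidableEq m] : MatIn S (1 : Matrix m m K) :=
  fun i j => by
    rw [Matrix.one_apply]
    split_ifs
    exacts [one_mem _, zero_mem _]

theorem smul [CommRing K] [SubringClass σ K] {c : K} (hc : c ∈ S) {X : Matrix m n K}
    (hX : MatIn S X) : MatIn S (c • X) := fun i j => by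
  rw [Matrix.smul_apply, smul_eq_mul]
  exact mul_mem hc (hX i j)

theorem mono {σ' : Type*} [SetLike σ' K] {T : σ'} {X : Matrix m n K} (hX : MatIn S X)
    (h : ∀ x ∈ S, x ∈ T) : MatIn T X := fun i j => h _ (hX i j)

theorem mul_left_mem {σ' : Type*} [CommRing K] [SetLike σ' K] [AddSubgroupClass σ' K] [Fintype m]
    {J : σ'} (hJ : ∀ x ∈ S, ∀ y ∈ J, x * y ∈ J) {X : Matrix l m K} {Y : Matrix m n K}
    (hX : MatIn S X) (hY : MatIn J Y) : MatIn J (X * Y) := fun i j => by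
  rw [Matrix.mul_apply]
  exact sum_mem fun k _ => hJ _ (hX i k) _ (hY k j)

theorem mul_right_mem {σ' : Type*} [CommRing K] [SetLike σ' K] [AddSubgroupClass σ' K] [Fintype m]
    {J : σ'} (hJ : ∀ x ∈ S, ∀ y ∈ J, x * y ∈ J) {X : Matrix l m K} {Y : Matrix m n K}
    (hX : MatIn J X) (hY : MatIn S Y) : MatIn J (X * Y) := fun i j => by
  rw [Matrix.mul_apply]
  exact sum_mem fun k _ => mul_comm (Y k j) (X i k) ▸ hJ _ (hY k j) _ (hX i k)

end MatIn

/-- The idempotent matrix `e` is the projection onto a free summand: `e = U W`, `W U = 1`. -/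
def SplitIn {K σ m : Type*} [CommRing K] [SetLike σ K] [Fintype m] (S : σ)
    (e : Matrix m m K) : Prop :=
  ∃ (k : ℕ) (U : Matrix m (Fin k) K) (W : Matrix (Fin k) m K),
    MatIn S U ∧ MatIn S W ∧ U * W = e ∧ W * U = 1

/-- Every idempotent matrix over `B` is the projection onto a free summand. -/
def IdemFree (B : Type*) [CommRing B] : Prop :=
  ∀ (m : ℕ) (e : Matrix (Fin m) (Fin m) B), e * e = e →
    ∃ (k : ℕ) (U : Matrix (Fin m) (Fin k) B) (W : Matrix (Fin k) (Fin m) B),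
      U * W = e ∧ W * U = 1

theorem SplitIn.mono {K σ σ' m : Type*} [CommRing K] [SetLike σ K] [SetLike σ' K] [Fintype m]
    {S : σ} {T : σ'} {e : Matrix m m K} (h : SplitIn S e) (hST : ∀ x ∈ S, x ∈ T) :
    SplitIn T e := by
  obtain ⟨k, U, W, hU, hW, h1, h2⟩ := h
  exact ⟨k, U, W, hU.mono hST, hW.mono hST, h1, h2⟩

/-- Splitting for idempotents indexed by `Fin n` gives splitting for all finite indexing types. -/
theorem splitIn_of_forall_fin {K σ τ m : Type*} [CommRing K] [SetLike σ K] [SetLike τ K]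
    [Fintype m] {A : τ} {S : σ}
    (H : ∀ (n : ℕ) (e : Matrix (Fin n) (Fin n) K), MatIn A e → e * e = e → SplitIn S e)
    (e : Matrix m m K) (heA : MatIn A e) (he : e * e = e) : SplitIn S e := by
  classical
  let φ := Fintype.equivFin m
  obtain ⟨k, U, W, hU, hW, h1, h2⟩ := H _ (e.submatrix φ.symm φ.symm) (fun i j => heA _ _)
    (by rw [Matrix.submatrix_mul_equiv, he])
  refine ⟨k, U.submatrix φ id, W.submatrix id φ, fun i j => hU _ _, fun i j => hW _ _, ?_, ?_⟩
  · have : U.submatrix φ id * W.submatrix id φ = (U * W).submatrix φ φ := by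
      ext i j; simp [Matrix.mul_apply]
    rw [this, h1]; ext i j; simp
  · rw [Matrix.submatrix_mul_equiv, h2]; simp

theorem splitIn_of_factor {K σ τ m n : Type*} [CommRing K] [SetLike σ K] [SubringClass σ K]
    [SetLike τ K] [SubringClass τ K] [Fintype m] [Fintype n] {A : τ} {S : σ}
    (H : ∀ (n : ℕ) (e : Matrix (Fin n) (Fin n) K), MatIn A e → e * e = e → SplitIn S e)
    {e : Matrix m m K} (he : e * e = e) (X : Matrix m n K) (Y : Matrix n m K)
    (hX : MatIn S X) (hY : MatIn S Y) (hXY : X * Y = e) (hYX : MatIn A (Y * X)) :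
    SplitIn S e := by
  have h2 : Y * X * (Y * X) = Y * e * X := by rw [← hXY]; simp only [Matrix.mul_assoc]
  obtain ⟨k, U, W, hU, hW, h3, h4⟩ := splitIn_of_forall_fin H (Y * X * (Y * X)) (hYX.mul hYX) (by
    calc Y * X * (Y * X) * (Y * X * (Y * X)) = Y * ((X * Y) * ((X * Y) * (X * Y))) * X := by
          simp only [Matrix.mul_assoc]
      _ = _ := by rw [hXY, he, he, h2])
  have heS : MatIn S e := hXY ▸ hX.mul hY
  refine ⟨k, e * X * U, W * (Y * e), (heS.mul hX).mul hU, hW.mul (hY.mul heS), ?_, ?_⟩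
  · calc e * X * U * (W * (Y * e)) = e * X * (U * W) * (Y * e) := by
          simp only [Matrix.mul_assoc]
      _ = e * (X * Y) * ((X * Y) * (X * Y)) * e := by rw [h3]; simp only [Matrix.mul_assoc]
      _ = e := by rw [hXY, he, he, he]
  · calc W * (Y * e) * (e * X * U) = W * (Y * (e * e) * X) * U := by
          simp only [Matrix.mul_assoc]
      _ = W * (U * W) * U := by rw [he, ← h2, h3]
      _ = (W * U) * (W * U) := by simp only [Matrix.mul_assoc]
      _ = 1 := by rw [h4, Matrix.one_mul]

/-- Gluing: an idempotent over `S` which splits after inverting `f ∈ A` comes from `A` as soon as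
`f` is comaximal in `A` with finitely many elements having the property that every element of `S`
is multiplied into `A` by their powers. -/
theorem splitIn_of_comaximal {K m n τ : Type*} [CommRing K]
    [Fintype m] [Fintype n] [DecidableEq n] [Fintype τ] {A S T : Subring K} (hAS : A ≤ S)
    (hST : S ≤ T)
    (H : ∀ (n : ℕ) (e : Matrix (Fin n) (Fin n) K), MatIn A e → e * e = e → SplitIn T e)
    {e : Matrix m m K} (he : e * e = e) (heS : MatIn S e) {f : K} (hf : f ∈ A) (g : τ → K)
    (hg : ∀ t, g t ∈ A)
    (hfg : ∃ c₀ ∈ A, ∃ c : τ → K, (∀ t, c t ∈ A) ∧ c₀ * f + ∑ t, c t * g t = 1)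
    (habs : ∀ b ∈ S, ∀ t, ∃ N : ℕ, g t ^ N * b ∈ A)
    (U : Matrix m n K) (W : Matrix n m K) (hU : MatIn S U) (hW : MatIn S W)
    (hUW : U * W = f • e) (hWU : W * U = f • 1) (heU : e * U = U) (hWe : W * e = W) :
    SplitIn T e := by
  classical
  -- a common exponent
  have hmono : ∀ b t (N M : ℕ), N ≤ M → g t ^ N * b ∈ A → g t ^ M * b ∈ A := by
    intro b t N M hNM hb
    obtain ⟨d, rfl⟩ := Nat.exists_eq_add_of_le hNM
    rw [add_comm, pow_add, mul_assoc]
    exact mul_mem (pow_mem (hg t) d) hb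
  have hfin : ∀ s : Finset K, (∀ b ∈ s, b ∈ S) → ∃ N, ∀ b ∈ s, ∀ t, g t ^ N * b ∈ A := by
    intro s hs
    choose! N hN using habs
    refine ⟨s.sup fun b => Finset.univ.sup fun t => N b t, fun b hb t => ?_⟩
    refine hmono b t (N b t) _ ?_ (hN b (hs b hb) t)
    exact (Finset.le_sup (f := fun t => N b t) (Finset.mem_univ t)).trans
      (Finset.le_sup (f := fun b => Finset.univ.sup fun t => N b t) hb)
  obtain ⟨N, hN⟩ := hfin
    ((Finset.univ.image fun p : m × m => e p.1 p.2) ∪ (Finset.univ.image fun p : m × n => U p.1 p.2)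
      ∪ (Finset.univ.image fun p : n × m => W p.1 p.2)) (by
    intro b hb
    simp only [Finset.mem_union, Finset.mem_image, Finset.mem_univ, true_and, Prod.exists] at hb
    rcases hb with (⟨i, j, rfl⟩ | ⟨i, j, rfl⟩) | ⟨i, j, rfl⟩
    exacts [heS i j, hU i j, hW i j])
  have hNe : ∀ t i j, g t ^ N * e i j ∈ A := fun t i j => hN _ (by
    simp only [Finset.mem_union, Finset.mem_image, Finset.mem_univ, true_and, Prod.exists]
    exact .inl (.inl ⟨i, j, rfl⟩)) t
  have hNU : ∀ t i j, g t ^ N * U i j ∈ A := fun t i j => hN _ (by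
    simp only [Finset.mem_union, Finset.mem_image, Finset.mem_univ, true_and, Prod.exists]
    exact .inl (.inr ⟨i, j, rfl⟩)) t
  have hNW : ∀ t i j, g t ^ N * W i j ∈ A := fun t i j => hN _ (by
    simp only [Finset.mem_union, Finset.mem_image, Finset.mem_univ, true_and, Prod.exists]
    exact .inr ⟨i, j, rfl⟩) t
  -- powers are comaximal
  obtain ⟨c₀, hc₀, c, hc, hsum⟩ :
      ∃ c₀ ∈ A, ∃ c : τ → K, (∀ t, c t ∈ A) ∧ c₀ * f + ∑ t, c t * g t ^ (2 * N) = 1 := by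
    obtain ⟨c₀, hc₀, c, hc, hsum⟩ := hfg
    let f' : A := ⟨f, hf⟩
    let g' : τ → A := fun t => ⟨g t, hg t⟩
    have htop : Ideal.span ({f'} ∪ Set.range g') = ⊤ := by
      rw [Ideal.eq_top_iff_one]
      have : (1 : A) = ⟨c₀, hc₀⟩ * f' + ∑ t, (⟨c t, hc t⟩ : A) * g' t := by
        apply Subtype.ext
        simp [f', g', hsum]
      rw [this]
      refine add_mem (Ideal.mul_mem_left _ _ (Ideal.subset_span (by simp)))
        (sum_mem fun t _ => Ideal.mul_mem_left _ _ (Ideal.subset_span (by simp)))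
    have h1 : (1 : A) ∈ Ideal.span {f'} ⊔ Ideal.span (Set.range fun t => g' t ^ (2 * N)) := by
      rw [← Ideal.eq_top_iff_one]
      by_contra hne
      obtain ⟨M, hM, hle⟩ := Ideal.exists_le_maximal _ hne
      apply hM.ne_top
      rw [eq_top_iff, ← htop, Ideal.span_le]
      rintro x (rfl | ⟨t, rfl⟩)
      · exact hle (Ideal.mem_sup_left (Ideal.subset_span rfl))
      · exact hM.isPrime.mem_of_pow_mem _
          (hle (Ideal.mem_sup_right (Ideal.subset_span ⟨t, rfl⟩)))
    obtain ⟨x, hx, y, hy, hxy⟩ := Submodule.mem_sup.1 h1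
    obtain ⟨a, rfl⟩ := Ideal.mem_span_singleton'.1 hx
    obtain ⟨d, rfl⟩ := (Ideal.mem_span_range_iff_exists_fun).1 hy
    refine ⟨a, a.2, fun t => d t, fun t => (d t).2, ?_⟩
    have := congrArg (Subtype.val) hxy
    simpa [f', g'] using this
  let X : Matrix m (n ⊕ τ × m) K := Matrix.of fun i j =>
    Sum.elim (fun j => U i j) (fun p => g p.1 ^ N * e i p.2) j
  let Y : Matrix (n ⊕ τ × m) m K := Matrix.of fun i j =>
    Sum.elim (fun i => c₀ * W i j) (fun p => c p.1 * (g p.1 ^ N * e p.2 j)) i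
  have hgA : ∀ t, g t ^ N ∈ A := fun t => pow_mem (hg t) N
  have hee : ∀ i j, ∑ k, e i k * e k j = e i j := fun i j => by
    rw [← Matrix.mul_apply, he]
  refine splitIn_of_factor H he X Y ?_ ?_ ?_ ?_
  · rintro i (j | ⟨t, j⟩)
    · exact hST (hU i j)
    · exact hST (hAS (hNe t i j))
  · rintro (i | ⟨t, i⟩) j
    · exact hST (mul_mem (hAS hc₀) (hW i j))
    · exact hST (hAS (mul_mem (hc t) (hNe t i j)))
  · ext i j
    have hUW' : ∑ k, U i k * W k j = f * e i j := by
      rw [← Matrix.mul_apply, hUW, Matrix.smul_apply, smul_eq_mul]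
    simp only [Matrix.mul_apply, X, Y, Matrix.of_apply, Fintype.sum_sum_type, Sum.elim_inl,
      Sum.elim_inr, Fintype.sum_prod_type]
    calc _ = c₀ * ∑ k, U i k * W k j + ∑ t, c t * g t ^ (2 * N) * ∑ k, e i k * e k j := by
          rw [Finset.mul_sum]
          congr 1
          · exact Finset.sum_congr rfl fun k _ => by ring
          · refine Finset.sum_congr rfl fun t _ => ?_
            rw [Finset.mul_sum]
            exact Finset.sum_congr rfl fun k _ => by rw [two_mul, pow_add]; ring
      _ = (c₀ * f + ∑ t, c t * g t ^ (2 * N)) * e i j := by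
          rw [hUW', hee, add_mul, Finset.sum_mul]; ring
      _ = e i j := by rw [hsum, one_mul]
  · rintro (i | ⟨s, i⟩) (j | ⟨t, j⟩) <;>
      simp only [Matrix.mul_apply, X, Y, Matrix.of_apply, Sum.elim_inl, Sum.elim_inr]
    · have : ∑ k, c₀ * W i k * U k j = c₀ * (f • (1 : Matrix n n K)) i j := by
        rw [← hWU, Matrix.mul_apply, Finset.mul_sum]
        exact Finset.sum_congr rfl fun k _ => by ring
      rw [this]
      exact mul_mem hc₀ ((MatIn.one (S := A)).smul hf i j)
    · have : ∑ k, c₀ * W i k * (g t ^ N * e k j) = c₀ * (g t ^ N * W i j) := by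
        rw [← congrFun₂ hWe i j, Matrix.mul_apply, Finset.mul_sum, Finset.mul_sum]
        exact Finset.sum_congr rfl fun k _ => by ring
      rw [this]
      exact mul_mem hc₀ (hNW t i j)
    · have : ∑ k, c s * (g s ^ N * e i k) * U k j = c s * (g s ^ N * U i j) := by
        rw [← congrFun₂ heU i j, Matrix.mul_apply, Finset.mul_sum, Finset.mul_sum]
        exact Finset.sum_congr rfl fun k _ => by ring
      rw [this]
      exact mul_mem (hc s) (hNU s i j)
    · exact sum_mem fun k _ => mul_mem (mul_mem (hc s) (hNe s i k)) (hNe t k j)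

/-- Milnor patching for the ideal `J` of `S`: an idempotent over `S` that splits modulo `J` comes
from any subring containing `J`. -/
theorem splitIn_of_split_mod {K m n : Type*} [CommRing K] [Fintype m] [Fintype n] [DecidableEq n]
    {A S T : Subring K} (hST : S ≤ T) (J : AddSubgroup K) (hJA : ∀ x ∈ J, x ∈ A)
    (hJS : ∀ x ∈ S, ∀ y ∈ J, x * y ∈ J)
    (H : ∀ (n : ℕ) (e : Matrix (Fin n) (Fin n) K), MatIn A e → e * e = e → SplitIn T e)
    {e : Matrix m m K} (he : e * e = e) (heS : MatIn S e)
    (U : Matrix m n K) (W : Matrix n m K) (hU : MatIn S U) (hW : MatIn S W)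
    (hUW : MatIn J (e - U * W)) (hWU : MatIn J (W * U - 1)) (heU : e * U = U) (hWe : W * e = W) :
    SplitIn T e := by
  classical
  set ε := e - U * W with hε
  have hεS : MatIn S ε := heS.sub (hU.mul hW)
  have heε : e * ε = ε := by rw [hε, Matrix.mul_sub, he, ← Matrix.mul_assoc, heU]
  have hεe : ε * e = ε := by rw [hε, Matrix.sub_mul, he, Matrix.mul_assoc, hWe]
  have hUWe : U * W = e - ε := by rw [hε]; abel
  let X : Matrix m (n ⊕ m) K := Matrix.fromCols U ε
  let Y : Matrix (n ⊕ m) m K := Matrix.fromRows (W * (e + ε)) ε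
  have hYX : Y * X = Matrix.fromBlocks (W * (e + ε) * U) (W * (e + ε) * ε) (ε * U) (ε * ε) := by
    rw [Matrix.fromRows_mul_fromCols]
  refine splitIn_of_factor H he X Y ?_ ?_ ?_ ?_
  · rintro i (j | j)
    exacts [hST (hU i j), hST (hεS i j)]
  · rintro (i | i) j
    exacts [hST ((hW.mul (heS.add hεS)) i j), hST (hεS i j)]
  · rw [Matrix.fromCols_mul_fromRows, ← Matrix.mul_assoc, hUWe, Matrix.sub_mul, Matrix.mul_add,
      Matrix.mul_add, he, heε, hεe]
    abel
  · rw [hYX]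
    rintro (i | i) (j | j)
    · have : W * (e + ε) * U = 1 + ((W * U - 1) + W * ε * U) := by
        rw [Matrix.mul_add, hWe, Matrix.add_mul]; abel
      rw [Matrix.fromBlocks_apply₁₁, this]
      refine add_mem (MatIn.one (S := A) i j) (hJA _ (add_mem (hWU i j) ?_))
      exact MatIn.mul_right_mem hJS (MatIn.mul_left_mem hJS hW hUW) hU i j
    · rw [Matrix.fromBlocks_apply₁₂]
      exact hJA _ (MatIn.mul_left_mem hJS (hW.mul (heS.add hεS)) hUW i j)
    · rw [Matrix.fromBlocks_apply₂₁]
      exact hJA _ (MatIn.mul_right_mem hJS hUW hU i j)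
    · rw [Matrix.fromBlocks_apply₂₂]
      exact hJA _ (MatIn.mul_right_mem hJS hUW hεS i j)

end

section

open Matrix Polynomial

/-! ### Lifting a basis from the special fibre: Horrocks' theorem in Roberts' form -/

namespace Roberts

variable {A F : Type*} [CommRing A] [CommRing F] [Algebra A F]

/-- Fractions `b / s` with `b ∈ A[v]` and `s` in the multiplicative set `S` of monic polynomials,
with coefficients in `I` and degree at most that of `s` (no degree condition if `b = false`). -/
def IsFrac (v : F) (S : Submonoid A[X]) (I : Ideal A) (bd : Bool) (x : F) : Prop :=
  ∃ s ∈ S, ∃ p : A[X], (∀ k, p.coeff k ∈ I) ∧ (bd → p.natDegree ≤ s.natDegree) ∧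
    aeval v s * x = aeval v p

variable {v : F} {S : Submonoid A[X]} {I : Ideal A} {bd : Bool}

theorem coeff_mul_mem (p q : A[X]) (hp : ∀ k, p.coeff k ∈ I) (k : ℕ) : (p * q).coeff k ∈ I := by
  rw [coeff_mul]
  exact sum_mem fun x _ => Ideal.mul_mem_right _ _ (hp _)

theorem IsFrac.common {ι : Type*} (t : Finset ι) (hS : ∀ s ∈ S, s.Monic) (x : ι → F)
    (hx : ∀ i ∈ t, IsFrac v S I bd (x i)) :
    ∃ s ∈ S, ∀ i ∈ t, ∃ p : A[X], (∀ k, p.coeff k ∈ I) ∧ (bd → p.natDegree ≤ s.natDegree) ∧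
      aeval v s * x i = aeval v p := by
  classical
  induction t using Finset.induction_on with
  | empty => exact ⟨1, S.one_mem, by simp⟩
  | insert a t ha ih =>
    obtain ⟨s, hs, h⟩ := ih fun i hi => hx i (Finset.mem_insert_of_mem hi)
    obtain ⟨s', hs', p', hp', hd', he'⟩ := hx a (Finset.mem_insert_self _ _)
    have hdeg : (s * s').natDegree = s.natDegree + s'.natDegree :=
      (hS s hs).natDegree_mul (hS s' hs')
    refine ⟨s * s', mul_mem hs hs', fun i hi => ?_⟩
    rcases Finset.mem_insert.1 hi with rfl | hi
    · refine ⟨p' * s, coeff_mul_mem _ _ hp', fun hb => ?_, ?_⟩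
      · have := natDegree_mul_le (p := p') (q := s)
        have := hd' hb
        omega
      · rw [map_mul, map_mul, ← he']; ring
    · obtain ⟨p, hp, hd, he⟩ := h i hi
      refine ⟨p * s', coeff_mul_mem _ _ hp, fun hb => ?_, ?_⟩
      · have := natDegree_mul_le (p := p) (q := s')
        have := hd hb
        omega
      · rw [map_mul, map_mul, ← he]; ring

theorem IsFrac.common_univ {ι : Type*} [Fintype ι] (hS : ∀ s ∈ S, s.Monic) (x : ι → F)
    (hx : ∀ i, IsFrac v S I bd (x i)) :
    ∃ s ∈ S, ∃ p : ι → A[X], (∀ i k, (p i).coeff k ∈ I) ∧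
      (bd → ∀ i, (p i).natDegree ≤ s.natDegree) ∧ ∀ i, aeval v s * x i = aeval v (p i) := by
  obtain ⟨s, hs, h⟩ := IsFrac.common Finset.univ hS x fun i _ => hx i
  choose p hp using fun i => h i (Finset.mem_univ i)
  exact ⟨s, hs, p, fun i => (hp i).1, fun hb i => (hp i).2.1 hb, fun i => (hp i).2.2⟩

theorem IsFrac.add (hS : ∀ s ∈ S, s.Monic) {x y : F} (hx : IsFrac v S I bd x)
    (hy : IsFrac v S I bd y) : IsFrac v S I bd (x + y) := by
  obtain ⟨s, hs, p, hp, hd, he⟩ := IsFrac.common_univ hS ![x, y]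
    (by intro i; fin_cases i; exacts [hx, hy])
  have h0 := he 0
  have h1 := he 1
  simp only [Matrix.cons_val_zero, Matrix.cons_val_one] at h0 h1
  refine ⟨s, hs, p 0 + p 1, fun k => ?_, fun hb => ?_, ?_⟩
  · rw [coeff_add]; exact add_mem (hp _ _) (hp _ _)
  · exact (natDegree_add_le _ _).trans (max_le (hd hb _) (hd hb _))
  · rw [map_add, mul_add, h0, h1]

theorem IsFrac.smul_of_mem {x : F} (hx : IsFrac v S ⊤ bd x) {a : A} (ha : a ∈ I) :
    IsFrac v S I bd (a • x) := by
  obtain ⟨s, hs, p, hp, hd, he⟩ := hx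
  refine ⟨s, hs, a • p, fun k => ?_, fun hb => (natDegree_smul_le _ _).trans (hd hb), ?_⟩
  · rw [coeff_smul, smul_eq_mul]; exact Ideal.mul_mem_right _ _ ha
  · rw [map_smul, ← he, mul_smul_comm]

/-- The `A`-module of all `S`-fractions, of degree at most zero if `bd`. -/
def fracs (v : F) (S : Submonoid A[X]) (hS : ∀ s ∈ S, s.Monic) (bd : Bool) : Submodule A F where
  carrier := {x | IsFrac v S ⊤ bd x}
  add_mem' hx hy := IsFrac.add hS hx hy
  zero_mem' := ⟨1, S.one_mem, 0, by simp, by simp, by simp⟩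
  smul_mem' a x hx := IsFrac.smul_of_mem hx trivial

theorem isFrac_of_mem_smul (hS : ∀ s ∈ S, s.Monic) {x : F} (hx : x ∈ I • fracs v S hS bd) :
    IsFrac v S I bd x := by
  induction hx using Submodule.smul_induction_on' with
  | smul a ha x hx => exact IsFrac.smul_of_mem hx ha
  | add x _ y _ hx hy => exact hx.add hS hy

theorem aeval_mul_mem_fracs (hS : ∀ s ∈ S, s.Monic) (b : A[X]) {x : F}
    (hx : x ∈ fracs v S hS false) : aeval v b * x ∈ fracs v S hS false := by
  obtain ⟨s, hs, p, -, -, he⟩ := hx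
  exact ⟨s, hs, b * p, by simp, by simp, by rw [map_mul, ← he]; ring⟩

theorem aeval_mem_fracs (hS : ∀ s ∈ S, s.Monic) (b : A[X]) :
    aeval v b ∈ fracs v S hS false :=
  ⟨1, S.one_mem, b, by simp, by simp, by simp⟩

/-- Division with remainder: a fraction is a polynomial plus a fraction of degree `≤ 0`. -/
theorem exists_sub_mem_fracs (hS : ∀ s ∈ S, s.Monic) {x : F} (hx : x ∈ fracs v S hS false) :
    ∃ b : A[X], x - aeval v b ∈ fracs v S hS true := by
  obtain ⟨s, hs, p, -, -, he⟩ := hx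
  refine ⟨p /ₘ s, s, hs, p %ₘ s, by simp, fun _ => natDegree_modByMonic_le _ (hS s hs), ?_⟩
  rw [mul_sub, he, ← map_mul, ← map_sub]
  congr 1
  nth_rewrite 1 [← modByMonic_add_div p s]
  ring

variable {n : Type*}

theorem fracs_true_le (hS : ∀ s ∈ S, s.Monic) :
    fracs v S hS true ≤ fracs v S hS false := fun _ ⟨s, hs, p, hp, _, he⟩ =>
  ⟨s, hs, p, hp, by simp, he⟩

theorem aeval_smul_mem {M : Type*} [AddCommGroup M] [Module A M] [Module F M]
    [IsScalarTower A F M] {P : Submodule A M} (hP : ∀ x ∈ P, v • x ∈ P)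
    (b : A[X]) {x : M} (hx : x ∈ P) : aeval v b • x ∈ P := by
  induction b using Polynomial.induction_on' with
  | add p q hp hq => rw [map_add, add_smul]; exact add_mem hp hq
  | monomial k a =>
    rw [aeval_monomial, mul_smul, algebraMap_smul]
    refine P.smul_mem _ ?_
    induction k with
    | zero => simpa using hx
    | succ k ih => rw [pow_succ', mul_smul]; exact hP _ ih

variable (v A) in
/-- The `A[v]`-module generated by a family, as an `A`-module. -/
def polySpan {M ι : Type*} [AddCommGroup M] [Module A M] [Module F M] (g : ι → M) :
    Submodule A M :=
  Submodule.span A (Set.range fun x : ℕ × ι => v ^ x.1 • g x.2)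

section polySpan

variable {M ι : Type*} [AddCommGroup M] [Module A M] [Module F M] [IsScalarTower A F M]

theorem mem_polySpan (g : ι → M) (i : ι) : g i ∈ polySpan A v g :=
  Submodule.subset_span ⟨(0, i), by simp⟩

theorem smul_mem_polySpan (g : ι → M) {x : M} (hx : x ∈ polySpan A v g) :
    v • x ∈ polySpan A v g := by
  induction hx using Submodule.span_induction with
  | mem x h =>
    obtain ⟨⟨k, i⟩, rfl⟩ := h
    refine Submodule.subset_span ⟨(k + 1, i), ?_⟩
    simp only [pow_succ', mul_smul]
  | zero => simp
  | add x y _ _ hx hy => rw [smul_add]; exact add_mem hx hy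
  | smul a x _ hx => rw [smul_comm]; exact Submodule.smul_mem _ _ hx

theorem polySpan_le {g : ι → M} {P : Submodule A M} (hP : ∀ x ∈ P, v • x ∈ P)
    (hg : ∀ i, g i ∈ P) : polySpan A v g ≤ P := by
  refine Submodule.span_le.2 ?_
  rintro _ ⟨⟨k, i⟩, rfl⟩
  simpa using aeval_smul_mem hP (X ^ k) (hg i)

theorem exists_sum_of_mem_polySpan [Fintype ι] {g : ι → M} {x : M} (hx : x ∈ polySpan A v g) :
    ∃ b : ι → A[X], x = ∑ i, aeval v (b i) • g i := by
  classical
  induction hx using Submodule.span_induction with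
  | mem x h =>
    obtain ⟨⟨k, i⟩, rfl⟩ := h
    refine ⟨Pi.single i (X ^ k), ?_⟩
    rw [Finset.sum_eq_single i]
    · simp
    · intro j _ hj; simp [hj]
    · simp
  | zero => exact ⟨0, by simp⟩
  | add x y _ _ hx hy =>
    obtain ⟨b, rfl⟩ := hx
    obtain ⟨c, rfl⟩ := hy
    exact ⟨b + c, by simp [add_smul, Finset.sum_add_distrib]⟩
  | smul a x _ hx =>
    obtain ⟨b, rfl⟩ := hx
    exact ⟨a • b, by simp [Finset.smul_sum, smul_assoc]⟩

/-- If monic polynomials carry the generators `g` into `Z`, then `polySpan g` is generated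
modulo `Z` by finitely many elements over `A`. -/
theorem exists_fg_sup [Finite ι] (g : ι → M) (Z : Submodule A M) (hZ : ∀ x ∈ Z, v • x ∈ Z)
    (h : ∀ i, ∃ s : A[X], s.Monic ∧ aeval v s • g i ∈ Z) :
    ∃ Y : Submodule A M, Y.FG ∧ Y ≤ polySpan A v g ∧ polySpan A v g ≤ Z ⊔ Y := by
  choose s hs hsZ using h
  refine ⟨⨆ i, Submodule.span A
    ((fun j => v ^ j • g i) '' ((Finset.range ((s i).natDegree + 1) : Finset ℕ) : Set ℕ)), ?_, ?_,
    ?_⟩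
  · refine Submodule.fg_iSup _ fun i => ?_
    exact Submodule.fg_span ((Finset.finite_toSet _).image _)
  · refine iSup_le fun i => Submodule.span_le.2 ?_
    rintro _ ⟨j, -, rfl⟩
    exact Submodule.subset_span ⟨(j, i), rfl⟩
  · refine Submodule.span_le.2 ?_
    rintro _ ⟨⟨k, i⟩, rfl⟩
    have h1 : v ^ k • g i = aeval v ((X ^ k : A[X]) /ₘ s i) • aeval v (s i) • g i
        + aeval v ((X ^ k : A[X]) %ₘ s i) • g i := by
      rw [← mul_smul, ← map_mul, ← add_smul, ← map_add, mul_comm, add_comm,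
        modByMonic_add_div]
      simp
    change v ^ k • g i ∈ _
    rw [h1]
    refine Submodule.add_mem_sup (aeval_smul_mem hZ _ (hsZ i)) ?_
    refine Submodule.mem_iSup_of_mem i ?_
    have h2 : ((X ^ k : A[X]) %ₘ s i).natDegree < (s i).natDegree + 1 :=
      Nat.lt_succ_of_le (natDegree_modByMonic_le _ (hs i))
    rw [aeval_eq_sum_range' h2, Finset.sum_smul]
    refine sum_mem fun j hj => ?_
    rw [smul_assoc]
    exact Submodule.smul_mem _ _ (Submodule.subset_span ⟨j, hj, rfl⟩)

end polySpan

theorem smul_mem_smul {M : Type*} [AddCommGroup M] [Module A M] [Module F M]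
    [IsScalarTower A F M] [SMulCommClass A F M] {P : Submodule A M} (hP : ∀ x ∈ P, v • x ∈ P) :
    ∀ x ∈ I • P, v • x ∈ I • P := by
  intro x hx
  induction hx using Submodule.smul_induction_on' with
  | smul a ha x hx => rw [smul_comm v a x]; exact Submodule.smul_mem_smul ha (hP _ hx)
  | add x _ y _ hx hy => rw [smul_add]; exact add_mem hx hy

theorem mem_smul_pi [Fintype n] [DecidableEq n] {C : Submodule A F} {x : n → F} :
    x ∈ I • Submodule.pi Set.univ (fun _ : n => C) ↔ ∀ i, x i ∈ I • C := by
  constructor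
  · intro hx i
    induction hx using Submodule.smul_induction_on' with
    | smul a ha x hx => exact Submodule.smul_mem_smul ha (hx i trivial)
    | add x _ y _ hx hy => exact add_mem hx hy
  · intro hx
    rw [← Finset.univ_sum_single x]
    refine sum_mem fun i _ => ?_
    have h : ∀ y ∈ I • C, (Pi.single i y : n → F) ∈ I • Submodule.pi Set.univ (fun _ : n => C) := by
      intro y hy
      induction hy using Submodule.smul_induction_on' with
      | smul a ha x hx =>
        have : (Pi.single i (a • x) : n → F) = a • Pi.single i x := by
          ext j
          by_cases hj : j = i
          · subst hj; simp
          · simp [hj]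
        rw [this]
        refine Submodule.smul_mem_smul ha fun j _ => ?_
        by_cases hj : j = i
        · subst hj; simpa using hx
        · simp [hj]
      | add x _ y _ hx hy => rw [Pi.single_add]; exact add_mem hx hy
    exact h _ (hx i)

theorem monic_unit_mul_det [Fintype n] [DecidableEq n] (hI : I ≤ Ideal.jacobson ⊥)
    {s : A[X]} (hs : s.Monic) (p : Matrix n n A[X]) (hp : ∀ i j k, (p i j).coeff k ∈ I)
    (hd : ∀ i j, (p i j).natDegree ≤ s.natDegree) :
    ∃ c : A[X], (c * (s • (1 : Matrix n n A[X]) - p).det).Monic := by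
  set N := s • (1 : Matrix n n A[X]) - p with hN
  have hdeg : N.det.natDegree ≤ Fintype.card n * s.natDegree := by
    rw [Matrix.det_apply]
    refine natDegree_sum_le_of_forall_le _ _ fun σ _ => ?_
    refine (natDegree_smul_le _ _).trans ((natDegree_prod_le _ _).trans ?_)
    refine (Finset.sum_le_card_nsmul _ _ s.natDegree fun i _ => ?_).trans (by simp)
    refine (natDegree_sub_le _ _).trans (max_le ?_ (hd _ _))
    rw [Matrix.smul_apply, Matrix.one_apply]
    split_ifs <;> simp
  have hcoeff : N.det.coeff (Fintype.card n * s.natDegree) - 1 ∈ I := by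
    rw [← Ideal.Quotient.eq_zero_iff_mem, map_sub, map_one, sub_eq_zero, ← coeff_map]
    have h1 : N.map (mapRingHom (Ideal.Quotient.mk I)) =
        (s.map (Ideal.Quotient.mk I)) • (1 : Matrix n n (A ⧸ I)[X]) := by
      ext1 i j
      have : (p i j).map (Ideal.Quotient.mk I) = 0 := by
        ext k; simpa [Ideal.Quotient.eq_zero_iff_mem] using hp i j k
      simp only [Matrix.map_apply, hN, Matrix.sub_apply, Matrix.smul_apply, coe_mapRingHom,
        smul_eq_mul]
      rw [Matrix.one_apply, Matrix.one_apply]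
      split_ifs <;> simp [this]
    have h2 : N.det.map (Ideal.Quotient.mk I) = (s.map (Ideal.Quotient.mk I)) ^ Fintype.card n := by
      rw [← coe_mapRingHom, RingHom.map_det, RingHom.mapMatrix_apply, h1, Matrix.det_smul,
        Matrix.det_one, mul_one, coe_mapRingHom]
    rw [h2]
    have h3 := (hs.map (Ideal.Quotient.mk I)).pow (Fintype.card n)
    nontriviality (A ⧸ I)
    have h4 : ((s.map (Ideal.Quotient.mk I)) ^ Fintype.card n).natDegree =
        Fintype.card n * s.natDegree := by
      rw [(hs.map _).natDegree_pow, hs.natDegree_map]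
    rw [← h4]
    exact h3
  have hu : IsUnit (N.det.coeff (Fintype.card n * s.natDegree)) := by
    have := Ideal.mem_jacobson_bot.1 (hI hcoeff) 1
    simpa using this
  obtain ⟨u, hu⟩ := hu
  refine ⟨C (↑u⁻¹ : A), monic_of_natDegree_le_of_coeff_eq_one (Fintype.card n * s.natDegree) ?_ ?_⟩
  · exact (natDegree_C_mul_le _ _).trans hdeg
  · rw [coeff_C_mul, ← hu, Units.inv_mul]

/-- **Lifting a basis**. Let `P` be an `A[v]`-lattice in the space of vectors of fractions which is
generated modulo `I` by elements `p i` congruent to the standard basis. Then `p` can be corrected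
to a generating family, in a way compatible with a projection `ρ`. -/
theorem exists_generators [Fintype n] [DecidableEq n] (hS : ∀ s ∈ S, s.Monic)
    (hI : I ≤ Ideal.jacobson ⊥) {ι : Type*} [Finite ι] (g : ι → n → F)
    (hg : ∀ i j, g i j ∈ fracs v S hS false) (p : n → n → F)
    (hp : ∀ i, p i ∈ polySpan A v g)
    (hpe : ∀ i j, p i j - (1 : Matrix n n F) i j ∈ I • fracs v S hS false)
    (hgp : polySpan A v g ≤ polySpan A v p ⊔ I • polySpan A v g)
    (hs : ∀ i, ∃ s ∈ S, aeval v s • (Pi.single i 1 : n → F) ∈ polySpan A v g)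
    (ρ : F →+ F) (hρρ : ∀ x, ρ (ρ x) = ρ x) (hρ1 : ρ 1 = 1) (hρp : ∀ i j, ρ (p i j) = p i j)
    (hρP : ∀ x ∈ I • polySpan A v g, (fun j => ρ (x j)) ∈ I • polySpan A v g)
    (hρE : ∀ x ∈ I • fracs v S hS true, ρ x ∈ I • fracs v S hS true) :
    ∃ q : n → n → F, (∀ i, q i ∈ polySpan A v g) ∧ (∀ i j, ρ (q i j) = q i j) ∧
      polySpan A v g ≤ polySpan A v q := by
  set P := polySpan A v g with hP
  let K : Submodule A (n → F) := Submodule.pi Set.univ fun _ : n => fracs v S hS false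
  let E : Submodule A (n → F) := Submodule.pi Set.univ fun _ : n => fracs v S hS true
  let ε : n → n → F := fun i => Pi.single i 1
  have hPv : ∀ x ∈ P, v • x ∈ P := fun x hx => smul_mem_polySpan g hx
  have hKv : ∀ x ∈ K, v • x ∈ K := by
    intro x hx i _
    simpa using aeval_mul_mem_fracs hS X (hx i trivial)
  have hPK : P ≤ K := polySpan_le hKv fun i j _ => hg i j
  have hεK : ∀ i, ε i ∈ K := by
    intro i j _
    by_cases h : j = i
    · subst h; simpa [ε] using aeval_mem_fracs (v := v) hS 1
    · simp [ε, h]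
  have hEK : E ≤ K := fun x hx i _ => fracs_true_le hS (hx i trivial)
  have hKsup : K ≤ polySpan A v ε ⊔ E := by
    intro x hx
    choose b hb using fun i => exists_sub_mem_fracs hS (hx i trivial)
    have : x = ∑ i, aeval v (b i) • ε i + (x - ∑ i, aeval v (b i) • ε i) := by abel
    rw [this]
    refine Submodule.add_mem_sup (sum_mem fun i _ => ?_) fun j _ => ?_
    · exact aeval_smul_mem (fun x hx => smul_mem_polySpan ε hx) _ (mem_polySpan ε i)
    · simpa [ε, Pi.single_apply] using hb j
  -- first application of Nakayama
  have hKPE : K ≤ P ⊔ E := by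
    obtain ⟨Y, hYfg, hYε, hεY⟩ := exists_fg_sup ε P hPv fun i => by
      obtain ⟨s, hs, h⟩ := hs i
      exact ⟨s, hS s hs, h⟩
    have hεK' : polySpan A v ε ≤ K := polySpan_le hKv hεK
    have h1 : polySpan A v ε ≤ P ⊔ I • K := by
      refine Submodule.span_le.2 ?_
      rintro _ ⟨⟨k, i⟩, rfl⟩
      have : v ^ k • ε i = v ^ k • p i - v ^ k • (p i - ε i) := by rw [smul_sub]; abel
      change v ^ k • ε i ∈ _
      rw [this]
      refine Submodule.sub_mem _ (Submodule.mem_sup_left ?_) (Submodule.mem_sup_right ?_)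
      · simpa using aeval_smul_mem hPv (X ^ k) (hp i)
      · have h2 : p i - ε i ∈ I • K := mem_smul_pi.2 fun j => by
          have := hpe i j
          rwa [Matrix.one_apply, show (if i = j then (1 : F) else 0) = ε i j by
            simp [ε, Pi.single_apply, eq_comm]] at this
        simpa using aeval_smul_mem (smul_mem_smul hKv) (X ^ k) h2
    have h2 : K ≤ P ⊔ E ⊔ Y := hKsup.trans (sup_le (hεY.trans (sup_le
      (le_sup_left.trans le_sup_left) le_sup_right)) (le_sup_right.trans le_sup_left))
    have h3 : Y ≤ P ⊔ E := by
      refine Submodule.le_of_le_smul_of_le_jacobson_bot hYfg hI ?_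
      refine hYε.trans (h1.trans (sup_le (le_sup_left.trans le_sup_left) ?_))
      refine (smul_mono_right I h2).trans ?_
      rw [Submodule.smul_sup]
      exact sup_le_sup_right Submodule.smul_le_right _
    exact h2.trans (sup_le le_rfl h3)
  -- correct the generators
  have hxy : ∀ i, ∃ x ∈ I • P, ∃ y ∈ I • E, x + y = ε i - p i := by
    intro i
    rw [← Submodule.mem_sup, ← Submodule.smul_sup]
    refine smul_mono_right I hKPE (mem_smul_pi.2 fun j => ?_)
    have := neg_mem (hpe i j)
    rwa [Matrix.one_apply, show (if i = j then (1 : F) else 0) = ε i j by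
            simp [ε, Pi.single_apply, eq_comm], neg_sub] at this
  choose x hx y hy hxy using hxy
  let q : n → n → F := fun i j => ρ (p i j + x i j)
  have hq1 : ∀ i, q i = p i + fun j => ρ (x i j) := by
    intro i; ext j; simp [q, hρp]
  have hρε : ∀ i j, ρ (ε i j) = ε i j := by
    intro i j
    by_cases h : j = i
    · subst h; simp [ε, hρ1]
    · simp [ε, h]
  have hq2 : ∀ i j, q i j = ε i j - ρ (y i j) := by
    intro i j
    have h := congrFun (hxy i) j
    simp only [Pi.add_apply, Pi.sub_apply] at h
    rw [← hρε i j, ← map_sub]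
    simp only [q]
    congr 1
    linear_combination h
  have hqP : ∀ i, q i ∈ P := fun i => by
    rw [hq1]
    exact add_mem (hp i) (Submodule.smul_le_right (hρP _ (hx i)))
  refine ⟨q, hqP, fun i j => hρρ _, ?_⟩
  set Z := polySpan A v q with hZ
  have hZv : ∀ x ∈ Z, v • x ∈ Z := fun x hx => smul_mem_polySpan q hx
  -- monic multiples of the standard basis
  obtain ⟨t, htm, ht⟩ : ∃ t : A[X], t.Monic ∧ ∀ k, aeval v t • ε k ∈ Z := by
    have hfr : ∀ ij : n × n, IsFrac v S I true (ρ (y ij.1 ij.2)) := fun ij =>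
      isFrac_of_mem_smul hS (hρE _ (mem_smul_pi.1 (hy ij.1) ij.2))
    obtain ⟨s, hsS, r, hrI, hrd, hr⟩ := IsFrac.common_univ hS _ hfr
    let r' : Matrix n n A[X] := Matrix.of fun i j => r (i, j)
    obtain ⟨c, hc⟩ := monic_unit_mul_det hI (hS s hsS) r' (fun i j => hrI (i, j))
      (fun i j => hrd rfl (i, j))
    set N := s • (1 : Matrix n n A[X]) - r' with hN
    refine ⟨_, hc, fun k => ?_⟩
    have h1 : ∀ i j, aeval v s * q i j = aeval v (N i j) := by
      intro i j
      rw [hq2, mul_sub, hr (i, j), hN, Matrix.sub_apply, map_sub]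
      congr 1
      rw [Matrix.smul_apply, Matrix.one_apply]
      by_cases h : i = j
      · subst h; simp [ε]
      · simp [ε, h, Ne.symm h]
    have h2 : aeval v N.det • ε k = ∑ i, aeval v (N.adjugate k i) • aeval v s • q i := by
      ext j
      simp only [Finset.sum_apply, Pi.smul_apply, smul_eq_mul, h1]
      simp only [← map_mul, ← map_sum]
      rw [← Matrix.mul_apply, Matrix.adjugate_mul, Matrix.smul_apply, Matrix.one_apply]
      by_cases h : k = j
      · subst h; simp [ε]
      · simp [ε, h, Ne.symm h]
    rw [map_mul, mul_smul, h2]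
    refine aeval_smul_mem hZv _ (sum_mem fun i _ => ?_)
    exact aeval_smul_mem hZv _ (aeval_smul_mem hZv _ (mem_polySpan q i))
  -- second application of Nakayama
  obtain ⟨Y, hYfg, hYP, hPY⟩ := exists_fg_sup g Z hZv fun i => by
    obtain ⟨s, hsS, r, -, -, hr⟩ := IsFrac.common_univ hS (g i) (hg i)
    refine ⟨t * s, htm.mul (hS s hsS), ?_⟩
    have : aeval v s • g i = ∑ j, aeval v (r j) • ε j := by
      ext k
      simp [hr, ε, Pi.single_apply]
    rw [map_mul, mul_smul, this, Finset.smul_sum]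
    refine sum_mem fun j _ => ?_
    rw [smul_comm]
    exact aeval_smul_mem hZv _ (ht j)
  have hpZ : polySpan A v p ≤ Z ⊔ I • P := by
    refine polySpan_le (fun x hx => ?_) fun i => ?_
    · obtain ⟨a, ha, b, hb, rfl⟩ := Submodule.mem_sup.1 hx
      rw [smul_add]
      exact Submodule.add_mem_sup (hZv _ ha) (smul_mem_smul hPv _ hb)
    · have : p i = q i + -(fun j => ρ (x i j)) := by rw [hq1]; abel
      rw [this]
      exact Submodule.add_mem_sup (mem_polySpan q i) (neg_mem (hρP _ (hx i)))
  have hPZ : P ≤ Z ⊔ I • Y := by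
    refine hgp.trans (sup_le hpZ le_sup_right |>.trans (sup_le le_sup_left ?_))
    refine (smul_mono_right I hPY).trans ?_
    rw [Submodule.smul_sup]
    exact sup_le_sup_right Submodule.smul_le_right _
  have hYZ : Y ≤ Z := Submodule.le_of_le_smul_of_le_jacobson_bot hYfg hI (hYP.trans hPZ)
  exact hPY.trans (sup_le le_rfl hYZ)

end Roberts

end

section

open Matrix Polynomial

namespace Roberts

variable {A F : Type*} [CommRing A] [CommRing F] [Algebra A F]
variable {v : F} {S : Submonoid A[X]} {I : Ideal A} {m n : Type*}

/-- Matrix form of the lifting theorem `Roberts.exists_generators`. -/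
theorem exists_split [Fintype m] [Fintype n] [DecidableEq n] (hS : ∀ s ∈ S, s.Monic)
    (hI : I ≤ Ideal.jacobson ⊥) {e : Matrix m m F} {U₁ : Matrix m n F} {W₁ : Matrix n m F}
    {Φ : Matrix n m F} {Ψ : Matrix m n F}
    (he : MatIn (aeval (R := A) v).range e) (hU₁ : MatIn (aeval (R := A) v).range U₁)
    (hW₁ : MatIn (aeval (R := A) v).range W₁)
    (hΦ : MatIn (fracs v S hS false) Φ) (hΨ : MatIn (fracs v S hS false) Ψ)
    (hΦΨ : Φ * Ψ = 1) (hΨΦ : Ψ * Φ = e)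
    (heU : MatIn (I • Subalgebra.toSubmodule (aeval (R := A) v).range) (e - U₁ * W₁))
    (hΦU : MatIn (I • fracs v S hS false) (Φ * U₁ - 1))
    (ρ : F →+ F) (hρρ : ∀ x, ρ (ρ x) = ρ x) (hρ1 : ρ 1 = 1)
    (hρU : ∀ i j, ρ (U₁ i j) = U₁ i j) (hρΦ : ∀ i j x, ρ (Φ i j * x) = Φ i j * ρ x)
    (hρB : ∀ x ∈ I • Subalgebra.toSubmodule (aeval (R := A) v).range,
      ρ x ∈ I • Subalgebra.toSubmodule (aeval (R := A) v).range)
    (hρE : ∀ x ∈ I • fracs v S hS true, ρ x ∈ I • fracs v S hS true) :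
    ∃ (Q : Matrix n n F) (z : Matrix n m F), (∀ i j, ρ (Q i j) = Q i j) ∧
      MatIn (aeval (R := A) v).range (Ψ * Q) ∧ MatIn (aeval (R := A) v).range z ∧
      Ψ * Q * z = e ∧ z * (Ψ * Q) = 1 := by
  classical
  set B := Subalgebra.toSubmodule (aeval (R := A) v).range with hB
  let g : m → n → F := fun k i => Φ i k
  have hgv : ∀ x ∈ polySpan A v g, v • x ∈ polySpan A v g := fun x hx => smul_mem_polySpan g hx
  have hBP : ∀ b ∈ (aeval (R := A) v).range, ∀ k, b • g k ∈ polySpan A v g := by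
    rintro _ ⟨b, rfl⟩ k
    exact aeval_smul_mem hgv b (mem_polySpan g k)
  have hIBP : ∀ y ∈ I • B, ∀ k, y • g k ∈ I • polySpan A v g := by
    intro y hy k
    induction hy using Submodule.smul_induction_on' with
    | smul a ha x hx => rw [smul_assoc]; exact Submodule.smul_mem_smul ha (hBP _ hx k)
    | add x _ y _ hx hy => rw [add_smul]; exact add_mem hx hy
  have hIP : ∀ x ∈ I • polySpan A v g, ∃ y : m → F, (∀ k, y k ∈ I • B) ∧
      x = ∑ k, y k • g k := by
    intro x hx
    induction hx using Submodule.smul_induction_on' with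
    | smul a ha x hx =>
      obtain ⟨b, rfl⟩ := exists_sum_of_mem_polySpan hx
      refine ⟨fun k => a • aeval v (b k), fun k => Submodule.smul_mem_smul ha ⟨b k, rfl⟩, ?_⟩
      simp only [Finset.smul_sum, smul_assoc]
    | add x _ y _ hx hy =>
      obtain ⟨b, hb, rfl⟩ := hx
      obtain ⟨c, hc, rfl⟩ := hy
      refine ⟨b + c, fun k => add_mem (hb k) (hc k), ?_⟩
      simp only [Pi.add_apply, add_smul, Finset.sum_add_distrib]
  have hΦe : Φ * e = Φ := by rw [← hΨΦ, ← Matrix.mul_assoc, hΦΨ, Matrix.one_mul]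
  let p : n → n → F := fun i j => (Φ * U₁) j i
  have hp_eq : ∀ i, p i = ∑ k, U₁ k i • g k := by
    intro i; ext j; simp [p, g, Matrix.mul_apply, mul_comm]
  have hρsum : ∀ y : m → F, (fun j => ρ ((∑ k, y k • g k) j)) = ∑ k, ρ (y k) • g k := by
    intro y
    ext j
    simp only [Finset.sum_apply, Pi.smul_apply, smul_eq_mul, map_sum, g]
    exact Finset.sum_congr rfl fun k _ => by rw [mul_comm, hρΦ, mul_comm]
  obtain ⟨q, hqP, hρq, hqgen⟩ := exists_generators hS hI g (fun k i => hΦ i k) p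
    (fun i => by
      rw [hp_eq]
      exact sum_mem fun k _ => hBP _ (hU₁ k i) k)
    (fun i j => by
      have := hΦU j i
      rwa [Matrix.sub_apply, Matrix.one_apply, show (if j = i then (1 : F) else 0) =
        (1 : Matrix n n F) i j by rw [Matrix.one_apply]; simp only [eq_comm]] at this)
    (polySpan_le (fun x hx => by
        obtain ⟨a, ha, b, hb, rfl⟩ := Submodule.mem_sup.1 hx
        rw [smul_add]
        exact Submodule.add_mem_sup (smul_mem_polySpan p ha) (smul_mem_smul hgv _ hb))
      fun k => by
        have h1 : g k = ∑ i, W₁ i k • p i + ∑ l, (e - U₁ * W₁) l k • g l := by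
          ext j
          have h2 : Φ j k = (Φ * U₁ * W₁ + Φ * (e - U₁ * W₁)) j k := by
            rw [Matrix.mul_sub, hΦe, Matrix.mul_assoc]; simp
          simp only [g, h2, Matrix.add_apply, Pi.add_apply, Finset.sum_apply, Pi.smul_apply,
            smul_eq_mul, p]
          rw [Matrix.mul_apply, Matrix.mul_apply (M := Φ) (N := e - U₁ * W₁)]
          simp only [mul_comm]
        rw [h1]
        refine Submodule.add_mem_sup (sum_mem fun i _ => ?_) (sum_mem fun l _ => ?_)
        · obtain ⟨b, hb⟩ := hW₁ i k
          rw [← hb]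
          exact aeval_smul_mem (fun x hx => smul_mem_polySpan p hx) b (mem_polySpan p i)
        · exact hIBP _ (heU l k) l)
    (fun i => by
      obtain ⟨s, hsS, r, -, -, hr⟩ := IsFrac.common_univ hS (fun k => Ψ k i) fun k => hΨ k i
      refine ⟨s, hsS, ?_⟩
      have : aeval v s • (Pi.single i 1 : n → F) = ∑ k, aeval v (r k) • g k := by
        ext j
        have h3 := congrFun₂ hΦΨ j i
        rw [Matrix.mul_apply] at h3
        simp only [← hr, Finset.sum_apply, Pi.smul_apply, smul_eq_mul, g]
        rw [Finset.sum_congr rfl fun k _ => (show aeval v s * Ψ k i * Φ j k =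
          aeval v s * (Φ j k * Ψ k i) by ring), ← Finset.mul_sum, h3, Matrix.one_apply,
          Pi.single_apply]
      rw [this]
      exact sum_mem fun k _ => hBP _ ⟨r k, rfl⟩ k)
    ρ hρρ hρ1
    (fun i j => by
      have := congrFun (hρsum fun k => U₁ k i) j
      simp only [hρU] at this
      rw [← hp_eq] at this
      exact this)
    (fun x hx => by
      obtain ⟨y, hy, rfl⟩ := hIP x hx
      rw [hρsum]
      exact sum_mem fun k _ => hIBP _ (hρB _ (hy k)) k)
    hρE
  let Q : Matrix n n F := Matrix.of fun i j => q j i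
  choose b hb using fun i => exists_sum_of_mem_polySpan (hqP i)
  choose c hc using fun k => exists_sum_of_mem_polySpan (hqgen (mem_polySpan g k))
  let b' : Matrix m n F := Matrix.of fun k i => aeval v (b i k)
  let z : Matrix n m F := Matrix.of fun i k => aeval v (c k i)
  have hQ : Q = Φ * b' := by
    ext i j
    have := congrFun (hb j) i
    simp only [Finset.sum_apply, Pi.smul_apply, smul_eq_mul, g] at this
    simp only [Q, b', Matrix.of_apply, Matrix.mul_apply, this, mul_comm]
  have hQz : Q * z = Φ := by
    ext i k
    have := congrFun (hc k) i
    simp only [Finset.sum_apply, Pi.smul_apply, smul_eq_mul, g] at this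
    simp only [Q, z, Matrix.of_apply, Matrix.mul_apply, this, mul_comm]
  have h1 : Q * (z * Ψ) = 1 := by rw [← Matrix.mul_assoc, hQz, hΦΨ]
  have h2 : z * Ψ * Q = 1 := mul_eq_one_comm.1 h1
  refine ⟨Q, z, fun i j => hρq j i, ?_, fun i k => ⟨c k i, rfl⟩, ?_, ?_⟩
  · rw [hQ, ← Matrix.mul_assoc, hΨΦ]
    exact he.mul fun k i => ⟨b i k, rfl⟩
  · rw [Matrix.mul_assoc, hQz, hΨΦ]
  · rw [← Matrix.mul_assoc, h2]

end Roberts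

end

section

open Matrix Polynomial

/-! ### Localizing a polynomial ring at the monic polynomials -/

/-- The monic polynomials. -/
def monics (R : Type*) [CommRing R] : Submonoid R[X] where
  carrier := {p | p.Monic}
  one_mem' := monic_one
  mul_mem' hp hq := hp.mul hq

theorem monics_le_nonZeroDivisors (R : Type*) [CommRing R] : monics R ≤ nonZeroDivisors R[X] :=
  fun _ hp => Polynomial.Monic.mem_nonZeroDivisors hp

/-- The ring `R⟨X⟩`, the localization of `R[X]` at all monic polynomials. -/
abbrev MonicLoc (R : Type*) [CommRing R] : Type _ := Localization (monics R)

instance (R : Type*) [CommRing R] [IsDomain R] : IsDomain (MonicLoc R) :=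
  IsLocalization.isDomain_localization (monics_le_nonZeroDivisors R)

section PID

variable {R : Type*} [CommRing R] [IsDomain R] [IsPrincipalIdealRing R]

theorem eq_span_of_constant_mem {q : Ideal R[X]} [q.IsPrime] (hq : ∀ s ∈ q, ¬ s.Monic) {c : R}
    (hc0 : c ≠ 0) (hc : C c ∈ q) : ∃ g, q = Ideal.span {g} := by
  obtain ⟨p, hp⟩ := IsPrincipalIdealRing.principal (q.comap (C : R →+* R[X]))
  have hpq : C p ∈ q := by
    have : p ∈ q.comap (C : R →+* R[X]) := hp ▸ Ideal.mem_span_singleton_self p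
    exact this
  have hp0 : p ≠ 0 := by
    rintro rfl
    have : c ∈ q.comap (C : R →+* R[X]) := hc
    rw [hp] at this
    exact hc0 (by simpa using this)
  have hpp : Prime p := by
    rw [← Ideal.span_singleton_prime hp0]
    have : Ideal.span {p} = q.comap (C : R →+* R[X]) := hp.symm
    rw [this]
    infer_instance
  refine ⟨C p, le_antisymm ?_ ((Ideal.span_singleton_le_iff_mem _).2 hpq)⟩
  have key : ∀ d : ℕ, ∀ f ∈ q, f.natDegree < d → C p ∣ f := by
    intro d
    induction d with
    | zero => intro f _ h; omega
    | succ d ih =>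
      intro f hf hd
      by_cases hpc : p ∣ f.leadingCoeff
      · have h1 : f.eraseLead = f - C f.leadingCoeff * X ^ f.natDegree := by
          rw [eq_sub_iff_add_eq, C_mul_X_pow_eq_monomial]
          exact f.eraseLead_add_monomial_natDegree_leadingCoeff
        have h2 : C p ∣ C f.leadingCoeff * X ^ f.natDegree :=
          Dvd.dvd.mul_right ((C : R →+* R[X]).map_dvd hpc) _
        have h3 : C p ∣ f.eraseLead := by
          by_cases hf0 : f.natDegree = 0
          · have : f.eraseLead = 0 := by
              rw [eq_C_of_natDegree_eq_zero hf0]; simp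
            rw [this]; exact dvd_zero _
          · refine ih _ ?_ ?_
            · rw [h1]
              exact sub_mem hf (Ideal.mem_of_dvd _ h2 hpq)
            · have := eraseLead_natDegree_le f
              omega
        have h4 : f = f.eraseLead + C f.leadingCoeff * X ^ f.natDegree := by rw [h1]; ring
        rw [h4]
        exact dvd_add h3 h2
      · exfalso
        obtain ⟨a, b, hab⟩ := (hpp.irreducible.coprime_iff_not_dvd).2 hpc
        refine hq (C (a * p) * X ^ f.natDegree + C b * f) ?_ ?_
        · rw [map_mul]
          refine add_mem (Ideal.mul_mem_right _ _ (Ideal.mul_mem_left _ _ hpq))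
            (Ideal.mul_mem_left _ _ hf)
        · refine monic_of_natDegree_le_of_coeff_eq_one f.natDegree ?_ ?_
          · exact (natDegree_add_le _ _).trans (max_le (natDegree_C_mul_X_pow_le _ _)
              (natDegree_C_mul_le _ _))
          · rw [coeff_add, coeff_C_mul_X_pow, if_pos rfl, coeff_C_mul]
            exact hab
  intro f hf
  exact Ideal.mem_span_singleton.2 (key _ f hf (Nat.lt_succ_self _))

theorem eq_span_of_forall_constant {q : Ideal R[X]} [hqp : q.IsPrime]
    (hq : ∀ c : R, C c ∈ q → c = 0) : ∃ g, q = Ideal.span {g} := by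
  by_cases h0 : q = ⊥
  · exact ⟨0, by simp [h0]⟩
  obtain ⟨g, hgq, hg⟩ := hqp.exists_mem_prime_of_ne_bot h0
  refine ⟨g, le_antisymm ?_ ((Ideal.span_singleton_le_iff_mem _).2 hgq)⟩
  set K := FractionRing R
  set φ : R[X] →+* K[X] := mapRingHom (algebraMap R K)
  let _ : Algebra R[X] K[X] := φ.toAlgebra
  have : IsLocalization ((nonZeroDivisors R).map (C : R →+* R[X])) K[X] :=
    Polynomial.isLocalization (nonZeroDivisors R) K
  have hdisj : ∀ J : Ideal R[X], J ≤ q →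
      Disjoint (((nonZeroDivisors R).map (C : R →+* R[X]) : Submonoid R[X]) : Set R[X]) J := by
    intro J hJ
    rw [Set.disjoint_left]
    rintro _ ⟨c, hc, rfl⟩ hcJ
    exact nonZeroDivisors.ne_zero hc (hq c (hJ hcJ))
  have hgprime : (Ideal.span {g}).IsPrime := (Ideal.span_singleton_prime hg.ne_zero).2 hg
  have hle : Ideal.span {g} ≤ q := (Ideal.span_singleton_le_iff_mem _).2 hgq
  have hp1 := IsLocalization.isPrime_of_isPrime_disjoint _ K[X] _ hgprime (hdisj _ hle)
  have hp2 := IsLocalization.isPrime_of_isPrime_disjoint _ K[X] _ hqp (hdisj _ le_rfl)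
  have hinj : Function.Injective φ := Polynomial.map_injective _ (IsFractionRing.injective R K)
  have hne : Ideal.map (algebraMap R[X] K[X]) (Ideal.span {g}) ≠ ⊥ := by
    rw [Ideal.map_span, Set.image_singleton, Ne, Ideal.span_singleton_eq_bot]
    exact fun h => hg.ne_zero (hinj (by rw [map_zero]; exact h))
  have hmax := hp1.isMaximal hne
  have heq := hmax.eq_of_le hp2.ne_top (Ideal.map_mono hle)
  rw [← IsLocalization.under_map_of_isPrime_disjoint ((nonZeroDivisors R).map (C : R →+* R[X]))
    K[X] hqp (hdisj _ le_rfl), ← heq,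
    IsLocalization.under_map_of_isPrime_disjoint ((nonZeroDivisors R).map (C : R →+* R[X]))
    K[X] hgprime (hdisj _ hle)]

instance : IsPrincipalIdealRing (MonicLoc R) := by
  refine IsPrincipalIdealRing.of_prime fun P hP => ?_
  obtain ⟨hp, hdisj⟩ := (IsLocalization.isPrime_iff_isPrime_disjoint (monics R) (MonicLoc R) P).1 hP
  have hno : ∀ s ∈ P.under R[X], ¬ s.Monic := fun s hs hsm =>
    Set.disjoint_left.1 hdisj hsm hs
  obtain ⟨g, hg⟩ : ∃ g, P.under R[X] = Ideal.span {g} := by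
    by_cases h : ∀ c : R, C c ∈ P.under R[X] → c = 0
    · exact eq_span_of_forall_constant h
    · push Not at h
      obtain ⟨c, hc, hc0⟩ := h
      exact eq_span_of_constant_mem hno hc0 hc
  refine ⟨algebraMap _ _ g, ?_⟩
  have := IsLocalization.map_under (monics R) (MonicLoc R) P
  rw [hg, Ideal.map_span, Set.image_singleton] at this
  exact this.symm

end PID

end

section

open Matrix Polynomial

/-! ### Idempotent matrices and projective modules -/

theorem exists_split_map {B B' m n : Type*} [CommRing B] [CommRing B'] [Fintype m] [Fintype n]
    [DecidableEq n] (f : B →+* B')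
    {e : Matrix m m B} {U : Matrix m n B} {W : Matrix n m B} (h1 : U * W = e) (h2 : W * U = 1) :
    U.map f * W.map f = e.map f ∧ W.map f * U.map f = 1 := by
  rw [← Matrix.map_mul, ← Matrix.map_mul, h1, h2]
  exact ⟨rfl, Matrix.map_one f (map_zero f) (map_one f)⟩

theorem IdemFree.of_ringEquiv {B B' : Type*} [CommRing B] [CommRing B'] (f : B ≃+* B')
    (h : IdemFree B) : IdemFree B' := by
  intro m e he
  obtain ⟨k, U, W, h1, h2⟩ := h m (e.map (f.symm : B' →+* B)) (by rw [← Matrix.map_mul, he])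
  obtain ⟨h3, h4⟩ := exists_split_map (f : B →+* B') h1 h2
  refine ⟨k, _, _, ?_, h4⟩
  rw [h3]
  ext i j; simp

/-- Transfer of `IdemFree` to the image in a larger ring. -/
theorem IdemFree.splitIn {B K σ : Type*} [CommRing B] [CommRing K] [SetLike σ K] {S : σ}
    (h : IdemFree B) (f : B →+* K) (hf : Function.Injective f) (hS : ∀ x, x ∈ S ↔ ∃ b, f b = x)
    (n : ℕ) (e : Matrix (Fin n) (Fin n) K) (he : MatIn S e) (hee : e * e = e) : SplitIn S e := by
  choose e' he' using fun i j => (hS _).1 (he i j)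
  have hm : (Matrix.of e').map f = e := by ext i j; exact he' i j
  obtain ⟨k, U, W, h1, h2⟩ := h n (Matrix.of e') (by
    apply Matrix.map_injective hf
    beta_reduce
    rw [Matrix.map_mul, hm, hee])
  obtain ⟨h3, h4⟩ := exists_split_map f h1 h2
  exact ⟨k, _, _, fun i j => (hS _).2 ⟨_, rfl⟩, fun i j => (hS _).2 ⟨_, rfl⟩, h3.trans hm, h4⟩

theorem idemFree_of_splitIn {B K σ : Type*} [CommRing B] [CommRing K] [SetLike σ K] {S : σ}
    (f : B →+* K) (hf : Function.Injective f) (hS : ∀ x, x ∈ S ↔ ∃ b, f b = x)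
    (h : ∀ (n : ℕ) (e : Matrix (Fin n) (Fin n) K), MatIn S e → e * e = e → SplitIn S e) :
    IdemFree B := by
  intro m e he
  obtain ⟨k, U, W, hU, hW, h1, h2⟩ := h m (e.map f) (fun i j => (hS _).2 ⟨_, rfl⟩)
    (by rw [← Matrix.map_mul, he])
  choose U' hU' using fun i j => (hS _).1 (hU i j)
  choose W' hW' using fun i j => (hS _).1 (hW i j)
  have hmU : (Matrix.of U').map f = U := by ext i j; exact hU' i j
  have hmW : (Matrix.of W').map f = W := by ext i j; exact hW' i j
  refine ⟨k, Matrix.of U', Matrix.of W', ?_, ?_⟩ <;> apply Matrix.map_injective hf <;> beta_reduce <;>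
    rw [Matrix.map_mul, hmU, hmW]
  · exact h1
  · rw [h2, Matrix.map_one f (map_zero f) (map_one f)]

theorem idemFree_of_pid (R : Type*) [CommRing R] [IsDomain R] [IsPrincipalIdealRing R] :
    IdemFree R := by
  intro m e he
  obtain ⟨k, b⟩ := Submodule.basisOfPid (Pi.basisFun R (Fin m)) (LinearMap.range e.mulVecLin)
  have hfix : ∀ x ∈ LinearMap.range e.mulVecLin, e.mulVecLin x = x := by
    rintro _ ⟨y, rfl⟩
    simp [Matrix.mulVec_mulVec, he]
  let u : (Fin k → R) →ₗ[R] (Fin m → R) :=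
    (LinearMap.range e.mulVecLin).subtype ∘ₗ b.equivFun.symm.toLinearMap
  let w : (Fin m → R) →ₗ[R] (Fin k → R) :=
    b.equivFun.toLinearMap ∘ₗ e.mulVecLin.rangeRestrict
  refine ⟨k, LinearMap.toMatrix' u, LinearMap.toMatrix' w, ?_, ?_⟩
  · rw [← LinearMap.toMatrix'_comp]
    apply Matrix.toLin'.injective
    rw [Matrix.toLin'_toMatrix']
    ext x i
    simp [u, w]
  · rw [← LinearMap.toMatrix'_comp]
    apply Matrix.toLin'.injective
    rw [Matrix.toLin'_toMatrix', Matrix.toLin'_one]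
    refine LinearMap.ext fun x => ?_
    have h1 : e.mulVecLin.rangeRestrict (u x) = b.equivFun.symm x := by
      apply Subtype.ext
      exact hfix _ (Subtype.mem _)
    simp only [LinearMap.comp_apply, LinearMap.id_apply, w, h1]
    exact b.equivFun.apply_symm_apply x

theorem IdemFree.allFGProjectiveFree {B M : Type*} [CommRing B] (h : IdemFree B) [AddCommGroup M]
    [Module B M] [Module.Finite B M] [Module.Projective B M] : Module.Free B M := by
  obtain ⟨m, f, hf⟩ := Module.Finite.exists_fin' B M
  obtain ⟨g, hg⟩ := Module.projective_lifting_property f LinearMap.id hf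
  have hfg : ∀ x, f (g x) = x := fun x => LinearMap.congr_fun hg x
  obtain ⟨k, U, W, h1, h2⟩ := h m (LinearMap.toMatrix' (g ∘ₗ f)) (by
    rw [← LinearMap.toMatrix'_comp]
    congr 1
    ext x i
    simp [hfg])
  have h1' : U.mulVecLin ∘ₗ W.mulVecLin = g ∘ₗ f := by
    rw [← Matrix.mulVecLin_mul, h1]
    exact Matrix.toLin'_toMatrix' _
  have h2' : W.mulVecLin ∘ₗ U.mulVecLin = LinearMap.id := by
    rw [← Matrix.mulVecLin_mul, h2, Matrix.mulVecLin_one]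
  have hU : ∀ x, g (f (U.mulVecLin x)) = U.mulVecLin x := by
    intro x
    have := LinearMap.congr_fun h1' (U.mulVecLin x)
    have h3 := LinearMap.congr_fun h2' x
    simp only [LinearMap.comp_apply, LinearMap.id_apply] at this h3
    rw [← this, h3]
  refine Module.Free.of_equiv (LinearEquiv.ofLinearMap (f ∘ₗ U.mulVecLin) (W.mulVecLin ∘ₗ g) ?_ ?_)
  · refine LinearMap.ext fun x => ?_
    have := LinearMap.congr_fun h1' (g x)
    simp only [LinearMap.comp_apply, LinearMap.id_apply] at this ⊢
    rw [this, hfg, hfg]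
  · refine LinearMap.ext fun x => ?_
    have := LinearMap.congr_fun h2' x
    simp only [LinearMap.comp_apply, LinearMap.id_apply] at this ⊢
    rw [hU, this]

end

section

open Matrix Polynomial

/-! ### Quillen patching -/

/-- Murray-von Neumann equivalence of matrices. -/
def MvN {B m n : Type*} [CommRing B] [Fintype m] [Fintype n] (e : Matrix m m B)
    (e' : Matrix n n B) : Prop :=
  ∃ (X : Matrix m n B) (Y : Matrix n m B), X * Y = e ∧ Y * X = e'

theorem MvN.trans {B m : Type*} [CommRing B] [Fintype m] {e e' e'' : Matrix m m B}
    (he : e * e = e) (he'' : e'' * e'' = e'') (h : MvN e e') (h' : MvN e' e'') : MvN e e'' := by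
  obtain ⟨X, Y, rfl, rfl⟩ := h
  obtain ⟨Z, T, h1, rfl⟩ := h'
  refine ⟨X * Z, T * Y, ?_, ?_⟩
  · calc X * Z * (T * Y) = X * (Z * T) * Y := by simp only [Matrix.mul_assoc]
      _ = (X * Y) * (X * Y) := by rw [h1]; simp only [Matrix.mul_assoc]
      _ = X * Y := he
  · calc T * Y * (X * Z) = T * (Y * X) * Z := by simp only [Matrix.mul_assoc]
      _ = (T * Z) * (T * Z) := by rw [← h1]; simp only [Matrix.mul_assoc]
      _ = T * Z := he''

section patch

variable {A : Type*} [CommRing A] [IsDomain A] {m : Type*} [Fintype m]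

theorem sub_dvd_comp_sub (a b p : A[X]) : a - b ∣ p.comp a - p.comp b := by
  have h : ∀ q : A[X], p.comp q = (p.map C).eval q := fun q => by
    rw [Polynomial.comp, eval₂_eq_eval_map]
  rw [h, h]
  exact sub_dvd_eval_sub a b _

theorem mvN_comp_of_sub {k : Type*} [Fintype k] [DecidableEq k]
    {e : Matrix m m A[X]} {f : A} (hf : f ≠ 0)
    {U : Matrix m k A[X]} {W : Matrix k m A[X]} (hUW : U * W = C f • e) (hWU : W * U = C f • 1)
    {a b : A[X]} (hab : C f ∣ a - b) :
    MvN (e.map (compRingHom a)) (e.map (compRingHom b)) := by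
  set φ := compRingHom a
  set ψ := compRingHom b
  have hf' : (C f : A[X]) ≠ 0 := C_ne_zero.2 hf
  have hφf : φ (C f) = C f := by simp [φ]
  have hψf : ψ (C f) = C f := by simp [ψ]
  have hUW1 : ∀ χ : A[X] →+* A[X], χ (C f) = C f → U.map χ * W.map χ = C f • e.map χ := by
    intro χ h
    rw [← Matrix.map_mul, hUW]
    ext i j; simp [h]
  have hWU1 : ∀ χ : A[X] →+* A[X], χ (C f) = C f → W.map χ * U.map χ = C f • 1 := by
    intro χ h
    rw [← Matrix.map_mul, hWU]
    ext1 i j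
    simp only [Matrix.map_apply, Matrix.smul_apply, smul_eq_mul, map_mul, h, Matrix.one_apply]
    split_ifs <;> simp
  have key : ∀ χ χ' : A[X] →+* A[X], χ (C f) = C f → (∀ p, C f ∣ χ' p - χ p) →
      ∃ β : Matrix m m A[X], C f • β = U.map χ' * W.map χ := by
    intro χ χ' hχ hd
    have : ∀ i j, C f ∣ (U.map χ' * W.map χ) i j := by
      intro i j
      have h1 : (U.map χ' * W.map χ) i j = C f * χ (e i j) +
          ∑ l, (χ' (U i l) - χ (U i l)) * χ (W l j) := by
        have h2 := congrFun₂ (hUW1 χ hχ) i j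
        simp only [Matrix.mul_apply, Matrix.smul_apply, Matrix.map_apply, smul_eq_mul] at h2 ⊢
        rw [← h2, ← Finset.sum_add_distrib]
        exact Finset.sum_congr rfl fun l _ => by ring
      rw [h1]
      exact dvd_add (dvd_mul_right _ _) (Finset.dvd_sum fun l _ => Dvd.dvd.mul_right (hd _) _)
    choose β hβ using this
    exact ⟨Matrix.of β, by ext1 i j; rw [hβ i j]; rfl⟩
  obtain ⟨β, hβ⟩ := key ψ φ hψf fun p => hab.trans (sub_dvd_comp_sub a b p)
  obtain ⟨γ, hγ⟩ := key φ ψ hφf fun p => by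
    have := hab.trans (sub_dvd_comp_sub a b p)
    rw [← dvd_neg, neg_sub] at this
    exact this
  have hcancel : ∀ M N : Matrix m m A[X], (C f * C f) • M = (C f * C f) • N → M = N := by
    intro M N h
    ext1 i j
    exact mul_left_cancel₀ (mul_ne_zero hf' hf') (congrFun₂ h i j)
  have hprod : ∀ (χ χ' : A[X] →+* A[X]), χ (C f) = C f → χ' (C f) = C f →
      (U.map χ * W.map χ') * (U.map χ' * W.map χ) = (C f * C f) • e.map χ := by
    intro χ χ' h h'
    calc _ = U.map χ * (W.map χ' * U.map χ') * W.map χ := by simp only [Matrix.mul_assoc]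
      _ = _ := by rw [hWU1 χ' h', Matrix.mul_smul, Matrix.mul_one, Matrix.smul_mul, hUW1 χ h,
        smul_smul]
  refine ⟨β, γ, hcancel _ _ ?_, hcancel _ _ ?_⟩
  · rw [← hprod φ ψ hφf hψf, ← hβ, ← hγ, Matrix.smul_mul, Matrix.mul_smul, smul_smul]
  · rw [← hprod ψ φ hψf hφf, ← hβ, ← hγ, Matrix.smul_mul, Matrix.mul_smul, smul_smul]

theorem exists_split_of_local (hA : IdemFree A) {m : ℕ} {e : Matrix (Fin m) (Fin m) A[X]}
    (he : e * e = e)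
    (hloc : ∀ M : Ideal A, M.IsMaximal → ∃ f ∉ M, ∃ (k : ℕ) (U : Matrix (Fin m) (Fin k) A[X])
      (W : Matrix (Fin k) (Fin m) A[X]), U * W = C f • e ∧ W * U = C f • 1) :
    ∃ (k : ℕ) (U : Matrix (Fin m) (Fin k) A[X]) (W : Matrix (Fin k) (Fin m) A[X]),
      U * W = e ∧ W * U = 1 := by
  have hidem : ∀ a, e.map (compRingHom a) * e.map (compRingHom a) = e.map (compRingHom a) :=
    fun a => by rw [← Matrix.map_mul, he]
  have htop : (1 : A) ∈ Ideal.span {f : A | ∀ c d : A,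
      MvN (e.map (compRingHom (C (c + d * f) * X))) (e.map (compRingHom (C c * X)))} := by
    rw [← Ideal.eq_top_iff_one]
    by_contra hne
    obtain ⟨M, hM, hle⟩ := Ideal.exists_le_maximal _ hne
    obtain ⟨f, hf, k, U, W, h1, h2⟩ := hloc M hM
    refine hf (hle (Ideal.subset_span fun c d => ?_))
    refine mvN_comp_of_sub (by rintro rfl; exact hf M.zero_mem) h1 h2 ⟨C d * X, ?_⟩
    rw [map_add, map_mul]; ring
  have hall : ∀ f ∈ Ideal.span {f : A | ∀ c d : A,
      MvN (e.map (compRingHom (C (c + d * f) * X))) (e.map (compRingHom (C c * X)))},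
      ∀ c d : A, MvN (e.map (compRingHom (C (c + d * f) * X))) (e.map (compRingHom (C c * X))) := by
    intro f hf
    induction hf using Submodule.span_induction with
    | mem f h => exact h
    | zero => intro c d; rw [mul_zero, add_zero]; exact ⟨_, _, hidem _, hidem _⟩
    | add x y _ _ hx hy =>
      intro c d
      have := hy (c + d * x) d
      rw [show c + d * (x + y) = c + d * x + d * y by ring]
      exact MvN.trans (hidem _) (hidem _) this (hx c d)
    | smul a x _ hx =>
      intro c d
      have := hx c (d * a)
      rwa [mul_assoc] at this
  have h1 := hall 1 htop 0 1
  have hX : e.map (compRingHom (C (0 + 1 * 1 : A) * X)) = e := by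
    ext1 i j; simp
  have h0 : e.map (compRingHom (C (0 : A) * X)) = (e.map (evalRingHom 0)).map (C : A →+* A[X]) := by
    ext1 i j; simp
  rw [hX, h0] at h1
  obtain ⟨X, Y, hXY, hYX⟩ := h1
  obtain ⟨k, U, W, h3, h4⟩ := hA m (e.map (evalRingHom 0)) (by rw [← Matrix.map_mul, he])
  obtain ⟨h5, h6⟩ := exists_split_map (C : A →+* A[X]) h3 h4
  rw [← hYX] at h5
  refine ⟨k, X * U.map C, W.map C * Y, ?_, ?_⟩
  · calc X * U.map C * (W.map C * Y) = X * (U.map C * W.map C) * Y := by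
          simp only [Matrix.mul_assoc]
      _ = (X * Y) * (X * Y) := by rw [h5]; simp only [Matrix.mul_assoc]
      _ = e := by rw [hXY, he]
  · calc W.map C * Y * (X * U.map C) = W.map C * (Y * X) * U.map C := by
          simp only [Matrix.mul_assoc]
      _ = (W.map C * U.map C) * (W.map C * U.map C) := by
          rw [← h5]; simp only [Matrix.mul_assoc]
      _ = 1 := by rw [h6, Matrix.one_mul]

end patch

end

section

open Matrix Polynomial

/-! ### Clearing denominators -/

theorem exists_split_of_isLocalization {B B' : Type*} [CommRing B] [CommRing B'] [Algebra B B']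
    (S : Submonoid B) [IsLocalization S B'] (hS : S ≤ nonZeroDivisors B) {m k : Type*} [Fintype m]
    [Fintype k] [DecidableEq k] {e : Matrix m m B} {U : Matrix m k B'} {W : Matrix k m B'}
    (h1 : U * W = e.map (algebraMap B B')) (h2 : W * U = 1) :
    ∃ s ∈ S, ∃ (U' : Matrix m k B) (W' : Matrix k m B), U' * W' = s • e ∧ W' * U' = s • 1 := by
  have hinj : Function.Injective (algebraMap B B') := IsLocalization.injective B' hS
  obtain ⟨a, ha⟩ := IsLocalization.exist_integer_multiples_of_finite S
    (fun p : m × k => U p.1 p.2)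
  obtain ⟨b, hb⟩ := IsLocalization.exist_integer_multiples_of_finite S
    (fun p : k × m => W p.1 p.2)
  choose U' hU' using fun i j => ha (i, j)
  choose W' hW' using fun i j => hb (i, j)
  have hU : (Matrix.of U').map (algebraMap B B') = algebraMap B B' a • U := by
    ext i j; simp [hU', Algebra.smul_def]
  have hW : (Matrix.of W').map (algebraMap B B') = algebraMap B B' b • W := by
    ext i j; simp [hW', Algebra.smul_def]
  refine ⟨a * b, mul_mem a.2 b.2, Matrix.of U', Matrix.of W', ?_, ?_⟩ <;>
    apply Matrix.map_injective hinj <;> beta_reduce <;> rw [Matrix.map_mul, hU, hW,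
      Matrix.smul_mul, Matrix.mul_smul, smul_smul]
  · rw [h1]; ext i j; simp
  · rw [h2, mul_comm]
    ext1 i j
    simp only [Matrix.smul_apply, Matrix.map_apply, smul_eq_mul, Matrix.one_apply, map_mul]
    split_ifs <;> simp

/-! ### Lifting invertible matrices -/

theorem exists_invertible_lift {F k : Type*} [CommRing F] [Field k] (π : F →+* k)
    (hπ : ∀ y : k, y ≠ 0 → ∃ x x' : F, x * x' = 1 ∧ π x = y) {n : Type*} [Fintype n]
    [DecidableEq n] (G : Matrix n n k) (hG : G.det ≠ 0) :
    ∃ N N' : Matrix n n F, N * N' = 1 ∧ N.map π = G := by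
  refine Matrix.diagonal_transvection_induction_of_det_ne_zero
    (fun G => ∃ N N' : Matrix n n F, N * N' = 1 ∧ N.map π = G) G hG ?_ ?_ ?_
  · intro D hD
    rw [Matrix.det_diagonal, Finset.prod_ne_zero_iff] at hD
    choose x x' h1 h2 using fun i => hπ (D i) (hD i (Finset.mem_univ _))
    refine ⟨Matrix.diagonal x, Matrix.diagonal x', ?_, ?_⟩
    · rw [Matrix.diagonal_mul_diagonal]; simp [h1]
    · rw [Matrix.diagonal_map (map_zero π)]; congr 1; ext i; exact h2 i
  · intro t
    obtain ⟨c, hc⟩ : ∃ c, π c = t.c := by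
      by_cases h : t.c = 0
      · exact ⟨0, by rw [h, map_zero]⟩
      · obtain ⟨x, -, -, h⟩ := hπ _ h
        exact ⟨x, h⟩
    refine ⟨Matrix.transvection t.i t.j c, Matrix.transvection t.i t.j (-c), ?_, ?_⟩
    · rw [Matrix.transvection_mul_transvection_same _ _ t.hij]; simp
    · ext i j
      simp only [Matrix.map_apply, Matrix.transvection, Matrix.TransvectionStruct.toMatrix,
        Matrix.add_apply, map_add, Matrix.single_apply, Matrix.one_apply]
      split_ifs <;> simp [hc]
  · rintro A B - - ⟨N, N', h1, rfl⟩ ⟨M, M', h2, rfl⟩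
    refine ⟨N * M, M' * N', ?_, Matrix.map_mul⟩
    calc N * M * (M' * N') = N * (M * M') * N' := by simp only [Matrix.mul_assoc]
      _ = 1 := by rw [h2, Matrix.mul_one, h1]

section local_step

variable {O : Type*} [CommRing O] [IsDomain O] [IsLocalRing O]

/-- Reduction of `O⟨X⟩` to the field of rational functions over the residue field. -/
noncomputable def MonicLoc.red (O : Type*) [CommRing O] [IsLocalRing O] :
    MonicLoc O →+* FractionRing (IsLocalRing.ResidueField O)[X] :=
  IsLocalization.lift (M := monics O) (g := (algebraMap (IsLocalRing.ResidueField O)[X] _).comp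
    (mapRingHom (IsLocalRing.residue O))) fun s => by
      rw [isUnit_iff_ne_zero, RingHom.comp_apply, Ne, FaithfulSMul.algebraMap_eq_zero_iff]
      exact (s.2.map _).ne_zero

theorem MonicLoc.red_algebraMap (p : O[X]) : MonicLoc.red O (algebraMap _ _ p) =
    algebraMap (IsLocalRing.ResidueField O)[X] _ (p.map (IsLocalRing.residue O)) :=
  IsLocalization.lift_eq _ _

theorem MonicLoc.exists_unit_lift (y : FractionRing (IsLocalRing.ResidueField O)[X]) (hy : y ≠ 0) :
    ∃ x x' : MonicLoc O, x * x' = 1 ∧ MonicLoc.red O x = y := by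
  have hpoly : ∀ p : (IsLocalRing.ResidueField O)[X], p ≠ 0 → ∃ x x' : MonicLoc O,
      x * x' = 1 ∧ MonicLoc.red O x = algebraMap _ _ p := by
    intro p hp
    obtain ⟨c, hc⟩ := IsLocalRing.residue_surjective p.leadingCoeff
    have hcu : IsUnit c := by
      by_contra h
      rw [← mem_nonunits_iff, ← IsLocalRing.mem_maximalIdeal, ← IsLocalRing.residue_eq_zero_iff,
        hc, leadingCoeff_eq_zero] at h
      exact hp h
    obtain ⟨d, hd⟩ := hcu.exists_right_inv
    have hmon : (p * C p.leadingCoeff⁻¹).Monic := monic_mul_leadingCoeff_inv hp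
    obtain ⟨q, hq, -, hqm⟩ := lifts_and_natDegree_eq_and_monic (f := IsLocalRing.residue O)
      ((mem_lifts _).2 (map_surjective _ IsLocalRing.residue_surjective _)) hmon
    have hu := IsLocalization.mk'_spec (MonicLoc O) (1 : O[X]) (⟨q, hqm⟩ : monics O)
    refine ⟨algebraMap _ _ (q * C c), IsLocalization.mk' (MonicLoc O) (1 : O[X])
      (⟨q, hqm⟩ : monics O) * algebraMap _ _ (C d), ?_, ?_⟩
    · calc _ = (IsLocalization.mk' (MonicLoc O) (1 : O[X]) (⟨q, hqm⟩ : monics O) *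
          algebraMap _ _ q) * algebraMap _ _ (C (c * d)) := by simp only [map_mul]; ring
        _ = 1 := by rw [hu, hd]; simp
    · rw [MonicLoc.red_algebraMap, Polynomial.map_mul, hq, map_C, hc, mul_assoc, ← C_mul,
        inv_mul_cancel₀ (leadingCoeff_ne_zero.2 hp), C_1, mul_one]
  obtain ⟨p, q, hq, rfl⟩ := IsFractionRing.div_surjective (IsLocalRing.ResidueField O)[X] y
  have hq0 : q ≠ 0 := nonZeroDivisors.ne_zero hq
  have hp0 : p ≠ 0 := by rintro rfl; simp at hy
  obtain ⟨x, x', h1, h2⟩ := hpoly p hp0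
  obtain ⟨z, z', h3, h4⟩ := hpoly q hq0
  refine ⟨x * z', x' * z, by linear_combination h1 * (z' * z) + h3, ?_⟩
  have h5 : MonicLoc.red O z * MonicLoc.red O z' = 1 := by rw [← map_mul, h3, map_one]
  rw [map_mul, h2, div_eq_mul_inv, ← h4, eq_inv_of_mul_eq_one_right h5]

theorem coeff_smul_induction {R M : Type*} [CommRing R] [AddCommGroup M] [Module R M] (I : Ideal R)
    (N : Submodule R M) (f : R[X] →ₗ[R] M) (hf : ∀ p, f p ∈ N) (p : R[X])
    (hp : ∀ k, p.coeff k ∈ I) : f p ∈ I • N := by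
  rw [p.as_sum_range, map_sum]
  refine sum_mem fun k _ => ?_
  rw [← mul_one (p.coeff k), ← smul_eq_mul, ← smul_monomial, map_smul]
  exact Submodule.smul_mem_smul (hp k) (hf _)

theorem fracs_monicLoc (x : MonicLoc O) :
    x ∈ Roberts.fracs (algebraMap O[X] (MonicLoc O) X) (monics O) (fun _ h => h) false := by
  obtain ⟨⟨b, s⟩, rfl⟩ := IsLocalization.mk'_surjective (monics O) x
  refine ⟨s, s.2, b, by simp, by simp, ?_⟩
  rw [aeval_algebraMap_apply, aeval_algebraMap_apply, aeval_X_left_apply, aeval_X_left_apply]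
  exact IsLocalization.mk'_spec' _ _ _

theorem MonicLoc.mem_of_red_eq_zero (x : MonicLoc O) (hx : MonicLoc.red O x = 0) :
    x ∈ IsLocalRing.maximalIdeal O • (⊤ : Submodule O (MonicLoc O)) := by
  obtain ⟨⟨b, s⟩, rfl⟩ := IsLocalization.mk'_surjective (monics O) x
  have hs := IsLocalization.mk'_spec (MonicLoc O) b s
  have hb : b.map (IsLocalRing.residue O) = 0 := by
    have := congrArg (MonicLoc.red O) hs
    rw [map_mul, hx, zero_mul, MonicLoc.red_algebraMap] at this
    exact (FaithfulSMul.algebraMap_eq_zero_iff _ _).1 this.symm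
  have hu := IsLocalization.mk'_spec (MonicLoc O) 1 s
  have := coeff_smul_induction (IsLocalRing.maximalIdeal O) (⊤ : Submodule O (MonicLoc O))
    ((LinearMap.mulLeft O (IsLocalization.mk' (MonicLoc O) 1 s)).comp
      (Algebra.linearMap O[X] (MonicLoc O) |>.restrictScalars O)) (fun _ => trivial) b (fun k => by
      rw [← IsLocalRing.residue_eq_zero_iff, ← coeff_map, hb, coeff_zero])
  convert this using 1
  simp only [LinearMap.comp_apply, LinearMap.mulLeft_apply, LinearMap.restrictScalars_apply,
    Algebra.linearMap_apply]
  rw [← hs, mul_left_comm, map_one] at *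
  linear_combination (-IsLocalization.mk' (MonicLoc O) b s) * hu

theorem exists_split_of_isLocalRing {m k : ℕ} {e : Matrix (Fin m) (Fin m) O[X]} (he : e * e = e)
    {s : O[X]} (hs : s.Monic) {U₀ : Matrix (Fin m) (Fin k) O[X]} {W₀ : Matrix (Fin k) (Fin m) O[X]}
    (h1 : U₀ * W₀ = s • e) (h2 : W₀ * U₀ = s • 1) :
    ∃ (k : ℕ) (U : Matrix (Fin m) (Fin k) O[X]) (W : Matrix (Fin k) (Fin m) O[X]),
      U * W = e ∧ W * U = 1 := by
  set κ := IsLocalRing.ResidueField O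
  set F := MonicLoc O
  set r := mapRingHom (IsLocalRing.residue O)
  have hr : Function.Surjective r := map_surjective _ IsLocalRing.residue_surjective
  set ι := algebraMap O[X] F
  have hι : Function.Injective ι := IsLocalization.injective _ (monics_le_nonZeroDivisors O)
  set π := MonicLoc.red O
  set j := algebraMap κ[X] (FractionRing κ[X])
  have hπ : ∀ p, π (ι p) = j (r p) := MonicLoc.red_algebraMap
  obtain ⟨k', Ub, Wb, h3, h4⟩ := idemFree_of_pid κ[X] m (e.map r) (by rw [← Matrix.map_mul, he])
  choose U₁ hU₁ using fun i j => hr (Ub i j)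
  choose W₁ hW₁ using fun i j => hr (Wb i j)
  have hU1 : (Matrix.of U₁).map r = Ub := by ext1 i j; exact hU₁ i j
  have hW1 : (Matrix.of W₁).map r = Wb := by ext1 i j; exact hW₁ i j
  generalize Matrix.of U₁ = U₁ at hU1
  generalize Matrix.of W₁ = W₁ at hW1
  have hjs : j (r s) ≠ 0 := by
    rw [Ne, FaithfulSMul.algebraMap_eq_zero_iff]
    exact (hs.map _).ne_zero
  have h3' := congrArg (fun M => M.map j) h3
  have h4' := congrArg (fun M => M.map j) h4
  have h1' := congrArg (fun M => (M.map r).map j) h1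
  have h2' := congrArg (fun M => (M.map r).map j) h2
  have hsm : ∀ (x : O[X]) {a b : Type} (M : Matrix a b O[X]),
      ((x • M).map r).map j = j (r x) • (M.map r).map j := by
    intros; ext1; simp
  have hone : ∀ {a : Type} [DecidableEq a], ((1 : Matrix a a O[X]).map r).map j = 1 := by
    intros; rw [Matrix.map_one _ (map_zero _) (map_one _), Matrix.map_one _ (map_zero _) (map_one _)]
  simp only [Matrix.map_mul, hsm, hone] at h1' h2' h3' h4'
  rw [Matrix.map_one _ (map_zero _) (map_one _)] at h4'
  have hee : (e.map r).map j * (e.map r).map j = (e.map r).map j := by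
    rw [← Matrix.map_mul, ← Matrix.map_mul, he]
  set E := (e.map r).map j
  set u₀ := (U₀.map r).map j
  set w₀ := (W₀.map r).map j
  set u₁ := Ub.map j
  set w₁ := Wb.map j
  have hGH : (w₀ * u₁) * ((j (r s))⁻¹ • (w₁ * u₀)) = 1 := by
    have hs1 : w₀ * E * u₀ = j (r s) • 1 := by
      have : j (r s) • (w₀ * E * u₀) = j (r s) • (j (r s) • 1) := by
        calc _ = w₀ * (j (r s) • E) * u₀ := by rw [Matrix.mul_smul, Matrix.smul_mul]
          _ = (w₀ * u₀) * (w₀ * u₀) := by rw [← h1']; simp only [Matrix.mul_assoc]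
          _ = _ := by rw [h2', Matrix.smul_mul, Matrix.one_mul]
      exact smul_right_injective _ hjs this
    rw [Matrix.mul_smul]
    calc _ = (j (r s))⁻¹ • (w₀ * (u₁ * w₁) * u₀) := by simp only [Matrix.mul_assoc]
      _ = 1 := by rw [h3', hs1, smul_smul, inv_mul_cancel₀ hjs, one_smul]
  have hHG : ((j (r s))⁻¹ • (w₁ * u₀)) * (w₀ * u₁) = 1 := by
    rw [Matrix.smul_mul]
    calc _ = (j (r s))⁻¹ • (w₁ * (u₀ * w₀) * u₁) := by simp only [Matrix.mul_assoc]
      _ = (w₁ * E * u₁) := by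
        rw [h1', Matrix.mul_smul, Matrix.smul_mul, smul_smul, inv_mul_cancel₀ hjs, one_smul]
      _ = (w₁ * u₁) * (w₁ * u₁) := by rw [← h3']; simp only [Matrix.mul_assoc]
      _ = 1 := by rw [h4', Matrix.one_mul]
  obtain rfl : k = k' := by
    simpa using Matrix.square_of_invertible _ _ hGH hHG
  have hdet : (w₀ * u₁).det ≠ 0 := by
    intro h
    have := congrArg Matrix.det hGH
    rw [Matrix.det_mul, h, zero_mul, Matrix.det_one] at this
    exact zero_ne_one this
  obtain ⟨N, N', hN, hNG⟩ := exists_invertible_lift π MonicLoc.exists_unit_lift _ hdet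
  have hN' : N' * N = 1 := mul_eq_one_comm.1 hN
  have hsi := IsLocalization.mk'_spec F 1 (⟨s, hs⟩ : monics O)
  set si := IsLocalization.mk' F 1 (⟨s, hs⟩ : monics O)
  rw [map_one] at hsi
  set v := ι X
  have hmem : ∀ p, ι p ∈ (aeval (R := O) v).range := fun p => ⟨p, by
    change aeval (ι X) p = _
    rw [aeval_algebraMap_apply, aeval_X_left_apply]⟩
  have hmem' : ∀ x ∈ (aeval (R := O) v).range, ∃ p, ι p = x := by
    rintro _ ⟨p, rfl⟩
    refine ⟨p, ?_⟩
    change _ = aeval (ι X) p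
    rw [aeval_algebraMap_apply, aeval_X_left_apply]
  have h1i : U₀.map ι * W₀.map ι = ι s • e.map ι := by
    rw [← Matrix.map_mul, h1]; ext1; simp
  have h2i : W₀.map ι * U₀.map ι = ι s • 1 := by
    rw [← Matrix.map_mul, h2]; ext1 i j
    simp only [Matrix.map_apply, Matrix.smul_apply, smul_eq_mul, Matrix.one_apply, map_mul]
    split_ifs <;> simp
  have htop : Roberts.fracs v (monics O) (fun _ h => h) false = ⊤ :=
    eq_top_iff.2 fun x _ => fracs_monicLoc x
  obtain ⟨Q, z, -, h5, h6, h7, h8⟩ := Roberts.exists_split (v := v) (S := monics O)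
    (I := IsLocalRing.maximalIdeal O) (e := e.map ι) (U₁ := U₁.map ι) (W₁ := W₁.map ι)
    (Φ := N' * W₀.map ι) (Ψ := si • (U₀.map ι * N)) (fun _ h => h)
    (IsLocalRing.maximalIdeal_le_jacobson _) (fun _ _ => hmem _) (fun _ _ => hmem _)
    (fun _ _ => hmem _) (by rw [htop]; exact fun _ _ => trivial)
    (by rw [htop]; exact fun _ _ => trivial)
    (by
      rw [Matrix.mul_smul]
      calc _ = si • (N' * (W₀.map ι * U₀.map ι) * N) := by simp only [Matrix.mul_assoc]
        _ = 1 := by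
          rw [h2i, Matrix.mul_smul, Matrix.mul_one, Matrix.smul_mul, hN', smul_smul, hsi, one_smul])
    (by
      rw [Matrix.smul_mul]
      calc _ = si • (U₀.map ι * (N * N') * W₀.map ι) := by simp only [Matrix.mul_assoc]
        _ = _ := by rw [hN, Matrix.mul_one, h1i, smul_smul, hsi, one_smul])
    (by
      intro a b
      have hx : (e - U₁ * W₁).map r = 0 := by
        ext1 i j
        have := congrFun₂ h3 i j
        rw [← hU1, ← hW1, ← Matrix.map_mul] at this
        simp only [Matrix.map_apply, Matrix.sub_apply, map_sub, Matrix.zero_apply] at this ⊢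
        rw [this, sub_self]
      rw [← Matrix.map_mul, Matrix.sub_apply, Matrix.map_apply, Matrix.map_apply, ← map_sub]
      refine coeff_smul_induction (IsLocalRing.maximalIdeal O)
        (Subalgebra.toSubmodule (aeval (R := O) v).range)
        (Algebra.linearMap O[X] F |>.restrictScalars O) (fun p => hmem p) _ fun k => ?_
      rw [← IsLocalRing.residue_eq_zero_iff, ← coeff_map]
      exact (congrArg (fun p => coeff p k) (congrFun₂ hx a b)).trans (coeff_zero _))
    (by
      rw [htop]
      intro a b
      refine MonicLoc.mem_of_red_eq_zero _ ?_
      have hx : (N' * W₀.map ι * U₁.map ι).map π = 1 := by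
        have hW0 : (W₀.map ι).map π = w₀ := by ext1; simp [w₀, hπ]
        have hU1' : (U₁.map ι).map π = u₁ := by ext1; simp [u₁, hπ, ← hU1]
        rw [Matrix.mul_assoc, Matrix.map_mul, Matrix.map_mul, hW0, hU1', ← hNG, ← Matrix.map_mul, hN',
          Matrix.map_one _ (map_zero _) (map_one _)]
      have := congrFun₂ hx a b
      rw [Matrix.map_apply] at this
      rw [Matrix.sub_apply, map_sub, this, Matrix.one_apply, Matrix.one_apply]
      split_ifs <;> simp)
    (AddMonoidHom.id F) (fun _ => rfl) rfl (fun _ _ => rfl) (fun _ _ _ => rfl) (fun _ h => h)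
    (fun _ h => h)
  choose U hU using fun i j => hmem' _ (h5 i j)
  choose W hW using fun i j => hmem' _ (h6 i j)
  have hU' : (Matrix.of U).map ι = si • (U₀.map ι * N) * Q := by ext1 i j; exact hU i j
  have hW' : (Matrix.of W).map ι = z := by ext1 i j; exact hW i j
  refine ⟨k, Matrix.of U, Matrix.of W, ?_, ?_⟩ <;> apply Matrix.map_injective hι <;> beta_reduce <;>
    rw [Matrix.map_mul, hU', hW']
  · exact h7
  · rw [h8, Matrix.map_one _ (map_zero _) (map_one _)]

end local_step

end

section

open Matrix Polynomial

/-! ### The theorem of Quillen and Suslin over principal ideal domains -/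

theorem exists_split_of_monic {A : Type*} [CommRing A] [IsDomain A] (hA : IdemFree A) {m k : ℕ}
    {e : Matrix (Fin m) (Fin m) A[X]} (he : e * e = e) {s : A[X]} (hs : s.Monic)
    {U₀ : Matrix (Fin m) (Fin k) A[X]} {W₀ : Matrix (Fin k) (Fin m) A[X]}
    (h1 : U₀ * W₀ = s • e) (h2 : W₀ * U₀ = s • 1) :
    ∃ (k : ℕ) (U : Matrix (Fin m) (Fin k) A[X]) (W : Matrix (Fin k) (Fin m) A[X]),
      U * W = e ∧ W * U = 1 := by
  refine exists_split_of_local hA he fun M hM => ?_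
  have hle : M.primeCompl ≤ nonZeroDivisors A := Ideal.primeCompl_le_nonZeroDivisors M
  have : IsDomain (Localization.AtPrime M) := IsLocalization.isDomain_localization hle
  let : Algebra A[X] (Localization.AtPrime M)[X] :=
    (mapRingHom (algebraMap A (Localization.AtPrime M))).toAlgebra
  have : IsLocalization (M.primeCompl.map (C : A →+* A[X])) (Localization.AtPrime M)[X] :=
    Polynomial.isLocalization _ _
  set r := algebraMap A[X] (Localization.AtPrime M)[X]
  obtain ⟨k, U, W, h3, h4⟩ := exists_split_of_isLocalRing (e := e.map r)
    (by rw [← Matrix.map_mul, he]) (s := r s) (hs.map _) (U₀ := U₀.map r) (W₀ := W₀.map r)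
    (by rw [← Matrix.map_mul, h1]; ext1; simp)
    (by
      rw [← Matrix.map_mul, h2]; ext1 i j
      simp only [Matrix.map_apply, Matrix.smul_apply, smul_eq_mul, Matrix.one_apply, map_mul]
      split_ifs <;> simp)
  obtain ⟨_, ⟨f, hf, rfl⟩, U', W', h5, h6⟩ := exists_split_of_isLocalization
    (M.primeCompl.map (C : A →+* A[X])) (by
      rintro _ ⟨f, hf, rfl⟩
      exact mem_nonZeroDivisors_of_ne_zero (C_ne_zero.2 (nonZeroDivisors.ne_zero (hle hf)))) h3 h4
  exact ⟨f, hf, k, U', W', h5, h6⟩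

theorem exists_mvPolynomial_equiv (n : ℕ) (R : Type*) [CommRing R] :
    ∃ θ : MvPolynomial (Fin n) R[X] ≃+* (MvPolynomial (Fin n) R)[X],
      ∀ s : R[X], θ (MvPolynomial.C s) = s.map MvPolynomial.C := by
  let θ : MvPolynomial (Fin n) R[X] ≃ₐ[R] (MvPolynomial (Fin n) R)[X] :=
    (MvPolynomial.optionEquivRight R (Fin n)).symm.trans (MvPolynomial.optionEquivLeft R (Fin n))
  refine ⟨θ.toRingEquiv, fun s => ?_⟩
  have : (θ.toAlgHom.comp (IsScalarTower.toAlgHom R R[X] (MvPolynomial (Fin n) R[X]))) =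
      Polynomial.mapAlgHom (Algebra.ofId R (MvPolynomial (Fin n) R)) := by
    ext
    simp [θ, MvPolynomial.algebraMap_eq]
  exact AlgHom.congr_fun this s

theorem idemFree_mvPolynomial (n : ℕ) : ∀ (R : Type*) [CommRing R] [IsDomain R]
    [IsPrincipalIdealRing R], IdemFree (MvPolynomial (Fin n) R) := by
  induction n with
  | zero =>
    intro R _ _ _
    exact (idemFree_of_pid R).of_ringEquiv (MvPolynomial.isEmptyRingEquiv R (Fin 0)).symm
  | succ n ih =>
    intro R _ _ _
    refine IdemFree.of_ringEquiv (MvPolynomial.finSuccEquiv R n).symm.toRingEquiv ?_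
    intro m e he
    obtain ⟨θ, hθC⟩ := exists_mvPolynomial_equiv n R
    let : Algebra (MvPolynomial (Fin n) R[X]) (MvPolynomial (Fin n) (MonicLoc R)) :=
      (MvPolynomial.map (algebraMap R[X] (MonicLoc R))).toAlgebra
    have : IsLocalization ((monics R).map (MvPolynomial.C : R[X] →+* MvPolynomial (Fin n) R[X]))
      (MvPolynomial (Fin n) (MonicLoc R)) := MvPolynomial.isLocalization _ _
    set r := algebraMap (MvPolynomial (Fin n) R[X]) (MvPolynomial (Fin n) (MonicLoc R))
    have hθe : (e.map θ.symm) * (e.map θ.symm) = e.map θ.symm := by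
      rw [← Matrix.map_mul, he]
    obtain ⟨k, U, W, h1, h2⟩ := ih (MonicLoc R) m ((e.map θ.symm).map r)
      (by rw [← Matrix.map_mul, hθe])
    obtain ⟨_, ⟨s, hs, rfl⟩, U', W', h3, h4⟩ := exists_split_of_isLocalization
      ((monics R).map (MvPolynomial.C : R[X] →+* MvPolynomial (Fin n) R[X])) (by
        rintro _ ⟨f, hf, rfl⟩
        exact mem_nonZeroDivisors_of_ne_zero
          ((map_ne_zero_iff _ (MvPolynomial.C_injective _ _)).2 (Monic.ne_zero hf))) h1 h2
    refine exists_split_of_monic (ih R) he (s := s.map MvPolynomial.C) (hs.map _)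
      (U₀ := U'.map θ) (W₀ := W'.map θ) ?_ ?_
    · rw [← Matrix.map_mul, h3]
      ext1 i j
      simp only [Matrix.map_apply, Matrix.smul_apply, smul_eq_mul, map_mul, hθC,
        RingEquiv.apply_symm_apply]
    · rw [← Matrix.map_mul, h4]
      ext1 i j
      simp only [Matrix.map_apply, Matrix.smul_apply, smul_eq_mul, Matrix.one_apply, map_mul, hθC]
      split_ifs <;> simp

end

section

open Matrix

/-! ### Monoid algebras of submonoids of an ambient group -/

section Ambient

open AddMonoidAlgebra

variable {V : Type*} [AddCommGroup V] (R : Type*) [CommRing R]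

/-- The elements of `R[V]` with support contained in `T`. -/
def supp (T : Set V) : Submodule R (AddMonoidAlgebra R V) where
  carrier := {f | ∀ x, f.coeff x ≠ 0 → x ∈ T}
  zero_mem' := fun x hx => absurd (by simp) hx
  add_mem' := by
    intro f g hf hg x hx
    rw [coeff_add, Finsupp.add_apply] at hx
    by_cases h : f.coeff x = 0
    · exact hg x (by rwa [h, zero_add] at hx)
    · exact hf x h
  smul_mem' := by
    intro c f hf x hx
    rw [coeff_smul, Finsupp.smul_apply] at hx
    exact hf x fun h => hx (by rw [h, smul_zero])

variable {R}

theorem supp_mono {T T' : Set V} (h : T ⊆ T') {f : AddMonoidAlgebra R V} (hf : f ∈ supp R T) :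
    f ∈ supp R T' := fun x hx => h (hf x hx)

theorem single_mem_supp {T : Set V} {x : V} (hx : x ∈ T) (a : R) : single x a ∈ supp R T := by
  classical
  intro y hy
  rw [coeff_single, Finsupp.single_apply] at hy
  split_ifs at hy with h
  · exact h ▸ hx
  · exact absurd rfl hy

theorem supp_induction {T : Set V} {p : AddMonoidAlgebra R V → Prop} (h0 : p 0)
    (hadd : ∀ f g, p f → p g → p (f + g)) (hs : ∀ x ∈ T, ∀ a : R, p (single x a))
    {f : AddMonoidAlgebra R V} (hf : f ∈ supp R T) : p f := by
  rw [← sum_coeff_single f]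
  exact Finset.sum_induction _ p hadd h0 fun x hx => hs x (hf x (Finsupp.mem_support_iff.1 hx)) _

theorem mem_supp_coeff_support (f : AddMonoidAlgebra R V) :
    f ∈ supp R (f.coeff.support : Set V) := fun x hx => by simpa using hx

theorem mul_mem_supp {T₁ T₂ T₃ : Set V} (h : ∀ x ∈ T₁, ∀ y ∈ T₂, x + y ∈ T₃)
    {f g : AddMonoidAlgebra R V} (hf : f ∈ supp R T₁) (hg : g ∈ supp R T₂) :
    f * g ∈ supp R T₃ := by
  refine supp_induction (p := fun f => f * g ∈ supp R T₃) ?_ ?_ ?_ hf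
  · rw [zero_mul]; exact zero_mem _
  · intro f f' h1 h2; rw [add_mul]; exact add_mem h1 h2
  · intro x hx a
    refine supp_induction (p := fun g => single x a * g ∈ supp R T₃) ?_ ?_ ?_ hg
    · rw [mul_zero]; exact zero_mem _
    · intro f f' h1 h2; rw [mul_add]; exact add_mem h1 h2
    · intro y hy b
      rw [single_mul_single]
      exact single_mem_supp (h x hx y hy) _

theorem exists_add_of_mem_supp_union {T₁ T₂ : Set V} {f : AddMonoidAlgebra R V}
    (hf : f ∈ supp R (T₁ ∪ T₂)) : ∃ f₁ ∈ supp R T₁, ∃ f₂ ∈ supp R T₂, f = f₁ + f₂ := by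
  refine supp_induction (p := fun f => ∃ f₁ ∈ supp R T₁, ∃ f₂ ∈ supp R T₂, f = f₁ + f₂)
    ⟨0, zero_mem _, 0, zero_mem _, (add_zero 0).symm⟩ ?_ ?_ hf
  · rintro _ _ ⟨f₁, h1, f₂, h2, rfl⟩ ⟨g₁, h3, g₂, h4, rfl⟩
    exact ⟨_, add_mem h1 h3, _, add_mem h2 h4, by abel⟩
  · rintro x (hx | hx) a
    · exact ⟨_, single_mem_supp hx a, 0, zero_mem _, (add_zero _).symm⟩
    · exact ⟨0, zero_mem _, _, single_mem_supp hx a, (zero_add _).symm⟩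

variable (R) in
/-- The subring `R[M]` of `R[V]`. -/
def alg (M : AddSubmonoid V) : Subring (AddMonoidAlgebra R V) where
  carrier := supp R (M : Set V)
  zero_mem' := zero_mem _
  add_mem' := add_mem
  neg_mem' := neg_mem
  one_mem' := by
    rw [one_def]
    exact single_mem_supp M.zero_mem _
  mul_mem' := mul_mem_supp fun _ hx _ hy => M.add_mem hx hy

theorem single_mem_alg {M : AddSubmonoid V} {x : V} (hx : x ∈ M) (a : R) : single x a ∈ alg R M :=
  single_mem_supp (T := (M : Set V)) hx a

theorem alg_mono {M M' : AddSubmonoid V} (h : M ≤ M') : alg R M ≤ alg R M' :=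
  fun _ hf => supp_mono (T := (M : Set V)) h hf

theorem smul_mem_alg {M : AddSubmonoid V} (a : R) {f : AddMonoidAlgebra R V} (hf : f ∈ alg R M) :
    a • f ∈ alg R M := Submodule.smul_mem (supp R (M : Set V)) a hf

theorem single_nsmul_one (n : ℕ) (v : V) : (single (n • v) 1 : AddMonoidAlgebra R V) =
    single v 1 ^ n := by
  rw [single_pow, one_pow]

theorem exists_single_mul_mem {T T' : Set V} {v : V} (hv : ∀ x ∈ T', v + x ∈ T')
    (h : ∀ x ∈ T, ∃ N : ℕ, N • v + x ∈ T') {f : AddMonoidAlgebra R V} (hf : f ∈ supp R T) :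
    ∃ N : ℕ, ∀ n, N ≤ n → single v 1 ^ n * f ∈ supp R T' := by
  refine supp_induction (p := fun f => ∃ N : ℕ, ∀ n, N ≤ n → single v 1 ^ n * f ∈ supp R T')
    ⟨0, fun n _ => by rw [mul_zero]; exact zero_mem _⟩ ?_ ?_ hf
  · rintro f g ⟨N, hN⟩ ⟨N', hN'⟩
    refine ⟨max N N', fun n hn => ?_⟩
    rw [mul_add]
    exact add_mem (hN n (le_of_max_le_left hn)) (hN' n (le_of_max_le_right hn))
  · intro x hx a
    obtain ⟨N, hN⟩ := h x hx
    refine ⟨N, fun n hn => ?_⟩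
    rw [← single_nsmul_one, single_mul_single]
    refine single_mem_supp ?_ _
    obtain ⟨d, rfl⟩ := Nat.exists_eq_add_of_le hn
    clear hn
    induction d with
    | zero => exact hN
    | succ d ih =>
      rw [← add_assoc, succ_nsmul, add_comm _ v, add_assoc]
      exact hv _ ih

theorem exists_pow_single_mul_mem_alg {M M' : AddSubmonoid V} {v : V} (hv : v ∈ M')
    (h : ∀ x ∈ M, ∃ N : ℕ, N • v + x ∈ M') {f : AddMonoidAlgebra R V} (hf : f ∈ alg R M) :
    ∃ N : ℕ, ∀ n, N ≤ n → single v 1 ^ n * f ∈ alg R M' :=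
  exists_single_mul_mem (T := (M : Set V)) (T' := (M' : Set V)) (fun _ hx => M'.add_mem hv hx) h hf

/-! ### Filtering the support -/

open Classical in
/-- The projection of `R[V]` onto the elements supported in `N`. -/
noncomputable def filt (N : Set V) : AddMonoidAlgebra R V →+ AddMonoidAlgebra R V where
  toFun f := ofCoeff (f.coeff.filter (· ∈ N))
  map_zero' := by ext; simp [Finsupp.filter_apply]
  map_add' f g := by ext x; simp only [coeff_add, Finsupp.add_apply, Finsupp.filter_apply]; split_ifs <;> simp

open Classical in
theorem coeff_filt (N : Set V) (f : AddMonoidAlgebra R V) (x : V) :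
    (filt N f).coeff x = if x ∈ N then f.coeff x else 0 := by
  simp [filt, Finsupp.filter_apply]

theorem filt_mem {N T : Set V} {f : AddMonoidAlgebra R V} (hf : f ∈ supp R T) :
    filt N f ∈ supp R (T ∩ N) := by
  classical
  intro x hx
  rw [coeff_filt] at hx
  split_ifs at hx with h
  exacts [⟨hf x hx, h⟩, absurd rfl hx]

theorem filt_eq_self {N : Set V} {f : AddMonoidAlgebra R V} (hf : f ∈ supp R N) :
    filt N f = f := by
  classical
  ext x
  rw [coeff_filt]
  split_ifs with h
  · rfl
  · by_contra h'
    exact h (hf x (Ne.symm h'))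

theorem filt_eq_zero {N T : Set V} (h : ∀ x ∈ T, x ∉ N) {f : AddMonoidAlgebra R V}
    (hf : f ∈ supp R T) : filt N f = 0 := by
  classical
  ext x
  rw [coeff_filt]
  split_ifs with h1
  · by_contra h'
    exact h x (hf x h') h1
  · rfl

theorem filt_single_of_mem {N : Set V} {x : V} (h : x ∈ N) (a : R) :
    filt N (single x a) = single x a := filt_eq_self (single_mem_supp h a)

theorem filt_single_of_notMem {N : Set V} {x : V} (h : x ∉ N) (a : R) :
    filt N (single x a) = 0 :=
  filt_eq_zero (T := {x}) (by simpa using h) (single_mem_supp (Set.mem_singleton x) a)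

theorem filt_one {N : Set V} (h : (0 : V) ∈ N) : filt N (1 : AddMonoidAlgebra R V) = 1 := by
  rw [one_def, filt_single_of_mem h]

theorem filt_mul_left {N T : Set V} (h : ∀ x ∈ T, ∀ y, x + y ∈ N ↔ y ∈ N)
    {a : AddMonoidAlgebra R V} (ha : a ∈ supp R T) (f : AddMonoidAlgebra R V) :
    filt N (a * f) = a * filt N f := by
  refine supp_induction (p := fun a => filt N (a * f) = a * filt N f) (by simp) ?_ ?_ ha
  · intro a b h1 h2; rw [add_mul, map_add, h1, h2, add_mul]
  · intro x hx c
    induction f using AddMonoidAlgebra.induction_linear with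
    | zero => simp
    | add f g h1 h2 => rw [mul_add, map_add, h1, h2, map_add, mul_add]
    | single y d =>
      rw [single_mul_single]
      by_cases hy : y ∈ N
      · rw [filt_single_of_mem hy, filt_single_of_mem ((h x hx y).2 hy), single_mul_single]
      · rw [filt_single_of_notMem hy, filt_single_of_notMem fun h' => hy ((h x hx y).1 h'),
          mul_zero]

theorem filt_mul {N T : Set V} (h : ∀ x ∈ T, ∀ y ∈ T, x + y ∈ N ↔ x ∈ N ∧ y ∈ N)
    {f g : AddMonoidAlgebra R V} (hf : f ∈ supp R T) (hg : g ∈ supp R T) :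
    filt N (f * g) = filt N f * filt N g := by
  refine supp_induction (p := fun f => filt N (f * g) = filt N f * filt N g) (by simp) ?_ ?_ hf
  · intro a b h1 h2; rw [add_mul, map_add, h1, h2, map_add, add_mul]
  · intro x hx c
    refine supp_induction (p := fun g => filt N (single x c * g) = filt N (single x c) * filt N g)
      (by simp) ?_ ?_ hg
    · intro a b h1 h2; rw [mul_add, map_add, h1, h2, map_add, mul_add]
    · intro y hy d
      rw [single_mul_single]
      by_cases hxN : x ∈ N
      · by_cases hyN : y ∈ N
        · rw [filt_single_of_mem hxN, filt_single_of_mem hyN,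
            filt_single_of_mem ((h x hx y hy).2 ⟨hxN, hyN⟩), single_mul_single]
        · rw [filt_single_of_notMem hyN, mul_zero,
            filt_single_of_notMem fun h' => hyN ((h x hx y hy).1 h').2]
      · rw [filt_single_of_notMem hxN, zero_mul,
          filt_single_of_notMem fun h' => hxN ((h x hx y hy).1 h').1]

theorem map_filt_mul {l m n : Type*} [Fintype m] {N T : Set V}
    (h : ∀ x ∈ T, ∀ y ∈ T, x + y ∈ N ↔ x ∈ N ∧ y ∈ N)
    {X : Matrix l m (AddMonoidAlgebra R V)} {Y : Matrix m n (AddMonoidAlgebra R V)}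
    (hX : MatIn (supp R T) X) (hY : MatIn (supp R T) Y) :
    (X * Y).map (filt N) = X.map (filt N) * Y.map (filt N) := by
  ext1 i j
  rw [Matrix.map_apply, Matrix.mul_apply, Matrix.mul_apply, map_sum]
  exact Finset.sum_congr rfl fun k _ => filt_mul h (hX i k) (hY k j)

/-! ### Splitting idempotents over `R[M]` -/

/-- Idempotent matrices over `R[M]` split. -/
def SubIdemFree (R : Type*) [CommRing R] (M : AddSubmonoid V) : Prop :=
  ∀ (n : ℕ) (e : Matrix (Fin n) (Fin n) (AddMonoidAlgebra R V)), MatIn (alg R M) e → e * e = e →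
    SplitIn (alg R M) e

theorem SubIdemFree.splitIn {M : AddSubmonoid V} (h : SubIdemFree R M) {m : Type*} [Fintype m]
    (e : Matrix m m (AddMonoidAlgebra R V)) (he : MatIn (alg R M) e) (hee : e * e = e) :
    SplitIn (alg R M) e := splitIn_of_forall_fin h e he hee

theorem mem_alg_iff_exists_mapDomain {M' : Type*} [AddCommMonoid M'] (j : M' →+ V)
    {M : AddSubmonoid V} (hj : ∀ x, x ∈ M ↔ ∃ y, j y = x) (f : AddMonoidAlgebra R V) :
    f ∈ alg R M ↔ ∃ b, mapDomainRingHom R j b = f := by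
  constructor
  · intro hf
    refine supp_induction (p := fun f => ∃ b, mapDomainRingHom R j b = f) ⟨0, map_zero _⟩ ?_ ?_ hf
    · rintro _ _ ⟨b, rfl⟩ ⟨c, rfl⟩
      exact ⟨b + c, map_add _ _ _⟩
    · intro x hx a
      obtain ⟨y, rfl⟩ := (hj x).1 hx
      exact ⟨single y a, by simp⟩
  · rintro ⟨b, rfl⟩
    induction b using AddMonoidAlgebra.induction_linear with
    | zero => rw [map_zero]; exact zero_mem _
    | add f g h1 h2 => rw [map_add]; exact add_mem h1 h2
    | single x a =>
      rw [mapDomainRingHom_apply, mapDomain_single]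
      exact single_mem_alg ((hj _).2 ⟨x, rfl⟩) a

theorem subIdemFree_iff {M' : Type*} [AddCommMonoid M'] (j : M' →+ V)
    (hinj : Function.Injective j) {M : AddSubmonoid V} (hj : ∀ x, x ∈ M ↔ ∃ y, j y = x) :
    SubIdemFree R M ↔ IdemFree (AddMonoidAlgebra R M') :=
  ⟨fun h => idemFree_of_splitIn (mapDomainRingHom R j) (mapDomain_injective hinj)
    (mem_alg_iff_exists_mapDomain j hj) h,
  fun h => IdemFree.splitIn h (mapDomainRingHom R j) (mapDomain_injective hinj)
    (mem_alg_iff_exists_mapDomain j hj)⟩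

theorem subIdemFree_bot [IsDomain R] [IsPrincipalIdealRing R] :
    SubIdemFree R (⊥ : AddSubmonoid V) := by
  refine IdemFree.splitIn (idemFree_of_pid R) (singleZeroRingHom (R := R) (M := V)) ?_ ?_
  · intro a b h
    simpa using congrArg (fun f => f.coeff 0) h
  · intro f
    constructor
    · intro hf
      refine ⟨f.coeff 0, ?_⟩
      ext x
      by_cases hx : x = 0
      · simp [hx]
      · by_contra h
        refine hx (hf x ?_)
        intro h0
        apply h
        simp [h0, Ne.symm hx]
    · rintro ⟨a, rfl⟩
      exact single_mem_alg (zero_mem _) a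

end Ambient

end

section

open Matrix Polynomial

/-! ### Splitting a direction off a monoid -/

section Direction

open AddMonoidAlgebra (single)

theorem exists_common_mul {ι S : Type*} [Finite ι] [CommMonoid S] (P : S → ι → Prop)
    (h : ∀ i, ∃ s, P s i) (hmul : ∀ s t i, P s i → P (t * s) i) : ∃ s, ∀ i, P s i := by
  classical
  cases nonempty_fintype ι
  choose s hs using h
  refine ⟨∏ i, s i, fun i => ?_⟩
  rw [← Finset.mul_prod_erase _ _ (Finset.mem_univ i), mul_comm]
  exact hmul _ _ _ (hs i)

theorem exists_common_nat {ι : Type*} [Finite ι] (P : ℕ → ι → Prop)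
    (h : ∀ i, ∃ N, ∀ n, N ≤ n → P n i) : ∃ N, ∀ n, N ≤ n → ∀ i, P n i := by
  cases nonempty_fintype ι
  choose s hs using h
  exact ⟨∑ i, s i, fun n hn i =>
    hs i n ((Finset.single_le_sum (fun _ _ => Nat.zero_le _) (Finset.mem_univ i)).trans hn)⟩

theorem mul_eq_of_smul {K m n : Type*} [CommRing K] [IsDomain K] [Fintype m] [Fintype n]
    [DecidableEq n] {e : Matrix m m K} (he : e * e = e) {t : K} (ht : t ≠ 0) {U : Matrix m n K}
    {W : Matrix n m K} (h1 : U * W = t • e) (h2 : W * U = t • 1) : e * U = U := by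
  have h : e * (U * W * U) = U * W * U := by
    rw [h1, ← Matrix.mul_assoc, Matrix.mul_smul, he]
  rw [Matrix.mul_assoc, h2, Matrix.mul_smul, Matrix.mul_one, Matrix.mul_smul] at h
  exact smul_right_injective _ ht h

theorem mul_eq_of_smul' {K m n : Type*} [CommRing K] [IsDomain K] [Fintype m] [Fintype n]
    [DecidableEq n] {e : Matrix m m K} (he : e * e = e) {t : K} (ht : t ≠ 0) {U : Matrix m n K}
    {W : Matrix n m K} (h1 : U * W = t • e) (h2 : W * U = t • 1) : W * e = W := by
  have h : W * (U * W) * e = W * (U * W) := by rw [h1, Matrix.mul_assoc, Matrix.smul_mul, he]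
  rw [← Matrix.mul_assoc, h2, Matrix.smul_mul, Matrix.one_mul, Matrix.smul_mul] at h
  exact smul_right_injective _ ht h

variable {V : Type*} [AddCommGroup V] {R : Type*} [CommRing R]

theorem exists_mapRingHom_eq_smul {T : Set V} {f : AddMonoidAlgebra (MonicLoc R) V}
    (hf : f ∈ supp (MonicLoc R) T) : ∃ s : monics R, ∃ g ∈ supp R[X] T,
      AddMonoidAlgebra.mapRingHom V (algebraMap R[X] (MonicLoc R)) g
        = algebraMap R[X] (MonicLoc R) s • f := by
  refine supp_induction (p := fun f => ∃ s : monics R, ∃ g ∈ supp R[X] T,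
      AddMonoidAlgebra.mapRingHom V (algebraMap R[X] (MonicLoc R)) g
        = algebraMap R[X] (MonicLoc R) s • f) ⟨1, 0, zero_mem _, by simp⟩ ?_ ?_ hf
  · rintro f f' ⟨s, g, hg, h⟩ ⟨s', g', hg', h'⟩
    refine ⟨s * s', (s' : R[X]) • g + (s : R[X]) • g',
      add_mem (Submodule.smul_mem _ _ hg) (Submodule.smul_mem _ _ hg'), ?_⟩
    have key : ∀ (t : R[X]) g, AddMonoidAlgebra.mapRingHom V (algebraMap R[X] (MonicLoc R)) (t • g)
        = algebraMap R[X] (MonicLoc R) t •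
          AddMonoidAlgebra.mapRingHom V (algebraMap R[X] (MonicLoc R)) g := by
      intro t g
      ext x
      simp [Algebra.smul_def]
    rw [map_add, key, key, h, h', smul_smul, smul_smul, smul_add, ← map_mul, ← map_mul,
      Submonoid.coe_mul, mul_comm (s' : R[X])]
  · intro x hx a
    obtain ⟨⟨b, s⟩, hb⟩ := IsLocalization.surj (monics R) a
    refine ⟨s, single x b, single_mem_supp hx _, ?_⟩
    rw [AddMonoidAlgebra.mapRingHom_single, ← hb, AddMonoidAlgebra.smul_single, smul_eq_mul,
      mul_comm]

/-- The substitution `R[X][V] → R[V]`, `X ↦ v`. -/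
noncomputable def substVar (R : Type*) [CommRing R] (v : V) :
    AddMonoidAlgebra R[X] V →+* AddMonoidAlgebra R V :=
  AddMonoidAlgebra.liftNCRingHom (aeval (R := R) (single v 1 : AddMonoidAlgebra R V)).toRingHom
    (AddMonoidAlgebra.of R V) fun _ _ => Commute.all _ _

theorem substVar_single (v x : V) (p : R[X]) :
    substVar R v (single x p) = aeval (single v 1 : AddMonoidAlgebra R V) p * single x 1 := by
  exact AddMonoidAlgebra.liftNC_single _ _ _ _

theorem substVar_smul (v : V) (p : R[X]) (f : AddMonoidAlgebra R[X] V) :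
    substVar R v (p • f) = aeval (single v 1 : AddMonoidAlgebra R V) p * substVar R v f := by
  induction f using AddMonoidAlgebra.induction_linear with
  | zero => simp
  | add f g h1 h2 => rw [smul_add, map_add, h1, h2, map_add, mul_add]
  | single x q => rw [AddMonoidAlgebra.smul_single, substVar_single, substVar_single, smul_eq_mul,
      map_mul, mul_assoc]

theorem aeval_single_mem_alg {M : AddSubmonoid V} {v : V} (hv : v ∈ M) (p : R[X]) :
    aeval (single v 1 : AddMonoidAlgebra R V) p ∈ alg R M := by
  rw [aeval_eq_sum_range]
  exact sum_mem fun i _ => smul_mem_alg _ (pow_mem (single_mem_alg hv _) _)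

theorem exists_pow_mul_substVar_mem {M : AddSubmonoid V} {T : Set V} {v : V} (hv : v ∈ M)
    (habs : ∀ x ∈ T, ∃ N : ℕ, N • v + x ∈ M) {f : AddMonoidAlgebra R[X] V}
    (hf : f ∈ supp R[X] T) :
    ∃ N : ℕ, ∀ n, N ≤ n → single v 1 ^ n * substVar R v f ∈ alg R M := by
  refine supp_induction (p := fun f => ∃ N : ℕ, ∀ n, N ≤ n →
    single v 1 ^ n * substVar R v f ∈ alg R M) ⟨0, fun n _ => by simp⟩ ?_ ?_ hf
  · rintro f f' ⟨N, h⟩ ⟨N', h'⟩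
    refine ⟨max N N', fun n hn => ?_⟩
    rw [map_add, mul_add]
    exact add_mem (h n (le_of_max_le_left hn)) (h' n (le_of_max_le_right hn))
  · intro x hx p
    obtain ⟨N, hN⟩ := exists_single_mul_mem (T := {x}) (T' := (M : Set V)) (R := R) (v := v)
      (fun _ hx => M.add_mem hv hx) (by rintro _ rfl; exact habs _ hx)
      (single_mem_supp (Set.mem_singleton x) 1)
    refine ⟨N, fun n hn => ?_⟩
    rw [substVar_single, mul_left_comm]
    exact mul_mem (aeval_single_mem_alg hv p) (hN n hn)

variable [Module ℚ V]

theorem coeff_aeval_single {v : V} (hv : v ≠ 0) (p : R[X]) (n : ℕ) :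
    (aeval (single v 1 : AddMonoidAlgebra R V) p).coeff (n • v) = p.coeff n := by
  classical
  induction p using Polynomial.induction_on' with
  | add p q h1 h2 => rw [map_add, AddMonoidAlgebra.coeff_add, Finsupp.add_apply, h1, h2,
      Polynomial.coeff_add]
  | monomial k a =>
    rw [aeval_monomial, ← single_nsmul_one, ← Algebra.smul_def, AddMonoidAlgebra.smul_single,
      smul_eq_mul, mul_one, AddMonoidAlgebra.coeff_single, Finsupp.single_apply, coeff_monomial]
    congr 1
    rw [← Nat.cast_smul_eq_nsmul ℚ, ← Nat.cast_smul_eq_nsmul ℚ, (smul_left_injective ℚ hv).eq_iff,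
      Nat.cast_inj]

theorem aeval_single_injective {v : V} (hv : v ≠ 0) :
    Function.Injective (aeval (R := R) (single v 1 : AddMonoidAlgebra R V)) := by
  intro p q h
  ext n
  rw [← coeff_aeval_single hv, h, coeff_aeval_single hv]

section Theta

variable (R) (v : V) (c : V →ₗ[ℚ] ℚ)

/-- The variable as a unit of `R⟨X⟩`. -/
noncomputable def monicVar (R : Type*) [CommRing R] : (MonicLoc R)ˣ :=
  (IsLocalization.map_units (M := monics R) (MonicLoc R) ⟨X, monic_X⟩).unit

theorem coe_monicVar : ((monicVar R : (MonicLoc R)ˣ) : MonicLoc R) = algebraMap _ _ (X : R[X]) :=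
  rfl

/-- The map `R[V] → R⟨X⟩[V]` sending a monomial `x` to `X ^ c(x) • (x - c(x) v)`; multiplicative on
monomials with integral `c`. -/
noncomputable def gradingMap : AddMonoidAlgebra R V →+ AddMonoidAlgebra (MonicLoc R) V :=
  AddMonoidAlgebra.liftNC ((AddMonoidAlgebra.singleZeroRingHom.comp
    ((algebraMap R[X] (MonicLoc R)).comp C)).toAddMonoidHom)
    (fun x => single (x.toAdd - c x.toAdd • v) ((monicVar R ^ ⌊c x.toAdd⌋ : (MonicLoc R)ˣ) :
      MonicLoc R))

variable {R}

theorem gradingMap_single (x : V) (a : R) : gradingMap R v c (single x a) =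
    single (x - c x • v) (algebraMap R[X] (MonicLoc R) (C a) *
      ((monicVar R ^ ⌊c x⌋ : (MonicLoc R)ˣ) : MonicLoc R)) := by
  refine (AddMonoidAlgebra.liftNC_single _ _ _ _).trans ?_
  simp

variable {v c} {M : AddSubmonoid V}

theorem gradingMap_mul (hc : ∀ x ∈ M, ∃ z : ℤ, c x = z)
    {f g : AddMonoidAlgebra R V} (hf : f ∈ alg R M) (hg : g ∈ alg R M) :
    gradingMap R v c (f * g) = gradingMap R v c f * gradingMap R v c g := by
  refine supp_induction (p := fun f => gradingMap R v c (f * g) =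
    gradingMap R v c f * gradingMap R v c g) (by simp) ?_ ?_ hf
  · intro a b h1 h2; rw [add_mul, map_add, h1, h2, map_add, add_mul]
  · intro x hx a
    refine supp_induction (p := fun g => gradingMap R v c (single x a * g) =
      gradingMap R v c (single x a) * gradingMap R v c g) (by simp) ?_ ?_ hg
    · intro a b h1 h2; rw [mul_add, map_add, h1, h2, map_add, mul_add]
    · intro y hy b
      obtain ⟨z, hz⟩ := hc x hx
      obtain ⟨w, hw⟩ := hc y hy
      rw [AddMonoidAlgebra.single_mul_single, gradingMap_single, gradingMap_single,
        gradingMap_single, AddMonoidAlgebra.single_mul_single, map_add, hz, hw]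
      congr 1
      · module
      · rw [← Int.cast_add, Int.floor_intCast, Int.floor_intCast, Int.floor_intCast, _root_.zpow_add]
        push_cast [map_mul]
        ring

theorem gradingMap_mem {M' : AddSubmonoid V} (hp : ∀ x ∈ M, x - c x • v ∈ M')
    {f : AddMonoidAlgebra R V} (hf : f ∈ alg R M) : gradingMap R v c f ∈ alg (MonicLoc R) M' := by
  refine supp_induction (p := fun f => gradingMap R v c f ∈ alg (MonicLoc R) M') (by simp) ?_ ?_ hf
  · intro a b h1 h2; rw [map_add]; exact add_mem h1 h2
  · intro x hx a
    rw [gradingMap_single]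
    exact single_mem_alg (hp x hx) _

theorem exists_mapRingHom_eq_pow_smul_gradingMap (hc : ∀ x ∈ M, ∃ z : ℤ, c x = z)
    {f : AddMonoidAlgebra R V} (hf : f ∈ alg R M) :
    ∃ N : ℕ, ∀ n, N ≤ n → ∃ g : AddMonoidAlgebra R[X] V,
      AddMonoidAlgebra.mapRingHom V (algebraMap R[X] (MonicLoc R)) g
        = algebraMap R[X] (MonicLoc R) (X ^ n) • gradingMap R v c f ∧
      substVar R v g = single v 1 ^ n * f := by
  refine supp_induction (p := fun f => ∃ N : ℕ, ∀ n, N ≤ n → ∃ g : AddMonoidAlgebra R[X] V,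
      AddMonoidAlgebra.mapRingHom V (algebraMap R[X] (MonicLoc R)) g
        = algebraMap R[X] (MonicLoc R) (X ^ n) • gradingMap R v c f ∧
      substVar R v g = single v 1 ^ n * f) ⟨0, fun n _ => ⟨0, by simp⟩⟩ ?_ ?_ hf
  · rintro f f' ⟨N, h⟩ ⟨N', h'⟩
    refine ⟨max N N', fun n hn => ?_⟩
    obtain ⟨g, h1, h2⟩ := h n (le_of_max_le_left hn)
    obtain ⟨g', h3, h4⟩ := h' n (le_of_max_le_right hn)
    exact ⟨g + g', by rw [map_add, h1, h3, map_add, smul_add],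
      by rw [map_add, h2, h4, mul_add]⟩
  · intro x hx a
    obtain ⟨z, hz⟩ := hc x hx
    refine ⟨z.natAbs, fun n hn => ?_⟩
    obtain ⟨d, hd⟩ : ∃ d : ℕ, (d : ℤ) = n + z := ⟨(n + z).toNat, by omega⟩
    refine ⟨single (x - c x • v) (C a * X ^ d), ?_, ?_⟩
    · rw [gradingMap_single, AddMonoidAlgebra.mapRingHom_single, AddMonoidAlgebra.smul_single, hz,
        Int.floor_intCast, show z = (d : ℤ) - n by omega, _root_.zpow_sub, zpow_natCast, zpow_natCast,
        map_mul, smul_eq_mul]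
      congr 1
      have h : algebraMap R[X] (MonicLoc R) (X ^ n) =
          ((monicVar R ^ n : (MonicLoc R)ˣ) : MonicLoc R) := by
        rw [Units.val_pow_eq_pow_val, coe_monicVar, map_pow]
      have h' : algebraMap R[X] (MonicLoc R) (X ^ d) =
          ((monicVar R ^ d : (MonicLoc R)ˣ) : MonicLoc R) := by
        rw [Units.val_pow_eq_pow_val, coe_monicVar, map_pow]
      rw [h, h', Units.val_mul]
      have h3 : ((monicVar R ^ n : (MonicLoc R)ˣ) : MonicLoc R) *
        (((monicVar R ^ n)⁻¹ : (MonicLoc R)ˣ) : MonicLoc R) = 1 := Units.mul_inv _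
      linear_combination (-algebraMap R[X] (MonicLoc R) (C a) *
        ((monicVar R ^ d : (MonicLoc R)ˣ) : MonicLoc R)) * h3
    · rw [substVar_single, map_mul, aeval_C, map_pow, aeval_X, ← single_nsmul_one,
        ← single_nsmul_one, AddMonoidAlgebra.single_mul_single, one_mul, mul_assoc,
        AddMonoidAlgebra.single_mul_single, one_mul, ← Algebra.smul_def,
        AddMonoidAlgebra.smul_single, smul_eq_mul, mul_one]
      congr 1
      have : (d : ℚ) = n + z := by exact_mod_cast hd
      rw [hz, ← Nat.cast_smul_eq_nsmul ℚ, ← Nat.cast_smul_eq_nsmul ℚ, this]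
      module

end Theta

theorem exists_split_of_direction [IsDomain R] {M M' : AddSubmonoid V}
    (hM' : SubIdemFree (MonicLoc R) M') {v : V} (hv : v ∈ M) (c : V →ₗ[ℚ] ℚ)
    (hcv : c v = 1)
    (hc : ∀ x ∈ M, ∃ z : ℤ, c x = z) (hp : ∀ x ∈ M, x - c x • v ∈ M')
    (habs : ∀ x ∈ M', ∃ N : ℕ, N • v + x ∈ M) {m : Type*} [Fintype m]
    {e : Matrix m m (AddMonoidAlgebra R V)} (heM : MatIn (alg R M) e) (he : e * e = e) :
    ∃ (k : ℕ) (s : R[X]) (U : Matrix m (Fin k) (AddMonoidAlgebra R V))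
      (W : Matrix (Fin k) m (AddMonoidAlgebra R V)), s.Monic ∧ MatIn (alg R M) U ∧
      MatIn (alg R M) W ∧ U * W = aeval (single v 1 : AddMonoidAlgebra R V) s • e ∧
      W * U = aeval (single v 1 : AddMonoidAlgebra R V) s • 1 ∧ e * U = U ∧ W * e = W := by
  classical
  set α := AddMonoidAlgebra.mapRingHom V (algebraMap R[X] (MonicLoc R)) with hα
  have hαinj : Function.Injective α := by
    intro f g h
    ext1; ext1 x
    apply IsLocalization.injective (MonicLoc R) (monics_le_nonZeroDivisors R)
    have := congrArg (fun f => f.coeff x) h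
    simpa [hα] using this
  have hαsmul : ∀ (t : R[X]) g, α (t • g) = algebraMap R[X] (MonicLoc R) t • α g := by
    intro t g
    ext x
    simp [hα, Algebra.smul_def]
  set θ := gradingMap R v c with hθ
  obtain ⟨k, U', W', hU', hW', h1, h2⟩ := hM'.splitIn (e.map θ)
    (fun i j => gradingMap_mem hp (heM i j)) (by
      ext1 i j
      conv_rhs => rw [← he]
      rw [Matrix.map_apply, Matrix.mul_apply, Matrix.mul_apply, map_sum]
      exact Finset.sum_congr rfl fun l _ => (gradingMap_mul hc (heM i l) (heM l j)).symm)
  -- clear denominators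
  obtain ⟨s, hs⟩ := exists_common_mul (ι := (m × Fin k) ⊕ (Fin k × m)) (S := monics R)
    (fun s i => ∃ g ∈ supp R[X] (M' : Set V), α g = algebraMap R[X] (MonicLoc R) s •
      (Sum.elim (fun p => U' p.1 p.2) (fun p => W' p.1 p.2) i))
    (by
      rintro (⟨i, j⟩ | ⟨i, j⟩)
      · exact exists_mapRingHom_eq_smul (hU' i j)
      · exact exists_mapRingHom_eq_smul (hW' i j))
    (by
      rintro s t i ⟨g, hg, h⟩
      refine ⟨(t : R[X]) • g, Submodule.smul_mem _ _ hg, ?_⟩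
      rw [hαsmul, h, smul_smul, ← map_mul, Submonoid.coe_mul])
  choose U'' hU'' hU3 using fun i j => hs (.inl (i, j))
  choose W'' hW'' hW3 using fun i j => hs (.inr (i, j))
  simp only [Sum.elim_inl, Sum.elim_inr] at hU3 hW3
  obtain ⟨N, hN⟩ := exists_common_nat (ι := m × m) (fun n p => ∃ g : AddMonoidAlgebra R[X] V,
      α g = algebraMap R[X] (MonicLoc R) (X ^ n) • θ (e p.1 p.2) ∧
      substVar R v g = single v 1 ^ n * e p.1 p.2)
    fun p => exists_mapRingHom_eq_pow_smul_gradingMap hc (heM p.1 p.2)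
  choose e'' he1 he2 using fun i j => hN N le_rfl (i, j)
  obtain ⟨N', hN'⟩ := exists_common_nat (ι := (m × Fin k) ⊕ (Fin k × m))
    (fun n i => (single v 1 : AddMonoidAlgebra R V) ^ n *
      substVar R v (Sum.elim (fun p => U'' p.1 p.2) (fun p => W'' p.1 p.2) i) ∈ alg R M) (by
      rintro (⟨i, j⟩ | ⟨i, j⟩)
      · exact exists_pow_mul_substVar_mem hv habs (hU'' i j)
      · exact exists_pow_mul_substVar_mem hv habs (hW'' i j))
  have hvne : v ≠ 0 := by
    rintro rfl
    simp at hcv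
  have hv0 : (single v 1 : AddMonoidAlgebra R V) ≠ 0 := by
    intro h
    have := congrArg (fun f => f.coeff v) h
    simp at this
  have hUW : ∀ i j, (∑ l, substVar R v (U'' i l) * substVar R v (W'' l j)) =
      aeval (single v 1 : AddMonoidAlgebra R V) (s * s : R[X]) * e i j := by
    intro i j
    have h3 : (X ^ N : R[X]) • ∑ l, U'' i l * W'' l j = (s * s : R[X]) • e'' i j := by
      apply hαinj
      rw [hαsmul, hαsmul, he1, map_sum]
      simp only [map_mul, hU3, hW3, smul_mul_smul_comm]
      rw [← Finset.smul_sum, ← Matrix.mul_apply, h1, smul_comm]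
      rfl
    have h4 := congrArg (substVar R v) h3
    rw [substVar_smul, substVar_smul, he2, map_pow, aeval_X, mul_left_comm] at h4
    have h5 := mul_left_cancel₀ (pow_ne_zero N hv0) h4
    rw [map_sum] at h5
    simpa only [map_mul] using h5
  have hWU : ∀ i j, (∑ l, substVar R v (W'' i l) * substVar R v (U'' l j)) =
      aeval (single v 1 : AddMonoidAlgebra R V) (s * s : R[X]) * (1 : Matrix (Fin k) (Fin k) _) i j := by
    intro i j
    have h3 : ∑ l, W'' i l * U'' l j = (s * s : R[X]) • (1 : Matrix (Fin k) (Fin k) _) i j := by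
      apply hαinj
      rw [hαsmul, map_sum]
      simp only [map_mul, hU3, hW3, smul_mul_smul_comm]
      rw [← Finset.smul_sum, ← Matrix.mul_apply, h2]
      congr 1
      rw [Matrix.one_apply, Matrix.one_apply]
      split_ifs <;> simp
    have h4 := congrArg (substVar R v) h3
    rw [substVar_smul, map_sum] at h4
    simp only [map_mul] at h4 ⊢
    rw [h4]
    congr 1
    rw [Matrix.one_apply, Matrix.one_apply]
    split_ifs <;> simp
  let U : Matrix m (Fin k) (AddMonoidAlgebra R V) := of fun i j =>
    single v 1 ^ N' * substVar R v (U'' i j)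
  let W : Matrix (Fin k) m (AddMonoidAlgebra R V) := of fun i j =>
    single v 1 ^ N' * substVar R v (W'' i j)
  set t : R[X] := X ^ N' * X ^ N' * ((s : R[X]) * (s : R[X])) with ht
  have htm : t.Monic := ((monic_X.pow N').mul (monic_X.pow N')).mul (s.2.mul s.2)
  have ht0 : aeval (single v 1 : AddMonoidAlgebra R V) t ≠ 0 :=
    fun h => htm.ne_zero (aeval_single_injective hvne (by rw [h, map_zero]))
  have hUW' : U * W = aeval (single v 1 : AddMonoidAlgebra R V) t • e := by
    ext1 i j
    rw [Matrix.mul_apply, Matrix.smul_apply, ht, map_mul, map_mul, map_pow, aeval_X, smul_eq_mul,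
      mul_assoc, ← hUW, Finset.mul_sum]
    refine Finset.sum_congr rfl fun l _ => ?_
    simp only [U, W, of_apply]
    ring
  have hWU' : W * U = aeval (single v 1 : AddMonoidAlgebra R V) t • 1 := by
    ext1 i j
    rw [Matrix.mul_apply, Matrix.smul_apply, ht, map_mul, map_mul, map_pow, aeval_X, smul_eq_mul,
      mul_assoc, ← hWU, Finset.mul_sum]
    refine Finset.sum_congr rfl fun l _ => ?_
    simp only [U, W, of_apply]
    ring
  refine ⟨k, t, U, W, htm, fun i j => hN' N' le_rfl (.inl (i, j)),
    fun i j => hN' N' le_rfl (.inr (i, j)), hUW', hWU', ?_, ?_⟩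
  · exact mul_eq_of_smul he ht0 hUW' hWU'
  · exact mul_eq_of_smul' he ht0 hUW' hWU'

end Direction

end

section

open Matrix Polynomial

/-! ### Laurent polynomial rings -/

section Laurent

open AddMonoidAlgebra (single)

variable {V : Type*} [AddCommGroup V] [Module ℚ V] {ι : Type*} {w : ι → V}

/-- The monoid generated by the `w i` with `i ∈ P` and the `± w i` with `i ∈ J`. -/
def laurentMon (w : ι → V) (P J : Finset ι) : AddSubmonoid V :=
  AddSubmonoid.closure {x | (∃ i ∈ P, x = w i) ∨ ∃ i ∈ J, x = w i ∨ x = -w i}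

theorem exists_dual_of_linearIndependent {K ι V : Type*} [Field K] [AddCommGroup V] [Module K V]
    {w : ι → V} (hw : LinearIndependent K w) (f : ι → K) : ∃ c : V →ₗ[K] K, ∀ i, c (w i) = f i := by
  obtain ⟨c, hc⟩ := LinearMap.exists_extend ((Module.Basis.span hw).constr K f)
  refine ⟨c, fun i => ?_⟩
  have h1 := (Module.Basis.span hw).constr_basis K f i
  rw [← h1, ← hc, LinearMap.comp_apply, Submodule.subtype_apply, Module.Basis.span_apply]

theorem subIdemFree_laurentMon_empty (hw : LinearIndependent ℚ w) (P : Finset ι) (R : Type*)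
    [CommRing R] [IsDomain R] [IsPrincipalIdealRing R] : SubIdemFree R (laurentMon w P ∅) := by
  have h1 : LinearIndependent ℕ (fun i : P => w i) :=
    (hw.comp (fun i : P => (i : ι)) Subtype.val_injective).restrict_scalars' ℕ
  refine (subIdemFree_iff (Finsupp.linearCombination ℕ (fun i : P => w i)).toAddMonoidHom h1
    fun x => ?_).2 ?_
  · have h2 : {x | (∃ i ∈ P, x = w i) ∨ ∃ i ∈ (∅ : Finset ι), x = w i ∨ x = -w i} =
        Set.range (fun i : P => w i) := by
      ext x
      simp [eq_comm]
    rw [laurentMon, h2, ← Submodule.span_nat_eq_addSubmonoidClosure, Submodule.mem_toAddSubmonoid,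
      ← Finsupp.range_linearCombination]
    rfl
  · exact (idemFree_mvPolynomial _ R).of_ringEquiv
      (MvPolynomial.renameEquiv R (Finset.equivFin P).symm).toRingEquiv

theorem subIdemFree_laurentMon (hw : LinearIndependent ℚ w) (J : Finset ι) : ∀ (P : Finset ι)
    (R : Type*) [CommRing R] [IsDomain R] [IsPrincipalIdealRing R],
    SubIdemFree R (laurentMon w P J) := by
  classical
  induction J using Finset.induction with
  | empty => exact fun P R _ _ _ => subIdemFree_laurentMon_empty hw P R
  | insert i J hiJ ih =>
    intro P R _ _ _ n e heM he
    have hmem1 : ∀ k ∈ P, w k ∈ laurentMon w P (insert i J) := fun k hk =>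
      AddSubmonoid.subset_closure (.inl ⟨k, hk, rfl⟩)
    have hmem2 : ∀ k ∈ J, w k ∈ laurentMon w P (insert i J) ∧
        -w k ∈ laurentMon w P (insert i J) := fun k hk =>
      ⟨AddSubmonoid.subset_closure (.inr ⟨k, Finset.mem_insert_of_mem hk, .inl rfl⟩),
        AddSubmonoid.subset_closure (.inr ⟨k, Finset.mem_insert_of_mem hk, .inr rfl⟩)⟩
    have hi1 : w i ∈ laurentMon w P (insert i J) :=
      AddSubmonoid.subset_closure (.inr ⟨i, Finset.mem_insert_self _ _, .inl rfl⟩)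
    have hi2 : -w i ∈ laurentMon w P (insert i J) :=
      AddSubmonoid.subset_closure (.inr ⟨i, Finset.mem_insert_self _ _, .inr rfl⟩)
    have hle1 : laurentMon w P J ≤ laurentMon w P (insert i J) := by
      refine AddSubmonoid.closure_le.2 ?_
      rintro _ (⟨k, hk, rfl⟩ | ⟨k, hk, rfl | rfl⟩)
      exacts [hmem1 k hk, (hmem2 k hk).1, (hmem2 k hk).2]
    have hle2 : laurentMon w (insert i P) J ≤ laurentMon w P (insert i J) := by
      refine AddSubmonoid.closure_le.2 ?_
      rintro _ (⟨k, hk, rfl⟩ | ⟨k, hk, rfl | rfl⟩)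
      · rcases Finset.mem_insert.1 hk with rfl | hk
        exacts [hi1, hmem1 k hk]
      exacts [(hmem2 k hk).1, (hmem2 k hk).2]
    obtain ⟨c, hc⟩ := exists_dual_of_linearIndependent hw (fun k => if k = i then (-1 : ℚ) else 0)
    have hci : c (w i) = -1 := by rw [hc, if_pos rfl]
    have hcn : ∀ k, k ≠ i → c (w k) = 0 := fun k hk => by rw [hc, if_neg hk]
    obtain ⟨k, s, U, W, hs, hU, hW, hUW, hWU, heU, hWe⟩ :=
      exists_split_of_direction (ih P (MonicLoc R)) (v := -w i) hi2 c (by rw [map_neg, hci, neg_neg])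
      (fun x hx => by
        refine AddSubmonoid.closure_induction (motive := fun x _ => ∃ z : ℤ, c x = z) ?_ ⟨0, by simp⟩ ?_ hx
        · have : ∀ k, ∃ z : ℤ, c (w k) = z := fun k => by
            by_cases hk : k = i
            · exact ⟨-1, by rw [hk, hci]; simp⟩
            · exact ⟨0, by rw [hcn k hk]; simp⟩
          rintro _ (⟨k, hk, rfl⟩ | ⟨k, hk, rfl | rfl⟩)
          · exact this k
          · exact this k
          · obtain ⟨z, hz⟩ := this k
            exact ⟨-z, by rw [map_neg, hz]; simp⟩
        · rintro x y _ _ ⟨z, hz⟩ ⟨z', hz'⟩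
          exact ⟨z + z', by rw [map_add, hz, hz']; simp⟩)
      (fun x hx => by
        refine AddSubmonoid.closure_induction
          (motive := fun x _ => x - c x • -w i ∈ laurentMon w P J) ?_ (by simp) ?_ hx
        · rintro _ (⟨k, hk, rfl⟩ | ⟨k, hk, rfl | rfl⟩)
          · by_cases hki : k = i
            · rw [hki, hci]; simp
            · rw [hcn k hki]
              have h : w k ∈ laurentMon w P J := AddSubmonoid.subset_closure (.inl ⟨k, hk, rfl⟩)
              simpa using h
          · rcases Finset.mem_insert.1 hk with rfl | hk
            · rw [hci]; simp
            · rw [hcn k (fun h => hiJ (h ▸ hk))]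
              have h : w k ∈ laurentMon w P J := AddSubmonoid.subset_closure (.inr ⟨k, hk, .inl rfl⟩)
              simpa using h
          · rcases Finset.mem_insert.1 hk with rfl | hk
            · rw [map_neg, hci]; simp
            · rw [map_neg, hcn k (fun h => hiJ (h ▸ hk))]
              have h : -w k ∈ laurentMon w P J := AddSubmonoid.subset_closure (.inr ⟨k, hk, .inr rfl⟩)
              simpa using h
        · intro x y _ _ hx hy
          have : x + y - c (x + y) • -w i = (x - c x • -w i) + (y - c y • -w i) := by
            rw [map_add]; module
          rw [this]
          exact add_mem hx hy)
      (fun x hx => ⟨0, by simpa using hle1 hx⟩) heM he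
    set x : AddMonoidAlgebra R V := single (w i) 1 with hx
    set y : AddMonoidAlgebra R V := single (-w i) 1 with hy
    have hxy : x * y = 1 := by
      rw [hx, hy, AddMonoidAlgebra.single_mul_single, add_neg_cancel, mul_one]; rfl
    let _ : Invertible y := ⟨x, hxy, by rw [mul_comm, hxy]⟩
    have hrev : x ^ s.natDegree * aeval y s = aeval x s.reverse := by
      have h : aeval x s.reverse * y ^ s.natDegree = aeval y s := eval₂_reverse_mul_pow _ y s
      rw [← h, mul_comm, mul_assoc, ← mul_pow, mul_comm y, hxy, one_pow, mul_one]
    have hwi : w i ∈ laurentMon w (insert i P) J :=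
      AddSubmonoid.subset_closure (.inl ⟨i, Finset.mem_insert_self _ _, rfl⟩)
    refine splitIn_of_comaximal (A := alg R (laurentMon w (insert i P) J))
      (S := alg R (laurentMon w P (insert i J))) (τ := Unit) (f := aeval x s.reverse) (alg_mono hle2)
      le_rfl (fun n e h1 h2 => (ih (insert i P) R n e h1 h2).mono fun x hx => alg_mono hle2 hx)
      he heM (aeval_single_mem_alg hwi _) (fun _ => x) (fun _ => single_mem_alg (M := laurentMon w (insert i P) J) hwi 1)
      ⟨1, (alg R (laurentMon w (insert i P) J)).one_mem, fun _ => -aeval x s.reverse.divX,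
        fun _ => (alg R (laurentMon w (insert i P) J)).neg_mem (aeval_single_mem_alg hwi _), ?_⟩ ?_ (x ^ s.natDegree • U) W
      (MatIn.smul (pow_mem (single_mem_alg hi1 _) _) hU) hW ?_ ?_ ?_ hWe
    · have h1 : aeval x s.reverse = aeval x s.reverse.divX * x + 1 := by
        conv_lhs => rw [← divX_mul_X_add s.reverse, coeff_zero_reverse, hs.leadingCoeff]
        simp
      rw [Fintype.sum_unique, h1]
      ring
    · rintro b hb -
      have hall : ∀ z ∈ laurentMon w P (insert i J), ∃ N : ℕ,
          N • w i + z ∈ laurentMon w (insert i P) J := by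
        intro z hz
        refine AddSubmonoid.closure_induction (motive := fun z _ => ∃ N : ℕ,
          N • w i + z ∈ laurentMon w (insert i P) J) ?_ ⟨0, by simp⟩ ?_ hz
        · rintro _ (⟨k, hk, rfl⟩ | ⟨k, hk, rfl | rfl⟩)
          · exact ⟨0, by rw [zero_smul, zero_add]; exact
              AddSubmonoid.subset_closure (.inl ⟨k, Finset.mem_insert_of_mem hk, rfl⟩)⟩
          · rcases Finset.mem_insert.1 hk with rfl | hk
            · exact ⟨0, by rw [zero_smul, zero_add]; exact hwi⟩
            · exact ⟨0, by rw [zero_smul, zero_add]; exact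
                AddSubmonoid.subset_closure (.inr ⟨k, hk, .inl rfl⟩)⟩
          · rcases Finset.mem_insert.1 hk with rfl | hk
            · exact ⟨1, by simp⟩
            · exact ⟨0, by rw [zero_smul, zero_add]; exact
                AddSubmonoid.subset_closure (.inr ⟨k, hk, .inr rfl⟩)⟩
        · rintro a b _ _ ⟨N, h1⟩ ⟨N', h2⟩
          refine ⟨N + N', ?_⟩
          rw [add_smul, add_add_add_comm]
          exact add_mem h1 h2
      obtain ⟨N, hN⟩ := exists_pow_single_mul_mem_alg hwi hall hb
      exact ⟨N, hN N le_rfl⟩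
    · rw [Matrix.smul_mul, hUW, smul_smul, hrev]
    · rw [Matrix.mul_smul, hWU, smul_smul, hrev]
    · rw [Matrix.mul_smul, heU]

theorem exists_linearIndependent_closure_eq {L : AddSubgroup V} (hL : L.FG) :
    ∃ (r : ℕ) (w : Fin r → V), LinearIndependent ℚ w ∧ AddSubgroup.closure (Set.range w) = L := by
  have hfin : Module.Finite ℤ (AddSubgroup.toIntSubmodule L) := by
    rw [Module.Finite.iff_fg, Submodule.fg_iff_addSubgroup_fg]
    exact hL
  have := IsAddTorsionFree.of_module_rat V
  have : Module.Free ℤ (AddSubgroup.toIntSubmodule L) := inferInstance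
  let b := Module.finBasis ℤ (AddSubgroup.toIntSubmodule L)
  refine ⟨_, fun i => (b i : V), ?_, ?_⟩
  · rw [← LinearIndependent.iff_fractionRing ℤ ℚ]
    exact b.linearIndependent.map' (Submodule.subtype _) (Submodule.ker_subtype _)
  · have h := congrArg (Submodule.map (AddSubgroup.toIntSubmodule L).subtype) b.span_eq
    rw [Submodule.map_span, Submodule.map_top, Submodule.range_subtype, ← Set.range_comp] at h
    have h2 := congrArg Submodule.toAddSubgroup h
    rw [Submodule.span_int_eq_addSubgroupClosure] at h2
    exact h2

theorem subIdemFree_addSubgroup {L : AddSubgroup V} (hL : L.FG) (R : Type*) [CommRing R]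
    [IsDomain R] [IsPrincipalIdealRing R] : SubIdemFree R L.toAddSubmonoid := by
  obtain ⟨r, w, hw, rfl⟩ := exists_linearIndependent_closure_eq hL
  have h := subIdemFree_laurentMon hw Finset.univ ∅ R
  have h2 : laurentMon w ∅ Finset.univ = (AddSubgroup.closure (Set.range w)).toAddSubmonoid := by
    rw [AddSubgroup.closure_toAddSubmonoid, laurentMon]
    congr 1
    ext x
    simp only [Finset.notMem_empty, false_and, exists_false, Finset.mem_univ, true_and, false_or,
      Set.mem_ofPred_eq, Set.mem_union, Set.mem_range, Set.mem_neg, ← exists_or]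
    refine exists_congr fun i => ?_
    rw [eq_comm, eq_comm (a := w i) (b := -x), neg_eq_iff_eq_neg]
  rwa [h2] at h

end Laurent

end

section

open Matrix

/-! ### Open rational cones -/

section Cones

variable {V : Type*} [AddCommGroup V]

/-- `Ω` is a rational convex cone, open in the rational space spanned by `L`. -/
structure OpenCone (L : AddSubgroup V) (Ω : Set V) : Prop where
  add_mem : ∀ {x y}, x ∈ Ω → y ∈ Ω → x + y ∈ Ω
  nsmul_mem_iff : ∀ {n : ℕ} {x : V}, 0 < n → (n • x ∈ Ω ↔ x ∈ Ω)
  exists_nsmul_mem : ∀ {x}, x ∈ Ω → ∃ n : ℕ, 0 < n ∧ n • x ∈ L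
  exists_nsmul_add_mem : ∀ {x y}, x ∈ Ω → y ∈ L → ∃ n : ℕ, 0 < n ∧ n • x + y ∈ Ω

/-- The monoid generated by the lattice points of `Ω`. -/
def coneMon (L : AddSubgroup V) (Ω : Set V) : AddSubmonoid V :=
  AddSubmonoid.closure (Ω ∩ L)

theorem mem_coneMon {L : AddSubgroup V} {Ω : Set V} (h : ∀ {x y}, x ∈ Ω → y ∈ Ω → x + y ∈ Ω)
    {x : V} : x ∈ coneMon L Ω ↔ x = 0 ∨ x ∈ Ω ∧ x ∈ L := by
  constructor
  · intro hx
    refine AddSubmonoid.closure_induction (motive := fun x _ => x = 0 ∨ x ∈ Ω ∧ x ∈ L)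
      (fun x hx => .inr hx) (.inl rfl) ?_ hx
    rintro x y - - (rfl | hx) (rfl | hy)
    · exact .inl (add_zero _)
    · exact .inr (by rwa [zero_add])
    · exact .inr (by rwa [add_zero])
    · exact .inr ⟨h hx.1 hy.1, L.add_mem hx.2 hy.2⟩
  · rintro (rfl | hx)
    · exact zero_mem _
    · exact AddSubmonoid.subset_closure hx

namespace OpenCone

variable {L : AddSubgroup V} {Ω : Set V}

theorem mem_coneMon (h : OpenCone L Ω) {x : V} : x ∈ coneMon L Ω ↔ x = 0 ∨ x ∈ Ω ∧ x ∈ L :=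
  _root_.mem_coneMon h.add_mem

theorem nsmul_mem (h : OpenCone L Ω) {n : ℕ} (hn : 0 < n) {x : V} (hx : x ∈ Ω) : n • x ∈ Ω :=
  (h.nsmul_mem_iff hn).2 hx

variable [Module ℚ V]

theorem qsmul_mem (h : OpenCone L Ω) {q : ℚ} (hq : 0 < q) {x : V} (hx : x ∈ Ω) : q • x ∈ Ω := by
  rw [← h.nsmul_mem_iff q.den_pos]
  have h1 : q.den • q • x = q.num.toNat • x := by
    rw [← Nat.cast_smul_eq_nsmul ℚ, ← Nat.cast_smul_eq_nsmul ℚ, smul_smul, Rat.den_mul_eq_num]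
    congr 1
    have := Int.toNat_of_nonneg (Rat.num_pos.2 hq).le
    exact_mod_cast this.symm
  rw [h1]
  exact h.nsmul_mem (by have := Rat.num_pos.2 hq; omega) hx

theorem add_nsmul_mem (h : OpenCone L Ω) {x y : V} (hx : x ∈ Ω) (hy : y ∈ Ω) (n : ℕ) :
    x + n • y ∈ Ω := by
  rcases n.eq_zero_or_pos with rfl | hn
  · simpa using hx
  · exact h.add_mem hx (h.nsmul_mem hn hy)

/-- The set of points `γ + q v` with `γ ∈ Γ` and `q ≥ 0` rational. -/
def _root_.coneAdd (Γ : Set V) (v : V) : Set V :=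
  {x | ∃ n : ℕ, 0 < n ∧ ∃ j : ℕ, n • x - j • v ∈ Γ}

theorem _root_.subset_coneAdd (Γ : Set V) (v : V) : Γ ⊆ coneAdd Γ v :=
  fun x hx => ⟨1, one_pos, 0, by simpa using hx⟩

theorem coneAdd_subset {Γ : Set V} (h : OpenCone L Ω) (hΓ : Γ ⊆ Ω) {v : V} (hv : v ∈ Ω) :
    coneAdd Γ v ⊆ Ω := by
  rintro x ⟨n, hn, j, hx⟩
  rw [← h.nsmul_mem_iff hn]
  have := h.add_nsmul_mem (hΓ hx) hv j
  rwa [sub_add_cancel] at this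

theorem coneAdd (h : OpenCone L Ω) {v : V} (hv : v ∈ L) : OpenCone L (coneAdd Ω v) where
  add_mem := by
    rintro x y ⟨n, hn, j, hx⟩ ⟨n', hn', j', hy⟩
    refine ⟨n * n', by positivity, n' * j + n * j', ?_⟩
    have := h.add_mem (h.nsmul_mem hn' hx) (h.nsmul_mem hn hy)
    convert this using 1
    module
  nsmul_mem_iff := by
    intro m x hm
    constructor
    · rintro ⟨n, hn, j, hx⟩
      exact ⟨n * m, by positivity, j, by rwa [mul_smul]⟩
    · rintro ⟨n, hn, j, hx⟩
      refine ⟨n, hn, m * j, ?_⟩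
      convert h.nsmul_mem hm hx using 1
      module
  exists_nsmul_mem := by
    rintro x ⟨n, hn, j, hx⟩
    obtain ⟨m, hm, h1⟩ := h.exists_nsmul_mem hx
    refine ⟨m * n, by positivity, ?_⟩
    have h2 := L.add_mem h1 (L.nsmul_mem hv (m * j))
    convert h2 using 1
    module
  exists_nsmul_add_mem := by
    rintro x y ⟨n, hn, j, hx⟩ hy
    obtain ⟨m, hm, h1⟩ := h.exists_nsmul_add_mem hx hy
    refine ⟨m * n, by positivity, 1, one_pos, m * j, ?_⟩
    convert h1 using 1
    module

theorem add_qsmul_mem_coneAdd {Γ : Set V} (h : OpenCone L Γ) {v x : V}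
    (hx : x ∈ _root_.coneAdd Γ v) {q : ℚ} (hq : 0 ≤ q) : x + q • v ∈ _root_.coneAdd Γ v := by
  obtain ⟨n, hn, j, hx⟩ := hx
  refine ⟨n * q.den, Nat.mul_pos hn q.den_pos, q.den * j + n * q.num.toNat, ?_⟩
  have := h.nsmul_mem q.den_pos hx
  convert this using 1
  have h1 : (q.num.toNat : ℚ) = q.den * q := by
    rw [mul_comm, Rat.mul_den_eq_num]
    exact_mod_cast Int.toNat_of_nonneg (Rat.num_nonneg.2 hq)
  simp only [← Nat.cast_smul_eq_nsmul ℚ]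
  push_cast
  rw [h1]
  module

theorem notMem_coneAdd {Γ : Set V} (h : OpenCone L Ω) (h0 : (0 : V) ∉ Ω) (hΓ : OpenCone L Γ)
    (hΓΩ : Γ ⊆ Ω) {v : V} (hv : v ∈ Ω) (hvΓ : v ∉ Γ) : v ∉ _root_.coneAdd Γ v := by
  rintro ⟨n, hn, j, hx⟩
  rcases lt_trichotomy n j with hlt | rfl | hlt
  · obtain ⟨k, rfl⟩ := Nat.exists_eq_add_of_lt hlt
    have h1 := h.add_nsmul_mem (hΓΩ hx) hv (k + 1)
    refine h0 ?_
    convert h1 using 1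
    module
  · exact h0 (hΓΩ (by simpa using hx))
  · obtain ⟨k, rfl⟩ := Nat.exists_eq_add_of_lt hlt
    refine hvΓ ((hΓ.nsmul_mem_iff k.succ_pos).1 ?_)
    convert hx using 1
    rw [Nat.succ_eq_add_one]
    module

/-- The projection of `D` along `v` onto the kernel of `c`. -/
def _root_.coneProj (D : Set V) (v : V) (c : V →ₗ[ℚ] ℚ) : Set V :=
  {x | c x = 0 ∧ ∃ q : ℚ, x + q • v ∈ D}

theorem coneProj {D : Set V} (h : OpenCone L D) {v : V} (hv : v ∈ L) {c : V →ₗ[ℚ] ℚ}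
    (hcv : c v = 1) (hc : ∀ x ∈ L, ∃ z : ℤ, c x = z) :
    OpenCone (L ⊓ c.toAddMonoidHom.ker) (coneProj D v c) where
  add_mem := by
    rintro x y ⟨hx, q, hxq⟩ ⟨hy, r, hyr⟩
    refine ⟨by rw [map_add, hx, hy, add_zero], q + r, ?_⟩
    convert h.add_mem hxq hyr using 1
    module
  nsmul_mem_iff := by
    intro n x hn
    constructor
    · rintro ⟨hx, q, hxq⟩
      have hn' : (n : ℚ) ≠ 0 := by positivity
      refine ⟨by simpa [hn.ne'] using hx, q / n, ?_⟩
      rw [← h.nsmul_mem_iff hn]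
      convert hxq using 1
      rw [← Nat.cast_smul_eq_nsmul ℚ, ← Nat.cast_smul_eq_nsmul ℚ, smul_add, smul_smul,
        mul_div_cancel₀ _ hn']
    · rintro ⟨hx, q, hxq⟩
      refine ⟨by rw [map_nsmul, hx, smul_zero], n * q, ?_⟩
      convert h.nsmul_mem hn hxq using 1
      module
  exists_nsmul_mem := by
    rintro x ⟨hx, q, hxq⟩
    obtain ⟨n, hn, h1⟩ := h.exists_nsmul_mem hxq
    refine ⟨n, hn, ?_, ?_⟩
    · obtain ⟨z, hz⟩ := hc _ h1
      have hnq : (n : ℚ) * q = z := by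
        rw [← hz, map_nsmul, map_add, hx, zero_add, map_smul, hcv]
        simp
      have h2 := L.sub_mem h1 (L.zsmul_mem hv z)
      change n • x ∈ L
      convert h2 using 1
      rw [← Int.cast_smul_eq_zsmul ℚ, ← hnq]
      module
    · change c (n • x) = 0
      rw [map_nsmul, hx, smul_zero]
  exists_nsmul_add_mem := by
    rintro x y ⟨hx, q, hxq⟩ ⟨hy, hyc⟩
    obtain ⟨n, hn, h1⟩ := h.exists_nsmul_add_mem hxq hy
    refine ⟨n, hn, ?_, n * q, ?_⟩
    · rw [map_add, map_nsmul, hx, smul_zero, zero_add]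
      exact hyc
    · convert h1 using 1
      module

theorem zero_notMem_coneProj {D : Set V} (hD : OpenCone L D) (h : OpenCone L Ω)
    (h0 : (0 : V) ∉ Ω) (hDΩ : D ⊆ Ω) {v : V} (hvΩ : v ∈ Ω) (hvD : v ∉ D) (c : V →ₗ[ℚ] ℚ) :
    (0 : V) ∉ _root_.coneProj D v c := by
  rintro ⟨-, q, hq⟩
  rw [zero_add] at hq
  rcases lt_trichotomy q 0 with hlt | rfl | hlt
  · have h1 := h.add_mem (hDΩ hq) (h.qsmul_mem (neg_pos.2 hlt) hvΩ)
    refine h0 ?_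
    convert h1 using 1
    module
  · exact h0 (hDΩ (by simpa using hq))
  · refine hvD ?_
    have := hD.qsmul_mem (inv_pos.2 hlt) hq
    rwa [smul_smul, inv_mul_cancel₀ hlt.ne', one_smul] at this

end OpenCone

variable [Module ℚ V]

theorem finrank_span_inf_ker_lt {L : AddSubgroup V} (hL : L.FG) {v : V} (hv : v ∈ L)
    {c : V →ₗ[ℚ] ℚ} (hcv : c v ≠ 0) :
    Module.finrank ℚ (Submodule.span ℚ ((L ⊓ c.toAddMonoidHom.ker : AddSubgroup V) : Set V)) <
      Module.finrank ℚ (Submodule.span ℚ (L : Set V)) := by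
  have : Module.Finite ℚ (Submodule.span ℚ (L : Set V)) := by
    obtain ⟨S, rfl⟩ := hL
    have h : Submodule.span ℚ (AddSubgroup.closure (S : Set V) : Set V) = Submodule.span ℚ S := by
      refine le_antisymm (Submodule.span_le.2 ?_) (Submodule.span_mono AddSubgroup.subset_closure)
      have : AddSubgroup.closure (S : Set V) ≤ (Submodule.span ℚ (S : Set V)).toAddSubgroup :=
        (AddSubgroup.closure_le _).2 Submodule.subset_span
      exact this
    rw [h]
    exact Module.Finite.span_finset ℚ S
  refine Submodule.finrank_lt_finrank_of_lt (lt_of_le_of_ne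
    (Submodule.span_mono fun x hx => hx.1) fun h => hcv ?_)
  have h1 : Submodule.span ℚ ((L ⊓ c.toAddMonoidHom.ker : AddSubgroup V) : Set V) ≤
      LinearMap.ker c := Submodule.span_le.2 fun x hx => hx.2
  exact h1 (h ▸ Submodule.subset_span hv)

theorem AddSubgroup.FG.of_le {G : Type*} [AddCommGroup G] {L L' : AddSubgroup G} (hL : L.FG)
    (h : L' ≤ L) : L'.FG := by
  have h1 : (AddSubgroup.toIntSubmodule L).FG := by
    rw [Submodule.fg_iff_addSubgroup_fg]; exact hL
  have : IsNoetherian ℤ (AddSubgroup.toIntSubmodule L) := isNoetherian_of_fg_of_noetherian _ h1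
  have h2 : (AddSubgroup.toIntSubmodule L').FG := by
    have := (isNoetherian_submodule.1 this) (AddSubgroup.toIntSubmodule L') h
    exact this
  rw [Submodule.fg_iff_addSubgroup_fg] at h2
  exact h2

end Cones

end

section

open Matrix Polynomial

/-! ### Inverting `1 + I` and extending projections to localizations -/

section Radical

open AddMonoidAlgebra (single)

variable {V : Type*} [AddCommGroup V] {R : Type*} [CommRing R]

theorem exists_one_add_mul_aeval {A K : Type*} [CommRing A] [CommRing K] [Algebra A K] {I : Ideal A}
    {a : integralClosure A K}
    (ha : a ∈ (I.map (algebraMap A (integralClosure A K))).radical) :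
    ∃ q : A[X], ∃ x ∈ I, (1 + (a : K)) * aeval (a : K) q = 1 + algebraMap A K x := by
  obtain ⟨k, hk⟩ := ha
  obtain ⟨p, hpm, hp0, hpI⟩ := exists_monic_aeval_eq_zero_forall_mem_of_mem_map hk
  have hp0' : aeval ((a : K) ^ k) p = 0 := by
    have := congrArg (integralClosure A K).val hp0
    rw [map_zero, ← aeval_algHom_apply] at this
    exact this
  set y₀ : A := (-1) ^ k with hy₀
  have hdiv : ((a : K) ^ k - (-1) ^ k) * aeval ((a : K) ^ k) (p /ₘ (X - Polynomial.C y₀)) =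
      -algebraMap A K (p.eval y₀) := by
    have h1 := congrArg (aeval ((a : K) ^ k)) (modByMonic_add_div p (X - Polynomial.C y₀))
    rw [modByMonic_X_sub_C_eq_C_eval, hp0', map_add, map_mul, map_sub, aeval_X, aeval_C,
      aeval_C] at h1
    have h2 : algebraMap A K y₀ = (-1) ^ k := by
      rw [hy₀, map_pow, map_neg, map_one]
    rw [h2] at h1
    linear_combination h1
  have h_eval_sub : p.eval y₀ - y₀ ^ p.natDegree ∈ I := by
    rw [eval_eq_sum_range, Finset.sum_range_succ, hpm.coeff_natDegree, one_mul, add_sub_cancel_right]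
    exact sum_mem fun i hi => I.mul_mem_right _ (hpI i (Finset.mem_range.1 hi).ne)
  have hb₀ : (a : K) ^ k - (-1) ^ k = (1 + a) *
      aeval (a : K) (∑ i ∈ Finset.range k, X ^ i * (-1 : A[X]) ^ (k - 1 - i)) := by
    rw [← (Commute.all (a : K) (-1)).geom_sum₂_mul]
    simp only [map_sum, map_mul, map_pow, aeval_X, map_neg, map_one]
    ring
  refine ⟨(∑ i ∈ Finset.range k, X ^ i * (-1 : A[X]) ^ (k - 1 - i)) *
    (p /ₘ (X - Polynomial.C y₀)).comp (X ^ k) * -(-1) ^ (k * p.natDegree),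
    (p.eval y₀ - y₀ ^ p.natDegree) * (-1) ^ (k * p.natDegree), I.mul_mem_right _ h_eval_sub, ?_⟩
  have h6 : ((-1 : K) ^ (k * p.natDegree)) * (-1) ^ (k * p.natDegree) = 1 := by
    rw [← mul_pow]; simp
  rw [map_mul, map_mul, ← mul_assoc, ← mul_assoc, ← hb₀, aeval_comp, map_pow, aeval_X, hdiv, hy₀]
  simp only [map_mul, map_pow, map_neg, map_one, map_sub]
  rw [← pow_mul]
  linear_combination h6

theorem exists_mul_sub_one_mem_supp {L : AddSubgroup V} {Γ : Set V}
    (hadd : ∀ {x y}, x ∈ Γ → y ∈ Γ → x + y ∈ Γ) (hsmul : ∀ {n : ℕ} {x}, 0 < n → x ∈ Γ → n • x ∈ Γ)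
    (hL : ∀ {x}, x ∈ Γ → ∃ n : ℕ, 0 < n ∧ n • x ∈ L)
    {a : AddMonoidAlgebra R V} (ha : a ∈ supp R Γ) :
    ∃ b ∈ alg R (coneMon ⊤ Γ), (1 + a) * b - 1 ∈ supp R (Γ ∩ L) := by
  have hle : alg R (coneMon L Γ) ≤ alg R (coneMon ⊤ Γ) :=
    alg_mono (AddSubmonoid.closure_mono fun x hx => ⟨hx.1, trivial⟩)
  let I : Ideal (alg R (coneMon L Γ)) :=
    { carrier := {x | (x : AddMonoidAlgebra R V) ∈ supp R (Γ ∩ L)}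
      add_mem' := fun hx hy => (supp R (Γ ∩ L)).add_mem hx hy
      zero_mem' := (supp R (Γ ∩ L)).zero_mem
      smul_mem' := fun c x hx => mul_mem_supp (T₁ := (coneMon L Γ : Set V)) (fun x hx y hy => by
        rcases (mem_coneMon hadd).1 hx with rfl | hx
        · rwa [zero_add]
        · exact ⟨hadd hx.1 hy.1, L.add_mem hx.2 hy.2⟩) c.2 hx }
  have key : ∃ h : a ∈ integralClosure (alg R (coneMon L Γ)) (AddMonoidAlgebra R V),
      (⟨a, h⟩ : integralClosure (alg R (coneMon L Γ)) (AddMonoidAlgebra R V)) ∈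
        (I.map (algebraMap _ _)).radical := by
    refine supp_induction (p := fun a => ∃ h : a ∈ integralClosure (alg R (coneMon L Γ))
      (AddMonoidAlgebra R V),
      (⟨a, h⟩ : integralClosure (alg R (coneMon L Γ)) (AddMonoidAlgebra R V)) ∈
        (I.map (algebraMap _ _)).radical) ⟨Subalgebra.zero_mem _, Ideal.zero_mem _⟩ ?_ ?_ ha
    · rintro f g ⟨h1, h2⟩ ⟨h3, h4⟩
      exact ⟨Subalgebra.add_mem _ h1 h3, Ideal.add_mem _ h2 h4⟩
    · intro x hx r
      obtain ⟨N, hN, hxN⟩ := hL hx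
      have h1 : (single x r : AddMonoidAlgebra R V) ^ N = single (N • x) (r ^ N) :=
        AddMonoidAlgebra.single_pow _ _ _
      have h2 : (single (N • x) (r ^ N) : AddMonoidAlgebra R V) ∈ supp R (Γ ∩ L) :=
        single_mem_supp (T := Γ ∩ L) ⟨hsmul hN hx, hxN⟩ _
      have h3 : (single (N • x) (r ^ N) : AddMonoidAlgebra R V) ∈ alg R (coneMon L Γ) :=
        single_mem_alg (M := coneMon L Γ)
          (AddSubmonoid.subset_closure (s := Γ ∩ L) ⟨hsmul hN hx, hxN⟩) _
      have h4 : IsIntegral (alg R (coneMon L Γ)) (single x r : AddMonoidAlgebra R V) := by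
        refine IsIntegral.of_pow hN ?_
        rw [h1]
        exact isIntegral_algebraMap (x := (⟨_, h3⟩ : alg R (coneMon L Γ)))
      refine ⟨h4, N, ?_⟩
      have h5 : (⟨single x r, h4⟩ :
          integralClosure (alg R (coneMon L Γ)) (AddMonoidAlgebra R V)) ^ N =
          algebraMap (alg R (coneMon L Γ)) _ ⟨single (N • x) (r ^ N), h3⟩ := Subtype.ext h1
      rw [h5]
      exact Ideal.mem_map_of_mem _ h2
  obtain ⟨haC, hk⟩ := key
  obtain ⟨q, x, hx, hq⟩ := exists_one_add_mul_aeval hk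
  refine ⟨aeval a q, ?_, ?_⟩
  · rw [aeval_eq_sum_range]
    exact Subring.sum_mem _ fun i _ => Subring.mul_mem _ (hle (q.coeff i).2) (Subring.pow_mem _
      (supp_mono (T' := (coneMon ⊤ Γ : Set V))
      (fun x hx => AddSubmonoid.subset_closure (s := Γ ∩ (⊤ : AddSubgroup V)) ⟨hx, trivial⟩) ha) i)
  · rw [hq, add_sub_cancel_left]
    exact hx

end Radical

section LocalizationExtension

/-- An additive map that is linear over a multiplicative set extends to the localization. -/
theorem exists_addMonoidHom_localization {K F : Type*} [CommRing K] [CommRing F] [Algebra K F]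
    (Y : Submonoid K) [IsLocalization Y F] (ρ : K →+ K) (hρ : ∀ y ∈ Y, ∀ x, ρ (y * x) = y * ρ x) :
    ∃ σ : F →+ F, ∀ (x : K) (y : Y),
      σ (IsLocalization.mk' F x y) = IsLocalization.mk' F (ρ x) y := by
  have h : ∀ z : F, ∃ w : F, ∀ (x : K) (y : Y), IsLocalization.mk' F x y = z →
      IsLocalization.mk' F (ρ x) y = w := by
    intro z
    obtain ⟨x₀, y₀, h0⟩ := IsLocalization.exists_mk'_eq Y z
    refine ⟨IsLocalization.mk' F (ρ x₀) y₀, fun x y hxy => ?_⟩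
    rw [← h0, IsLocalization.eq] at hxy
    obtain ⟨c, hc⟩ := hxy
    rw [IsLocalization.eq]
    refine ⟨c, ?_⟩
    have h1 := congrArg ρ hc
    rwa [hρ _ c.2, hρ _ y₀.2, hρ _ c.2, hρ _ y.2] at h1
  choose σ hσ using h
  have hσ' : ∀ (x : K) (y : Y), σ (IsLocalization.mk' F x y) = IsLocalization.mk' F (ρ x) y :=
    fun x y => (hσ _ x y rfl).symm
  refine ⟨⟨⟨σ, ?_⟩, ?_⟩, hσ'⟩
  · have := hσ' 0 1
    rwa [map_zero, IsLocalization.mk'_zero] at this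
  · intro z w
    obtain ⟨x, y, rfl⟩ := IsLocalization.exists_mk'_eq Y z
    obtain ⟨x', y', rfl⟩ := IsLocalization.exists_mk'_eq Y w
    change σ _ = σ _ + σ _
    rw [← IsLocalization.mk'_add, hσ', hσ', hσ', ← IsLocalization.mk'_add, map_add,
      mul_comm x, mul_comm x', hρ _ y'.2, hρ _ y.2, mul_comm (y' : K), mul_comm (y : K)]

end LocalizationExtension

end

section

open Matrix Polynomial

/-! ### Splitting over a localization at `1 + I` -/

section Denominators

variable {A A' : Type*} [CommRing A] [CommRing A'] [Algebra A A'] {T : Submonoid A}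
  [IsLocalization T A'] {I : Ideal A}

theorem exists_smul_eq_map_polynomial {p : A'[X]}
    (hp : ∀ k, p.coeff k ∈ I.map (algebraMap A A')) :
    ∃ t ∈ T, ∃ q : A[X], (∀ k, q.coeff k ∈ I) ∧ q.natDegree ≤ p.natDegree ∧
      q.map (algebraMap A A') = Polynomial.C (algebraMap A A' t) * p := by
  obtain ⟨t, ht⟩ := exists_common_mul (ι := Fin (p.natDegree + 1)) (S := T)
    (fun t k => ∃ a ∈ I, algebraMap A A' a = algebraMap A A' t * p.coeff k)
    (fun k => by
      obtain ⟨⟨a, t⟩, h⟩ := (IsLocalization.mem_map_algebraMap_iff T A').1 (hp k)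
      exact ⟨t, a, a.2, by rw [← h, mul_comm]⟩)
    (fun s t k ⟨a, ha, h⟩ => ⟨t * a, I.mul_mem_left _ ha, by
      rw [map_mul, h, Submonoid.coe_mul, map_mul, mul_assoc]⟩)
  choose a haI ha using ht
  refine ⟨t, t.2, ∑ k : Fin (p.natDegree + 1), monomial (k : ℕ) (a k), fun k => ?_, ?_, ?_⟩
  · rw [finsetSum_coeff]
    refine sum_mem fun j _ => ?_
    rw [coeff_monomial]
    split_ifs
    exacts [haI _, zero_mem _]
  · refine natDegree_sum_le_of_forall_le _ _ fun k _ => (natDegree_monomial_le _).trans ?_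
    omega
  · rw [Polynomial.map_sum]
    conv_rhs => rw [p.as_sum_range_C_mul_X_pow, Finset.mul_sum, Finset.sum_range]
    refine Finset.sum_congr rfl fun k _ => ?_
    rw [map_monomial, ha, ← C_mul_X_pow_eq_monomial, Polynomial.C_mul, mul_assoc]

theorem map_le_jacobson_bot (hIT : ∀ a ∈ I, ∃ b, (1 + a) * b ∈ T) (hT : ∀ t ∈ T, t - 1 ∈ I) :
    I.map (algebraMap A A') ≤ Ideal.jacobson ⊥ := by
  intro x hx
  rw [Ideal.mem_jacobson_bot]
  intro y
  obtain ⟨⟨a, t⟩, h⟩ := (IsLocalization.mem_map_algebraMap_iff T A').1 (Ideal.mul_mem_right y _ hx)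
  have h1 : (a : A) + t - 1 ∈ I := by
    rw [add_sub_assoc]
    exact I.add_mem a.2 (hT _ t.2)
  obtain ⟨b, hb⟩ := hIT _ h1
  rw [add_sub_cancel] at hb
  have h2 : IsUnit (algebraMap A A' (a + t)) :=
    isUnit_of_mul_isUnit_left (y := algebraMap A A' b) (by
      rw [← map_mul]; exact IsLocalization.map_units A' (⟨_, hb⟩ : T))
  refine isUnit_of_mul_isUnit_left (y := algebraMap A A' t) ?_
  rw [add_mul, one_mul]
  dsimp only at h
  rw [h, ← map_add]
  exact h2

end Denominators

section

variable {A K A' F : Type*} [CommRing A] [CommRing K] [CommRing A'] [CommRing F]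
  [Algebra A K] [Algebra A A'] [Algebra A' F] [Algebra K F] [Algebra A F] [IsScalarTower A A' F]
  [IsScalarTower A K F]

theorem aeval_map_eq_algebraMap_aeval (v : K) (p : A[X]) :
    aeval (algebraMap K F v) (p.map (algebraMap A A')) = algebraMap K F (aeval v p) := by
  rw [aeval_map_algebraMap, aeval_algebraMap_apply]

theorem exists_aeval_of_mem_smul_range {I : Ideal A'} {w x : F}
    (hx : x ∈ I • Subalgebra.toSubmodule (aeval (R := A') w).range) :
    ∃ p : A'[X], (∀ k, p.coeff k ∈ I) ∧ aeval w p = x := by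
  induction hx using Submodule.smul_induction_on' with
  | smul a ha x hx =>
    obtain ⟨q, rfl⟩ := hx
    exact ⟨Polynomial.C a * q, fun k => by rw [coeff_C_mul]; exact I.mul_mem_right _ ha,
      by rw [map_mul, aeval_C, Algebra.smul_def]; rfl⟩
  | add x _ y _ hx hy =>
    obtain ⟨p, hp, rfl⟩ := hx
    obtain ⟨q, hq, rfl⟩ := hy
    exact ⟨p + q, fun k => by rw [coeff_add]; exact add_mem (hp k) (hq k), map_add _ _ _⟩

theorem aeval_mem_smul_range {I : Ideal A'} (w : F) {p : A'[X]} (hp : ∀ k, p.coeff k ∈ I) :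
    aeval w p ∈ I • Subalgebra.toSubmodule (aeval (R := A') w).range := by
  rw [aeval_eq_sum_range]
  exact sum_mem fun k _ => Submodule.smul_mem_smul (hp k) ⟨X ^ k, by simp⟩

theorem algebraMap_mem_range {v x : K} (hx : x ∈ (aeval (R := A) v).range) :
    algebraMap K F x ∈ (aeval (R := A') (algebraMap K F v)).range := by
  obtain ⟨p, rfl⟩ := hx
  exact ⟨p.map (algebraMap A A'), aeval_map_eq_algebraMap_aeval v p⟩

/-- Roberts' theorem over the localization of `A` at a multiplicative subset of `1 + I`, with
denominators cleared. -/
theorem exists_split_of_isLocalization_one_add [IsDomain K] {I : Ideal A} {T : Submonoid A}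
    [IsLocalization T A'] (hIT : ∀ a ∈ I, ∃ b, (1 + a) * b ∈ T) (hT : ∀ t ∈ T, t - 1 ∈ I)
    {Y : Submonoid K} [IsLocalization Y F] (hY : Y ≤ nonZeroDivisors K)
    (hTY : ∀ t ∈ T, algebraMap A K t ∈ Y) (ρ : K →+ K) (hρ : ∀ x y, ρ (ρ x * y) = ρ x * ρ y)
    (hρ1 : ρ 1 = 1) (hρY : ∀ y ∈ Y, ρ y = y) {v : K} {S : Submonoid A[X]}
    (hS : ∀ s ∈ S, s.Monic) (hSY : ∀ s ∈ S, aeval v s ∈ Y)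
    (hρI : ∀ p : A[X], (∀ k, p.coeff k ∈ I) → ∃ q : A[X], (∀ k, q.coeff k ∈ I) ∧
      q.natDegree ≤ p.natDegree ∧ ρ (aeval v p) = aeval v q)
    {m n : Type*} [Fintype m] [Fintype n] [DecidableEq n] {e : Matrix m m K} {U₁ U₂ : Matrix m n K}
    {W₁ W₂ : Matrix n m K} {s : A[X]} (hs : s ∈ S) (he : MatIn (aeval (R := A) v).range e)
    (hU₁ : MatIn (aeval (R := A) v).range U₁) (hW₁ : MatIn (aeval (R := A) v).range W₁)
    (hU₂ : MatIn (aeval (R := A) v).range U₂) (hW₂ : MatIn (aeval (R := A) v).range W₂)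
    (hUW : U₂ * W₂ = (aeval v s) ^ 2 • e) (hWU : W₂ * U₂ = (aeval v s) ^ 2 • 1)
    (heI : ∀ i j, ∃ p : A[X], (∀ k, p.coeff k ∈ I) ∧ aeval v p = (e - U₁ * W₁) i j)
    (hWI : ∀ i j, ∃ p : A[X], (∀ k, p.coeff k ∈ I) ∧
      aeval v p = (W₂ * U₁ - aeval v s • (1 : Matrix n n K)) i j)
    (hρe : ∀ i j, ρ (e i j) = e i j) (hρU₁ : ∀ i j, ρ (U₁ i j) = U₁ i j)
    (hρU₂ : ∀ i j, ρ (U₂ i j) = U₂ i j) (hρW₂ : ∀ i j, ρ (W₂ i j) = W₂ i j) :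
    ∃ t ∈ T, ∃ (U : Matrix m n K) (W : Matrix n m K), (∀ i j, ∃ p : A[X], U i j = ρ (aeval v p)) ∧
      (∀ i j, ∃ p : A[X], W i j = ρ (aeval v p)) ∧ U * W = algebraMap A K t • e ∧
      W * U = algebraMap A K t • 1 := by
  have hinj : Function.Injective (algebraMap K F) := IsLocalization.injective F hY
  obtain ⟨σ, hσ⟩ := exists_addMonoidHom_localization (F := F) Y ρ fun y hy x => by
    have := hρ y x
    rwa [hρY y hy] at this
  have hσι : ∀ x, σ (algebraMap K F x) = algebraMap K F (ρ x) := fun x => by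
    rw [← IsLocalization.mk'_one (M := Y) F x, hσ, IsLocalization.mk'_one]
  have hσσ : ∀ x y, σ (σ x * y) = σ x * σ y := by
    intro x y
    obtain ⟨x, a, rfl⟩ := IsLocalization.exists_mk'_eq Y x
    obtain ⟨y, b, rfl⟩ := IsLocalization.exists_mk'_eq Y y
    rw [hσ, hσ, ← IsLocalization.mk'_mul, ← IsLocalization.mk'_mul, hσ, hρ]
  have hσ1 : σ 1 = 1 := by rw [← map_one (algebraMap K F), hσι, hρ1]
  have hσl : ∀ x y, σ x = x → σ (x * y) = x * σ y := fun x y hx => by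
    have := hσσ x y
    rwa [hx] at this
  have hσY : ∀ y ∈ Y, ∀ x, σ (algebraMap K F y * x) = algebraMap K F y * σ x :=
    fun y hy x => hσl _ _ (by rw [hσι, hρY y hy])
  have hunit : ∀ y ∈ Y, IsUnit (algebraMap K F y) := fun y hy =>
    IsLocalization.map_units F (⟨y, hy⟩ : Y)
  have htower : ∀ a, algebraMap A' F (algebraMap A A' a) = algebraMap K F (algebraMap A K a) :=
    fun a => by rw [← IsScalarTower.algebraMap_apply, ← IsScalarTower.algebraMap_apply]
  set w : F := algebraMap K F v with hw
  set I' : Ideal A' := I.map (algebraMap A A') with hI'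
  set S' : Submonoid A'[X] := S.map (mapRingHom (algebraMap A A')) with hS'
  have hS'm : ∀ s ∈ S', s.Monic := by
    rintro _ ⟨s, hs, rfl⟩
    exact (hS s hs).map _
  have haev : ∀ p : A[X], aeval w (p.map (algebraMap A A')) = algebraMap K F (aeval v p) :=
    aeval_map_eq_algebraMap_aeval v
  have hι : ∀ {x : K}, x ∈ (aeval (R := A) v).range →
      algebraMap K F x ∈ (aeval (R := A') w).range := fun hx => algebraMap_mem_range hx
  have hιI : ∀ p : A[X], (∀ k, p.coeff k ∈ I) →
      algebraMap K F (aeval v p) ∈ I' • Subalgebra.toSubmodule (aeval (R := A') w).range :=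
    fun p hp => by
      rw [← haev]
      exact aeval_mem_smul_range w fun k => by
        rw [coeff_map]
        exact Ideal.mem_map_of_mem _ (hp k)
  obtain ⟨τ, hτ⟩ := (hunit _ (hSY s hs)).exists_right_inv
  have hs' : s.map (algebraMap A A') ∈ S' := ⟨s, hs, rfl⟩
  have hτσ : σ τ = τ := by
    have h1 := hσY _ (hSY s hs) τ
    rw [hτ, hσ1] at h1
    rw [← mul_one (σ τ), ← hτ, mul_left_comm, ← mul_assoc, ← h1, one_mul]
  have hτfrac : ∀ p : A[X], τ * algebraMap K F (aeval v p) ∈ Roberts.fracs w S' hS'm false :=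
    fun p => ⟨_, hs', p.map (algebraMap A A'), by simp, by simp, by
      rw [haev, haev, ← mul_assoc, hτ, one_mul]⟩
  have hfix : ∀ x, ρ x = x → σ (τ * algebraMap K F x) = τ * algebraMap K F x := fun x hx => by
    rw [hσl _ _ hτσ, hσι, hx]
  set ι : K →+* F := algebraMap K F with hιdef
  have hUWι : U₂.map ι * W₂.map ι = (ι (aeval v s)) ^ 2 • e.map ι := by
    rw [← Matrix.map_mul, hUW]
    ext i j
    rw [Matrix.map_apply, Matrix.smul_apply, smul_eq_mul, map_mul, map_pow]
    rfl
  have hWUι : W₂.map ι * U₂.map ι = (ι (aeval v s)) ^ 2 • 1 := by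
    rw [← Matrix.map_mul, hWU]
    ext i j
    rw [Matrix.map_apply, Matrix.smul_apply, smul_eq_mul, map_mul, map_pow, Matrix.smul_apply,
      Matrix.one_apply, Matrix.one_apply, apply_ite ι, map_one, map_zero, smul_eq_mul]
  have hττ : τ * τ * ι (aeval v s) ^ 2 = 1 := by
    linear_combination (τ * ι (aeval v s) + 1) * hτ
  have hdiv : ∀ {t x y} (ht : t ∈ T), ι (algebraMap A K t) * x = ι y →
      x = IsLocalization.mk' A' 1 (⟨t, ht⟩ : T) • ι y := by
    intro t x y ht h
    have h1 := IsLocalization.mk'_spec A' 1 (⟨t, ht⟩ : T)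
    rw [map_one] at h1
    rw [← h, Algebra.smul_def, ← htower, ← mul_assoc, ← map_mul, h1, map_one, one_mul]
  have key := Roberts.exists_split (v := w) (S := S') (I := I') (e := e.map ι) (U₁ := U₁.map ι)
    (W₁ := W₁.map ι) (Φ := τ • W₂.map ι) (Ψ := τ • U₂.map ι) hS'm
    (map_le_jacobson_bot hIT hT) (fun i j => hι (he i j)) (fun i j => hι (hU₁ i j))
    (fun i j => hι (hW₁ i j))
    (fun i j => by
      obtain ⟨p, hp⟩ := hW₂ i j
      have := hτfrac p
      rwa [show aeval v p = W₂ i j from hp] at this)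
    (fun i j => by
      obtain ⟨p, hp⟩ := hU₂ i j
      have := hτfrac p
      rwa [show aeval v p = U₂ i j from hp] at this)
    (by rw [Matrix.smul_mul, Matrix.mul_smul, hWUι, smul_smul, smul_smul, hττ, one_smul])
    (by rw [Matrix.smul_mul, Matrix.mul_smul, hUWι, smul_smul, smul_smul, hττ, one_smul])
    (fun i j => by
      obtain ⟨p, hp, h⟩ := heI i j
      rw [← Matrix.map_mul, ← Matrix.map_sub ι (map_sub ι), Matrix.map_apply, ← h]
      exact hιI p hp)
    (fun i j => by
      obtain ⟨p, hp, h⟩ := hWI i j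
      have h2 : (τ • W₂.map ι * U₁.map ι - 1 : Matrix n n F) i j = τ * ι (aeval v p) := by
        rw [h, Matrix.smul_mul, ← Matrix.map_mul, Matrix.sub_apply, Matrix.sub_apply,
          Matrix.smul_apply, Matrix.smul_apply, Matrix.map_apply, map_sub, smul_eq_mul, smul_eq_mul,
          map_mul, mul_sub, ← mul_assoc, mul_comm τ (ι (aeval v s)), hτ, one_mul,
          Matrix.one_apply, Matrix.one_apply, apply_ite ι, map_one, map_zero]
      rw [h2]
      have h3 : τ * ι (aeval v p) = ∑ k ∈ Finset.range (p.natDegree + 1),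
          algebraMap A A' (p.coeff k) • (τ * ι (aeval v (X ^ k : A[X]))) := by
        rw [aeval_eq_sum_range, map_sum, Finset.mul_sum]
        refine Finset.sum_congr rfl fun k _ => ?_
        rw [Algebra.smul_def, Algebra.smul_def, htower, map_mul, aeval_X_pow]
        ring
      rw [h3]
      exact sum_mem fun k _ => Submodule.smul_mem_smul (Ideal.mem_map_of_mem _ (hp k)) (hτfrac _))
    σ (fun x => by
      have := hσσ x 1
      rwa [mul_one, hσ1, mul_one] at this) hσ1
    (fun i j => by rw [Matrix.map_apply, hσι, hρU₁])
    (fun i j x => hσl _ _ (hfix _ (hρW₂ i j)))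
    (fun x hx => by
      obtain ⟨p, hp, rfl⟩ := exists_aeval_of_mem_smul_range hx
      obtain ⟨t, ht, q, hq, -, hqp⟩ := exists_smul_eq_map_polynomial (T := T) hp
      obtain ⟨q', hq', -, hqq'⟩ := hρI q hq
      rw [hdiv ht (x := σ (aeval w p)) (y := aeval v q') (by
        rw [← hσY _ (hTY t ht), ← hqq', ← hσι, ← haev, hqp, map_mul (aeval w), aeval_C, htower])]
      exact Submodule.smul_mem _ _ (hιI _ hq'))
    (fun x hx => by
      obtain ⟨_, ⟨s', hs', rfl⟩, p, hp, hdeg, hx⟩ := Roberts.isFrac_of_mem_smul hS'm hx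
      obtain ⟨t, ht, q, hq, hqd, hqp⟩ := exists_smul_eq_map_polynomial (T := T) hp
      obtain ⟨q', hq', hqd', hqq'⟩ := hρI q hq
      change aeval w (s'.map (algebraMap A A')) * x = _ at hx
      rw [haev] at hx
      have h1 : ι (aeval v s') * σ x = IsLocalization.mk' A' 1 (⟨t, ht⟩ : T) • ι (aeval v q') := by
        rw [← hσY _ (hSY s' hs'), hx]
        exact hdiv ht (by
          rw [← hσY _ (hTY t ht), ← hqq', ← hσι, ← haev, hqp, map_mul (aeval w), aeval_C, htower])
      obtain ⟨τ', hτ'⟩ := (hunit _ (hSY s' hs')).exists_right_inv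
      have h2 : σ x = IsLocalization.mk' A' 1 (⟨t, ht⟩ : T) •
          ∑ k ∈ Finset.range (q'.natDegree + 1),
          algebraMap A A' (q'.coeff k) • (τ' * ι (v ^ k)) := by
        have h3 : ∑ k ∈ Finset.range (q'.natDegree + 1),
          algebraMap A A' (q'.coeff k) • (τ' * ι (v ^ k)) = τ' * ι (aeval v q') := by
          rw [aeval_eq_sum_range, map_sum, Finset.mul_sum]
          refine Finset.sum_congr rfl fun k _ => ?_
          rw [Algebra.smul_def, Algebra.smul_def, htower, map_mul]
          ring
        rw [h3, ← mul_smul_comm, ← h1, ← mul_assoc, mul_comm τ', hτ', one_mul]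
      rw [h2]
      refine Submodule.smul_mem _ _ (sum_mem fun k hk => Submodule.smul_mem_smul
        (Ideal.mem_map_of_mem _ (hq' k))
        ⟨s'.map (algebraMap A A'), ⟨s', hs', rfl⟩, X ^ k, fun _ => trivial, fun h => ?_, ?_⟩)
      · refine (natDegree_X_pow_le k).trans ?_
        have h4 : p.natDegree ≤ (s'.map (algebraMap A A')).natDegree := hdeg h
        have h5 := Finset.mem_range.1 hk
        omega
      · rw [haev, ← mul_assoc, hτ', one_mul, map_pow, map_pow, aeval_X])
  obtain ⟨Q, z, hQ, hu, hz, huz, hzu⟩ := key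
  have huσ : ∀ i j, σ (((τ • U₂.map ι) * Q) i j) = ((τ • U₂.map ι) * Q) i j := fun i j => by
    rw [Matrix.mul_apply, map_sum]
    refine Finset.sum_congr rfl fun k _ => ?_
    rw [hσl _ _ (by exact hfix _ (hρU₂ i k)), hQ]
  generalize (τ • U₂.map ι) * Q = u at huσ huz hzu hu
  have hzu' : z.map σ * u = 1 := by
    ext i j
    rw [Matrix.mul_apply]
    have h := congrArg σ (congrFun (congrFun hzu i) j)
    rw [Matrix.mul_apply, map_sum, Matrix.one_apply, apply_ite σ, hσ1, map_zero] at h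
    rw [Matrix.one_apply, ← h]
    refine Finset.sum_congr rfl fun k _ => ?_
    rw [mul_comm, mul_comm (z i k), hσl _ _ (huσ k j), Matrix.map_apply]
  have huz' : u * z.map σ = e.map ι := by
    ext i j
    rw [Matrix.mul_apply]
    have h := congrArg σ (congrFun (congrFun huz i) j)
    rw [Matrix.mul_apply, map_sum, Matrix.map_apply, hσι, hρe] at h
    rw [Matrix.map_apply, ← h]
    refine Finset.sum_congr rfl fun k _ => ?_
    rw [hσl _ _ (huσ i k), Matrix.map_apply]
  have hclear : ∀ x ∈ (aeval (R := A') w).range, ∃ t : T, ∃ p : A[X],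
      ι (ρ (aeval v p)) = ι (algebraMap A K t) * σ x := by
    rintro _ ⟨p, rfl⟩
    have hp : ∀ k, p.coeff k ∈ (⊤ : Ideal A).map (algebraMap A A') := by
      rw [Ideal.map_top]
      exact fun _ => trivial
    obtain ⟨t, ht, q, -, -, hq⟩ := exists_smul_eq_map_polynomial (T := T) hp
    refine ⟨⟨t, ht⟩, q, ?_⟩
    change _ = _ * σ (aeval w p)
    rw [← hσι, ← haev, hq, map_mul (aeval w), aeval_C, htower, hσY _ (hTY t ht)]
  have hmul : ∀ (s t : T) x, (∃ p : A[X], ι (ρ (aeval v p)) = ι (algebraMap A K t) * σ x) →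
      ∃ p : A[X], ι (ρ (aeval v p)) = ι (algebraMap A K ↑(s * t)) * σ x := by
    rintro s t x ⟨p, hp⟩
    refine ⟨Polynomial.C (s : A) * p, ?_⟩
    rw [map_mul (aeval v), aeval_C, ← hσι, map_mul ι, hσY _ (hTY s s.2), hσι, hp,
      Submonoid.coe_mul, map_mul, map_mul, mul_assoc]
  obtain ⟨t, ht⟩ := exists_common_mul (ι := m × n) (S := T)
    (fun t k => (∃ p : A[X], ι (ρ (aeval v p)) = ι (algebraMap A K t) * σ (u k.1 k.2)) ∧
      ∃ p : A[X], ι (ρ (aeval v p)) = ι (algebraMap A K t) * σ (z k.2 k.1))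
    (fun k => by
      obtain ⟨t₁, h₁⟩ := hclear _ (hu k.1 k.2)
      obtain ⟨t₂, h₂⟩ := hclear _ (hz k.2 k.1)
      exact ⟨t₁ * t₂, mul_comm t₂ t₁ ▸ hmul t₂ t₁ _ h₁, hmul t₁ t₂ _ h₂⟩)
    (fun s t k h => ⟨hmul t s _ h.1, hmul t s _ h.2⟩)
  choose p hp using fun i j => (ht (i, j)).1
  choose q hq using fun i j => (ht (j, i)).2
  have hU : (Matrix.of fun i j => ρ (aeval v (p i j))).map ι = ι (algebraMap A K t) • u := by
    ext i j
    rw [Matrix.map_apply, Matrix.of_apply, hp, huσ, Matrix.smul_apply, smul_eq_mul]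
  have hW : (Matrix.of fun i j => ρ (aeval v (q i j))).map ι =
      ι (algebraMap A K t) • z.map σ := by
    ext i j
    rw [Matrix.map_apply, Matrix.of_apply, hq, Matrix.smul_apply, Matrix.map_apply, smul_eq_mul]
  refine ⟨t * t, T.mul_mem t.2 t.2, .of fun i j => ρ (aeval v (p i j)),
    .of fun i j => ρ (aeval v (q i j)), fun i j => ⟨_, rfl⟩, fun i j => ⟨_, rfl⟩,
    Matrix.map_injective hinj ?_, Matrix.map_injective hinj ?_⟩
  · beta_reduce
    rw [Matrix.map_mul, hU, hW, Matrix.smul_mul, Matrix.mul_smul, huz']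
    ext i j
    simp only [Matrix.smul_apply, Matrix.map_apply, smul_eq_mul, map_mul, mul_assoc]
  · beta_reduce
    rw [Matrix.map_mul, hU, hW, Matrix.smul_mul, Matrix.mul_smul, hzu']
    ext i j
    simp only [Matrix.smul_apply, Matrix.map_apply, smul_eq_mul, map_mul, mul_assoc,
      Matrix.one_apply, apply_ite ι, map_one, map_zero]

end

end

section

open Matrix Polynomial

/-! ### Splitting after inverting an element near one -/

section Direction

open AddMonoidAlgebra (single)

variable {V : Type*} [AddCommGroup V] [Module ℚ V] {R : Type*} [CommRing R]
variable {L : AddSubgroup V} {Γ : Set V} {v : V}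

/-- The monoid generated by the lattice points of the cone `Γ + ℚ≥0 v` together with `v`. -/
def dirMon (L : AddSubgroup V) (Γ : Set V) (v : V) : AddSubmonoid V :=
  AddSubmonoid.closure (coneAdd Γ v ∩ L ∪ {v})

theorem mem_dirMon (hΓ : OpenCone L Γ) (hv : v ∈ L) {x : V} :
    x ∈ dirMon L Γ v ↔ (∃ j : ℕ, x = j • v) ∨ x ∈ coneAdd Γ v ∩ L := by
  have hD := hΓ.coneAdd hv
  have hDv : ∀ x ∈ coneAdd Γ v ∩ L, ∀ j : ℕ, x + j • v ∈ coneAdd Γ v ∩ (L : Set V) :=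
    fun x hx j => ⟨by
      have := hΓ.add_qsmul_mem_coneAdd hx.1 (q := j) (Nat.cast_nonneg j)
      rwa [Nat.cast_smul_eq_nsmul] at this, L.add_mem hx.2 (L.nsmul_mem hv j)⟩
  constructor
  · intro hx
    refine AddSubmonoid.closure_induction
      (motive := fun x _ => (∃ j : ℕ, x = j • v) ∨ x ∈ coneAdd Γ v ∩ L) ?_ ?_ ?_ hx
    · rintro x (hx | rfl)
      · exact .inr hx
      · exact .inl ⟨1, (one_nsmul _).symm⟩
    · exact .inl ⟨0, (zero_nsmul v).symm⟩
    · rintro x y - - (⟨i, rfl⟩ | hx) (⟨j, rfl⟩ | hy)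
      · exact .inl ⟨i + j, (add_nsmul v i j).symm⟩
      · exact .inr (add_comm y _ ▸ hDv y hy i)
      · exact .inr (hDv x hx j)
      · exact .inr ⟨hD.add_mem hx.1 hy.1, L.add_mem hx.2 hy.2⟩
  · rintro (⟨j, rfl⟩ | hx)
    · exact AddSubmonoid.nsmul_mem _ (AddSubmonoid.subset_closure (.inr rfl)) j
    · exact AddSubmonoid.subset_closure (.inl hx)

variable (R Γ) in
/-- The monoid algebra of the monoid generated by `Γ`. -/
abbrev ConeAlg : Type _ := ↥(alg R (coneMon ⊤ Γ))

/-- The ideal of the elements of `ConeAlg R Γ` supported in `Γ`. -/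
def coneIdeal (R : Type*) [CommRing R] (hΓ : OpenCone L Γ) : Ideal (ConeAlg R Γ) where
  carrier := {x | (x : AddMonoidAlgebra R V) ∈ supp R Γ}
  zero_mem' := (supp R Γ).zero_mem
  add_mem' := (supp R Γ).add_mem
  smul_mem' a x hx := mul_mem_supp (T₁ := (coneMon ⊤ Γ : Set V)) (T₂ := Γ) (fun y hy z hz => by
    rcases hΓ.add_mem |> mem_coneMon |>.1 hy with rfl | h
    · rwa [zero_add]
    · exact hΓ.add_mem h.1 hz) a.2 hx

/-- `f` is a polynomial in the `N`-th root of `v` with coefficients in `I`. -/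
def IsPolyIn (v : V) (I : Ideal (ConeAlg R Γ)) (N : ℕ+) (f : AddMonoidAlgebra R V) : Prop :=
  ∃ p : (ConeAlg R Γ)[X], (∀ k, p.coeff k ∈ I) ∧
    aeval (single ((N : ℚ)⁻¹ • v) 1 : AddMonoidAlgebra R V) p = f

theorem root_pow (N k : ℕ+) : (single (((k * N : ℕ+) : ℚ)⁻¹ • v) 1 : AddMonoidAlgebra R V) ^ (k : ℕ)
    = single ((N : ℚ)⁻¹ • v) 1 := by
  rw [← single_nsmul_one, ← Nat.cast_smul_eq_nsmul ℚ, smul_smul]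
  congr 2
  have : (k : ℚ) ≠ 0 := by exact_mod_cast k.ne_zero
  have : (N : ℚ) ≠ 0 := by exact_mod_cast N.ne_zero
  push_cast
  field_simp

theorem root_pow_self (N : ℕ+) : (single ((N : ℚ)⁻¹ • v) 1 : AddMonoidAlgebra R V) ^ (N : ℕ)
    = single v 1 := by
  have := root_pow (R := R) (v := v) 1 N
  rw [mul_one] at this
  rw [this]
  simp

theorem IsPolyIn.mul_left {I : Ideal (ConeAlg R Γ)} {N : ℕ+} {f : AddMonoidAlgebra R V}
    (h : IsPolyIn v I N f) (k : ℕ+) : IsPolyIn v I (k * N) f := by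
  obtain ⟨p, hp, rfl⟩ := h
  refine ⟨expand _ k p, fun n => ?_, ?_⟩
  · rw [coeff_expand k.pos]
    split_ifs
    exacts [hp _, zero_mem _]
  · rw [expand_aeval, root_pow]

theorem IsPolyIn.exists_add {I : Ideal (ConeAlg R Γ)} {f g : AddMonoidAlgebra R V}
    (hf : ∃ N, IsPolyIn v I N f) (hg : ∃ N, IsPolyIn v I N g) : ∃ N, IsPolyIn v I N (f + g) := by
  obtain ⟨M, hf⟩ := hf
  obtain ⟨N, hg⟩ := hg
  obtain ⟨p, hp, hpf⟩ := hf.mul_left N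
  obtain ⟨q, hq, hqg⟩ := hg.mul_left M
  rw [mul_comm M N] at hqg
  exact ⟨N * M, p + q, fun k => by rw [coeff_add]; exact I.add_mem (hp k) (hq k),
    by rw [map_add, hpf, hqg]⟩

theorem exists_isPolyIn_of_mem_supp (hΓ : OpenCone L Γ) {f : AddMonoidAlgebra R V}
    (hf : f ∈ supp R (coneAdd Γ v ∩ L)) : ∃ N, IsPolyIn v (coneIdeal R hΓ) N f := by
  refine supp_induction (p := fun f => ∃ N, IsPolyIn v (coneIdeal R hΓ) N f)
    ⟨1, 0, by simp, by simp⟩ (fun f g => IsPolyIn.exists_add) ?_ hf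
  rintro x ⟨⟨n, hn, j, hx⟩, -⟩ a
  have hn' : (n : ℚ) ≠ 0 := by exact_mod_cast hn.ne'
  have hγ : (n : ℚ)⁻¹ • (n • x - j • v) ∈ Γ := hΓ.qsmul_mem (by positivity) hx
  refine ⟨⟨n, hn⟩, monomial j ⟨single _ a, single_mem_alg (M := coneMon ⊤ Γ)
    (AddSubmonoid.subset_closure (s := Γ ∩ (⊤ : AddSubgroup V)) ⟨hγ, trivial⟩) a⟩, fun k => ?_, ?_⟩
  · rw [coeff_monomial]
    split_ifs
    · exact single_mem_supp hγ a
    · exact zero_mem _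
  · rw [aeval_monomial, ← single_nsmul_one]
    change single _ a * single _ 1 = _
    rw [AddMonoidAlgebra.single_mul_single, mul_one]
    congr 1
    rw [PNat.mk_coe, smul_sub, ← Nat.cast_smul_eq_nsmul ℚ n, ← Nat.cast_smul_eq_nsmul ℚ j,
      ← Nat.cast_smul_eq_nsmul ℚ j, smul_smul, inv_mul_cancel₀ hn', one_smul, smul_comm]
    abel

theorem IsPolyIn.mono {I J : Ideal (ConeAlg R Γ)} (hIJ : I ≤ J) {N : ℕ+}
    {f : AddMonoidAlgebra R V} (h : IsPolyIn v I N f) : IsPolyIn v J N f := by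
  obtain ⟨p, hp, h⟩ := h
  exact ⟨p, fun k => hIJ (hp k), h⟩

theorem exists_isPolyIn_of_mem_alg (hΓ : OpenCone L Γ) (hv : v ∈ L) {f : AddMonoidAlgebra R V}
    (hf : f ∈ alg R (dirMon L Γ v)) : ∃ N, IsPolyIn (Γ := Γ) v ⊤ N f := by
  obtain ⟨f₁, hf₁, g, hg, rfl⟩ := exists_add_of_mem_supp_union (T₁ := {x | ∃ j : ℕ, x = j • v})
    (T₂ := coneAdd Γ v ∩ L) (supp_mono (T := (dirMon L Γ v : Set V)) 
    (fun x hx => (mem_dirMon hΓ hv).1 hx) hf)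
  obtain ⟨N, hN⟩ := exists_isPolyIn_of_mem_supp hΓ hg
  refine IsPolyIn.exists_add ?_ ⟨N, hN.mono le_top⟩
  refine supp_induction (p := fun f => ∃ N, IsPolyIn (Γ := Γ) v ⊤ N f)
    ⟨1, 0, by simp, by simp⟩ (fun f g => IsPolyIn.exists_add) ?_ hf₁
  rintro _ ⟨j, rfl⟩ a
  refine ⟨1, monomial j ⟨single 0 a, single_mem_alg (zero_mem _) a⟩, fun _ => trivial, ?_⟩
  rw [aeval_monomial, ← single_nsmul_one]
  change single _ a * single _ 1 = _
  rw [AddMonoidAlgebra.single_mul_single, mul_one]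
  simp

theorem aeval_root_mem_supp (hΓ : OpenCone L Γ) (N : ℕ+) (p : (ConeAlg R Γ)[X]) :
    aeval (single ((N : ℚ)⁻¹ • v) 1 : AddMonoidAlgebra R V) p ∈
      supp R ({x | ∃ j : ℕ, x = j • (N : ℚ)⁻¹ • v} ∪ coneAdd Γ v) := by
  rw [aeval_eq_sum_range]
  refine (supp R _).sum_mem fun k _ => ?_
  rw [← single_nsmul_one]
  refine mul_mem_supp (T₁ := (coneMon ⊤ Γ : Set V)) (T₂ := {k • (N : ℚ)⁻¹ • v}) ?_ (p.coeff k).2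
    (single_mem_supp (Set.mem_singleton _) 1)
  rintro x hx _ rfl
  rcases mem_coneMon hΓ.add_mem |>.1 hx with rfl | h
  · exact .inl ⟨k, zero_add _⟩
  · right
    have := hΓ.add_qsmul_mem_coneAdd (subset_coneAdd Γ v h.1) (q := k * (N : ℚ)⁻¹) (by positivity)
    rwa [mul_smul, Nat.cast_smul_eq_nsmul] at this

theorem filt_aeval_root_mem_alg (hΓ : OpenCone L Γ) (hv : v ∈ L) (c : V →ₗ[ℚ] ℚ) (hcv : c v = 1)
    (hc : ∀ x ∈ L, ∃ z : ℤ, c x = z) (N : ℕ+) (p : (ConeAlg R Γ)[X]) :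
    filt (L : Set V) (aeval (single ((N : ℚ)⁻¹ • v) 1 : AddMonoidAlgebra R V) p) ∈
      alg R (dirMon L Γ v) := by
  refine supp_mono ?_ (filt_mem (N := (L : Set V)) (aeval_root_mem_supp hΓ N p))
  rintro _ ⟨⟨j, rfl⟩ | hx, hL⟩
  · refine (mem_dirMon hΓ hv).2 (.inl ?_)
    obtain ⟨z, hz⟩ := hc _ hL
    rw [← Nat.cast_smul_eq_nsmul ℚ, smul_smul, map_smul, hcv, smul_eq_mul, mul_one] at hz
    have hz0 : 0 ≤ z := by
      have : (0 : ℚ) ≤ z := hz ▸ by positivity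
      exact_mod_cast this
    refine ⟨z.toNat, ?_⟩
    rw [← Nat.cast_smul_eq_nsmul ℚ, ← Nat.cast_smul_eq_nsmul ℚ, smul_smul, hz]
    congr 1
    exact_mod_cast (Int.toNat_of_nonneg hz0).symm
  · exact (mem_dirMon hΓ hv).2 (.inr ⟨hx, hL⟩)

theorem filt_mul_single (N : Set V) (f : AddMonoidAlgebra R V) (y : V) (a : R) :
    filt N (f * single y a) = filt {x | x + y ∈ N} f * single y a := by
  refine supp_induction (p := fun f => filt N (f * single y a) = filt {x | x + y ∈ N} f * single y a)
    (by simp) (fun f g hf hg => by rw [add_mul, map_add, hf, hg, map_add, add_mul]) ?_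
    (mem_supp_coeff_support f)
  intro x _ b
  rw [AddMonoidAlgebra.single_mul_single]
  by_cases h : x + y ∈ N
  · rw [filt_single_of_mem h, filt_single_of_mem (N := {x | x + y ∈ N}) h,
      AddMonoidAlgebra.single_mul_single]
  · rw [filt_single_of_notMem h, filt_single_of_notMem (N := {x | x + y ∈ N}) h, zero_mul]

theorem exists_filt_aeval_eq (hΓ : OpenCone L Γ) (w : V) (p : (ConeAlg R Γ)[X])
    (hp : ∀ k, p.coeff k ∈ coneIdeal R hΓ) :
    ∃ q : (ConeAlg R Γ)[X], (∀ k, q.coeff k ∈ coneIdeal R hΓ) ∧ q.natDegree ≤ p.natDegree ∧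
      filt (L : Set V) (aeval (single w 1 : AddMonoidAlgebra R V) p) = aeval (single w 1) q := by
  have hq : ∀ k, filt {x | x + k • w ∈ L} (p.coeff k : AddMonoidAlgebra R V) ∈ supp R Γ :=
    fun k => supp_mono Set.inter_subset_left (filt_mem (hp k))
  have hq' : ∀ k, filt {x | x + k • w ∈ L} (p.coeff k : AddMonoidAlgebra R V) ∈
      alg R (coneMon ⊤ Γ) := fun k =>
    supp_mono (T := Γ) (T' := (coneMon ⊤ Γ : Set V)) (fun x hx =>
      AddSubmonoid.subset_closure (s := Γ ∩ (⊤ : AddSubgroup V)) ⟨hx, trivial⟩) (hq k)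
  refine ⟨∑ k ∈ Finset.range (p.natDegree + 1), monomial k ⟨_, hq' k⟩, fun k => ?_, ?_, ?_⟩
  · rw [finsetSum_coeff]
    refine sum_mem fun j _ => ?_
    rw [coeff_monomial]
    split_ifs
    exacts [hq j, zero_mem _]
  · refine natDegree_sum_le_of_forall_le _ _ fun k hk => (natDegree_monomial_le _).trans ?_
    have := Finset.mem_range.1 hk
    omega
  · rw [aeval_eq_sum_range, map_sum, map_sum]
    refine Finset.sum_congr rfl fun k _ => ?_
    rw [aeval_monomial, ← single_nsmul_one]
    exact filt_mul_single _ _ _ _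

theorem filt_one_add_mul {f : AddMonoidAlgebra R V} (hf : f ∈ supp R (L : Set V))
    (g : AddMonoidAlgebra R V) : filt (L : Set V) (f * g) = f * filt (L : Set V) g :=
  filt_mul_left (T := (L : Set V)) (fun x hx y => ⟨fun h => by
    have := L.sub_mem h hx
    rwa [add_sub_cancel_left] at this, fun h => L.add_mem hx h⟩) hf g

/-- The submonoid of nonzero elements of the group algebra of `L`. -/
def nonzeroAlg (R : Type*) [CommRing R] [IsDomain R] (L : AddSubgroup V) :
    Submonoid (AddMonoidAlgebra R V) where
  carrier := {f | f ∈ alg R L.toAddSubmonoid ∧ f ≠ 0}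
  one_mem' := ⟨Subring.one_mem _, one_ne_zero⟩
  mul_mem' hf hg := ⟨Subring.mul_mem _ hf.1 hg.1, mul_ne_zero hf.2 hg.2⟩

/-- The submonoid of the elements `t` of `ConeAlg R Γ` with `t - 1` supported in `Γ ∩ L`. -/
def oneAdd (R : Type*) [CommRing R] (hΓ : OpenCone L Γ) : Submonoid (ConeAlg R Γ) where
  carrier := {t | (t - 1 : AddMonoidAlgebra R V) ∈ supp R (Γ ∩ L)}
  one_mem' := by
    change ((1 : AddMonoidAlgebra R V) - 1) ∈ supp R (Γ ∩ L)
    rw [sub_self]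
    exact (supp R _).zero_mem
  mul_mem' {s t} hs ht := by
    change ((s : AddMonoidAlgebra R V) * t - 1) ∈ supp R (Γ ∩ L)
    have h : (s : AddMonoidAlgebra R V) * t - 1 = (s - 1) * (t - 1) + (s - 1) + (t - 1) := by ring
    rw [h]
    exact (supp R _).add_mem ((supp R _).add_mem (mul_mem_supp (T₁ := Γ ∩ L)
      (T₂ := Γ ∩ L) (T₃ := Γ ∩ L) (fun x hx y hy =>
      ⟨hΓ.add_mem hx.1 hy.1, L.add_mem hx.2 hy.2⟩) hs ht) hs) ht

theorem exists_split_one_add [IsDomain R] (hΓ : OpenCone L Γ) (h0 : (0 : V) ∉ Γ) (hv : v ∈ L)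
    (c : V →ₗ[ℚ] ℚ) (hcv : c v = 1) (hc : ∀ x ∈ L, ∃ z : ℤ, c x = z) {m n : Type*} [Fintype m]
    [Fintype n] [DecidableEq n] {s : R[X]} (hs : s.Monic) {e : Matrix m m (AddMonoidAlgebra R V)}
    {U₁ U₂ : Matrix m n (AddMonoidAlgebra R V)} {W₁ W₂ : Matrix n m (AddMonoidAlgebra R V)}
    (he : MatIn (alg R (dirMon L Γ v)) e) (hU₁ : MatIn (alg R (dirMon L Γ v)) U₁)
    (hW₁ : MatIn (alg R (dirMon L Γ v)) W₁) (hU₂ : MatIn (alg R (dirMon L Γ v)) U₂)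
    (hW₂ : MatIn (alg R (dirMon L Γ v)) W₂)
    (hUW : U₂ * W₂ = (aeval (single v 1 : AddMonoidAlgebra R V) s) ^ 2 • e)
    (hWU : W₂ * U₂ = (aeval (single v 1 : AddMonoidAlgebra R V) s) ^ 2 • 1)
    (heI : MatIn (supp R (coneAdd Γ v ∩ L)) (e - U₁ * W₁))
    (hWI : MatIn (supp R (coneAdd Γ v ∩ L))
      (W₂ * U₁ - aeval (single v 1 : AddMonoidAlgebra R V) s • (1 : Matrix n n _))) :
    ∃ f : AddMonoidAlgebra R V, f - 1 ∈ supp R (Γ ∩ L) ∧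
      ∃ (U : Matrix m n (AddMonoidAlgebra R V)) (W : Matrix n m (AddMonoidAlgebra R V)),
        MatIn (alg R (dirMon L Γ v)) U ∧ MatIn (alg R (dirMon L Γ v)) W ∧ U * W = f • e ∧
        W * U = f • 1 := by
  classical
  let g : (m × m) ⊕ (m × n) ⊕ (n × m) ⊕ (m × n) ⊕ (n × m) ⊕ (m × m) ⊕ (n × n) →
      Ideal (ConeAlg R Γ) × AddMonoidAlgebra R V :=
    Sum.elim (fun i => (⊤, e i.1 i.2)) <| Sum.elim (fun i => (⊤, U₁ i.1 i.2)) <|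
    Sum.elim (fun i => (⊤, W₁ i.1 i.2)) <| Sum.elim (fun i => (⊤, U₂ i.1 i.2)) <|
    Sum.elim (fun i => (⊤, W₂ i.1 i.2)) <|
    Sum.elim (fun i => (coneIdeal R hΓ, (e - U₁ * W₁) i.1 i.2)) fun i => (coneIdeal R hΓ,
      (W₂ * U₁ - aeval (single v 1 : AddMonoidAlgebra R V) s • (1 : Matrix n n _) :
        Matrix n n (AddMonoidAlgebra R V)) i.1 i.2)
  obtain ⟨N, hN⟩ := exists_common_mul (S := ℕ+) (fun N i => IsPolyIn v (g i).1 N (g i).2) (by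
    rintro (i | i | i | i | i | i | i)
    · exact exists_isPolyIn_of_mem_alg hΓ hv (he i.1 i.2)
    · exact exists_isPolyIn_of_mem_alg hΓ hv (hU₁ i.1 i.2)
    · exact exists_isPolyIn_of_mem_alg hΓ hv (hW₁ i.1 i.2)
    · exact exists_isPolyIn_of_mem_alg hΓ hv (hU₂ i.1 i.2)
    · exact exists_isPolyIn_of_mem_alg hΓ hv (hW₂ i.1 i.2)
    · exact exists_isPolyIn_of_mem_supp hΓ (heI i.1 i.2)
    · exact exists_isPolyIn_of_mem_supp hΓ (hWI i.1 i.2)) (fun s t i h => h.mul_left t)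
  have hrange : ∀ {f : AddMonoidAlgebra R V}, IsPolyIn (Γ := Γ) v ⊤ N f →
      f ∈ (aeval (R := ConeAlg R Γ) (single ((N : ℚ)⁻¹ • v) 1 : AddMonoidAlgebra R V)).range :=
    fun ⟨p, _, h⟩ => ⟨p, h⟩
  have hML : dirMon L Γ v ≤ L.toAddSubmonoid :=
    AddSubmonoid.closure_le.2 (Set.union_subset Set.inter_subset_right (by simpa using hv))
  have hfix : ∀ {f}, f ∈ alg R (dirMon L Γ v) → filt (L : Set V) f = f :=
    fun hf => filt_eq_self (alg_mono hML hf)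
  let Y := nonzeroAlg R L
  let T := oneAdd R hΓ
  have hY : Y ≤ nonZeroDivisors (AddMonoidAlgebra R V) :=
    fun y hy => mem_nonZeroDivisors_of_ne_zero hy.2
  have hTY : ∀ t ∈ T, algebraMap (ConeAlg R Γ) (AddMonoidAlgebra R V) t ∈ Y := by
    intro t ht
    change (t - 1 : AddMonoidAlgebra R V) ∈ supp R (Γ ∩ L) at ht
    change (t : AddMonoidAlgebra R V) ∈ _ ∧ (t : AddMonoidAlgebra R V) ≠ 0
    refine ⟨?_, fun h => ?_⟩
    · have h1 := (alg R L.toAddSubmonoid).add_mem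
        (supp_mono Set.inter_subset_right ht : _ ∈ supp R (L : Set V)) (Subring.one_mem _)
      rwa [sub_add_cancel] at h1
    · refine h0 (ht 0 ?_).1
      rw [h]
      simp [AddMonoidAlgebra.one_def]
  let F := Localization Y
  let φ : Localization T →+* F := IsLocalization.lift (M := T)
    (g := algebraMap (ConeAlg R Γ) F) fun t => by
      rw [IsScalarTower.algebraMap_apply (ConeAlg R Γ) (AddMonoidAlgebra R V) F]
      exact IsLocalization.map_units F (⟨_, hTY t t.2⟩ : Y)
  let : Algebra (Localization T) F := φ.toAlgebra
  have : IsScalarTower (ConeAlg R Γ) (Localization T) F := IsScalarTower.of_algebraMap_eq fun x =>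
    (IsLocalization.lift_eq _ _).symm
  let S : Submonoid (ConeAlg R Γ)[X] :=
    { carrier := {s | s.Monic ∧ aeval (single ((N : ℚ)⁻¹ • v) 1 : AddMonoidAlgebra R V) s ∈ Y}
      one_mem' := ⟨monic_one, by rw [map_one]; exact Y.one_mem⟩
      mul_mem' := fun hs ht => ⟨hs.1.mul ht.1, by rw [map_mul]; exact Y.mul_mem hs.2 ht.2⟩ }
  let j : R →+* ConeAlg R Γ := AddMonoidAlgebra.singleZeroRingHom.codRestrict (alg R (coneMon ⊤ Γ))
    fun a => single_mem_alg (zero_mem _) a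
  have hsv : aeval (single ((N : ℚ)⁻¹ • v) 1 : AddMonoidAlgebra R V) (expand _ N (s.map j)) =
      aeval (single v 1 : AddMonoidAlgebra R V) s := by
    rw [expand_aeval, root_pow_self, aeval_def, aeval_def, eval₂_map]
    rfl
  have hsS : expand _ N (s.map j) ∈ S := ⟨(hs.map j).expand N.pos, by
    rw [hsv]
    refine ⟨aeval_single_mem_alg hv s, fun h => hs.ne_zero ?_⟩
    exact aeval_single_injective (fun h => by simp [h] at hcv) (h.trans (map_zero _).symm)⟩
  obtain ⟨t, ht, U, W, hU, hW, h1, h2⟩ := exists_split_of_isLocalization_one_add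
    (A' := Localization T) (F := F)
    (I := coneIdeal R hΓ) (T := T) (Y := Y) (S := S) (v := single ((N : ℚ)⁻¹ • v) 1)
    (fun a ha => by
      obtain ⟨b, hb, h⟩ := exists_mul_sub_one_mem_supp (L := L) hΓ.add_mem
        (fun hn hx => hΓ.nsmul_mem hn hx) hΓ.exists_nsmul_mem ha
      exact ⟨⟨b, hb⟩, h⟩)
    (fun t ht => supp_mono Set.inter_subset_left ht) hY hTY (filt (L : Set V))
    (fun x y => filt_one_add_mul (supp_mono Set.inter_subset_right
      (filt_mem (mem_supp_coeff_support x))) y)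
    (filt_one L.zero_mem) (fun y hy => filt_eq_self hy.1) (fun s hs => hs.1) (fun s hs => hs.2)
    (exists_filt_aeval_eq hΓ _) hsS
    (fun i j => hrange (hN (.inl (i, j))))
    (fun i j => hrange (hN (.inr (.inl (i, j)))))
    (fun i j => hrange (hN (.inr (.inr (.inl (i, j))))))
    (fun i j => hrange (hN (.inr (.inr (.inr (.inl (i, j)))))))
    (fun i j => hrange (hN (.inr (.inr (.inr (.inr (.inl (i, j))))))))
    (by rw [hsv]; exact hUW) (by rw [hsv]; exact hWU)
    (fun i j => hN (.inr (.inr (.inr (.inr (.inr (.inl (i, j))))))))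
    (fun i j => by rw [hsv]; exact hN (.inr (.inr (.inr (.inr (.inr (.inr (i, j))))))))
    (fun i j => hfix (he i j)) (fun i j => hfix (hU₁ i j)) (fun i j => hfix (hU₂ i j))
    (fun i j => hfix (hW₂ i j))
  refine ⟨t, ht, U, W, fun i j => ?_, fun i j => ?_, h1, h2⟩
  · obtain ⟨p, hp⟩ := hU i j
    exact hp ▸ filt_aeval_root_mem_alg hΓ hv c hcv hc N p
  · obtain ⟨p, hp⟩ := hW i j
    exact hp ▸ filt_aeval_root_mem_alg hΓ hv c hcv hc N p

end Direction

end

section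

open Matrix Polynomial

/-! ### Enlarging a cone in one direction -/

section ConeAdd

open AddMonoidAlgebra (single)

variable {V : Type*} [AddCommGroup V] {R : Type*} [CommRing R]

theorem mem_supp_sdiff {N T : Set V} {f : AddMonoidAlgebra R V} (hf : f ∈ supp R T)
    (h : filt N f = 0) : f ∈ supp R (T \ N) := by
  intro x hx
  refine ⟨hf x hx, fun hN => hx ?_⟩
  have := congrArg (fun g => g.coeff x) h
  simpa [coeff_filt, hN] using this

theorem map_filt_eq_self {m n : Type*} {N : Set V} {X : Matrix m n (AddMonoidAlgebra R V)}
    (hX : MatIn (supp R N) X) : X.map (filt N) = X := by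
  ext1 i j
  exact filt_eq_self (hX i j)

theorem matIn_map_filt {m n : Type*} {N T : Set V} {X : Matrix m n (AddMonoidAlgebra R V)}
    (hX : MatIn (supp R T) X) : MatIn (supp R N) (X.map (filt N)) :=
  fun i j => supp_mono Set.inter_subset_right (filt_mem (hX i j))

theorem matIn_supp_sdiff {m n : Type*} {N T : Set V} {X Y : Matrix m n (AddMonoidAlgebra R V)}
    (hX : MatIn (supp R T) X) (hY : MatIn (supp R T) Y) (h : X.map (filt N) = Y.map (filt N)) :
    MatIn (supp R (T \ N)) (X - Y) := fun i j =>
  mem_supp_sdiff ((supp R T).sub_mem (hX i j) (hY i j)) (by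
    refine (map_sub (filt N) (X i j) (Y i j)).trans (sub_eq_zero.2 ?_)
    exact congrFun (congrFun h i) j)

theorem multiples_eq_laurentMon (v : V) :
    AddSubmonoid.multiples v = laurentMon (fun _ : Unit => v) Finset.univ ∅ := by
  refine le_antisymm ?_ ?_
  · rw [AddSubmonoid.multiples_le]
    exact AddSubmonoid.subset_closure (.inl ⟨(), Finset.mem_univ _, rfl⟩)
  · refine AddSubmonoid.closure_le.2 ?_
    rintro x (⟨_, _, rfl⟩ | ⟨i, hi, -⟩)
    · exact AddSubmonoid.mem_multiples _
    · simp at hi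

variable [Module ℚ V] {L : AddSubgroup V} {Γ Ω : Set V} {v : V}

theorem dirMon_le (hv : v ∈ L) : dirMon L Γ v ≤ L.toAddSubmonoid :=
  AddSubmonoid.closure_le.2 (Set.union_subset Set.inter_subset_right (by simpa using hv))

theorem dirMon_le_coneMon (hΩ : OpenCone L Ω) (hΓΩ : Γ ⊆ Ω) (hv : v ∈ L) (hvΩ : v ∈ Ω) :
    dirMon L Γ v ≤ coneMon L Ω := by
  refine AddSubmonoid.closure_le.2 (Set.union_subset (fun x hx => ?_) ?_)
  · exact AddSubmonoid.subset_closure (s := Ω ∩ L) ⟨hΩ.coneAdd_subset hΓΩ hvΩ hx.1, hx.2⟩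
  · rintro x rfl
    exact AddSubmonoid.subset_closure (s := Ω ∩ L) ⟨hvΩ, hv⟩

theorem coneMon_le_dirMon : coneMon L Γ ≤ dirMon L Γ v :=
  AddSubmonoid.closure_mono fun _ hx => .inl ⟨subset_coneAdd Γ v hx.1, hx.2⟩

theorem coneMon_coneAdd_le_dirMon : coneMon L (coneAdd Γ v) ≤ dirMon L Γ v :=
  AddSubmonoid.closure_mono fun _ hx => .inl hx

theorem splitIn_of_one_add [IsDomain R] (hΩ : OpenCone L Ω) (h0 : (0 : V) ∉ Ω)
    (hΓ : OpenCone L Γ) (hΓΩ : Γ ⊆ Ω) (hv : v ∈ L) (hvΩ : v ∈ Ω)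
    (H : ∀ (n : ℕ) (e : Matrix (Fin n) (Fin n) (AddMonoidAlgebra R V)),
      MatIn (alg R (coneMon L Γ)) e → e * e = e → SplitIn (alg R (coneMon L Ω)) e)
    {m n : Type*} [Fintype m] [Fintype n] [DecidableEq n]
    {e : Matrix m m (AddMonoidAlgebra R V)}
    (heS : MatIn (alg R (dirMon L Γ v)) e) (he : e * e = e) {f : AddMonoidAlgebra R V}
    (hf : f - 1 ∈ supp R (Γ ∩ L))
    {U : Matrix m n (AddMonoidAlgebra R V)} {W : Matrix n m (AddMonoidAlgebra R V)}
    (hU : MatIn (alg R (dirMon L Γ v)) U) (hW : MatIn (alg R (dirMon L Γ v)) W)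
    (hUW : U * W = f • e) (hWU : W * U = f • 1) : SplitIn (alg R (coneMon L Ω)) e := by
  have hf0 : f ≠ 0 := by
    rintro rfl
    refine h0 (hΓΩ (hf 0 ?_).1)
    simp [AddMonoidAlgebra.one_def]
  have hsub : supp R (Γ ∩ L) ≤ supp R (coneMon L Γ : Set V) := fun x hx =>
    supp_mono (AddSubmonoid.subset_closure (s := Γ ∩ L)) hx
  have hfA : f ∈ alg R (coneMon L Γ) := by
    have := (alg R (coneMon L Γ)).add_mem (hsub hf) (Subring.one_mem _)
    rwa [sub_add_cancel] at this
  have hmem : ∀ t : (f - 1).coeff.support, (t : V) ∈ Γ ∩ L := fun t =>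
    hf t (Finsupp.mem_support_iff.1 t.2)
  refine splitIn_of_comaximal (A := alg R (coneMon L Γ)) (S := alg R (dirMon L Γ v))
    (τ := (f - 1).coeff.support) (alg_mono coneMon_le_dirMon)
    (alg_mono (dirMon_le_coneMon hΩ hΓΩ hv hvΩ)) H he heS hfA (fun t => single (t : V) 1)
    (fun t => hsub (single_mem_supp (hmem t) 1)) ?_ ?_ U W hU hW hUW hWU
    (mul_eq_of_smul he hf0 hUW hWU) (mul_eq_of_smul' he hf0 hUW hWU)
  · refine ⟨1, Subring.one_mem _, fun t => - single 0 ((f - 1).coeff t), fun t =>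
      (alg R (coneMon L Γ)).neg_mem (single_mem_alg (zero_mem _) _), ?_⟩
    simp only [neg_mul, AddMonoidAlgebra.single_mul_single, zero_add, mul_one, one_mul,
      Finset.sum_neg_distrib]
    have h := AddMonoidAlgebra.sum_coeff_single (f - 1)
    rw [Finsupp.sum, ← Finset.sum_coe_sort] at h
    rw [h]
    ring
  · intro b hb t
    obtain ⟨N, hN⟩ := exists_pow_single_mul_mem_alg (M := dirMon L Γ v) (M' := coneMon L Γ)
      (v := (t : V)) (AddSubmonoid.subset_closure (hmem t)) (fun x hx => by
        have hxL : x ∈ L := dirMon_le hv hx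
        obtain ⟨n, -, h⟩ := hΓ.exists_nsmul_add_mem (hmem t).1 hxL
        exact ⟨n, AddSubmonoid.subset_closure ⟨h, L.add_mem (L.nsmul_mem (hmem t).2 n) hxL⟩⟩) hb
    exact ⟨N, hN N le_rfl⟩

theorem exists_split_of_coneProj [IsDomain R] (hΓ : OpenCone L Γ) (hv : v ∈ L)
    {c : V →ₗ[ℚ] ℚ} (hcv : c v = 1) (hc : ∀ x ∈ L, ∃ z : ℤ, c x = z)
    (hD : SubIdemFree (MonicLoc R)
      (coneMon (L ⊓ c.toAddMonoidHom.ker) (coneProj (coneAdd Γ v) v c)))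
    {m : Type*} [Fintype m] {e : Matrix m m (AddMonoidAlgebra R V)}
    (heM : MatIn (alg R (dirMon L Γ v)) e) (he : e * e = e) :
    ∃ (k : ℕ) (s : R[X]) (U : Matrix m (Fin k) (AddMonoidAlgebra R V))
      (W : Matrix (Fin k) m (AddMonoidAlgebra R V)), s.Monic ∧ MatIn (alg R (dirMon L Γ v)) U ∧
      MatIn (alg R (dirMon L Γ v)) W ∧
      U * W = aeval (single v 1 : AddMonoidAlgebra R V) s • e ∧
      W * U = aeval (single v 1 : AddMonoidAlgebra R V) s • 1 ∧ e * U = U ∧ W * e = W := by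
  refine exists_split_of_direction hD (AddSubmonoid.subset_closure (.inr rfl)) c hcv
    (fun x hx => hc x (dirMon_le hv hx)) (fun x hx => ?_) (fun x hx => ?_) heM he
  · rcases (mem_dirMon hΓ hv).1 hx with ⟨j, rfl⟩ | hx
    · have h : j • v - c (j • v) • v = 0 := by
        rw [map_nsmul, hcv, nsmul_one, Nat.cast_smul_eq_nsmul, sub_self]
      rw [h]
      exact zero_mem _
    · have hc0 : c (x - c x • v) = 0 := by simp [hcv]
      refine AddSubmonoid.subset_closure ⟨⟨hc0, c x, by rw [sub_add_cancel]; exact hx.1⟩, ?_, hc0⟩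
      obtain ⟨z, hz⟩ := hc x hx.2
      rw [hz, Int.cast_smul_eq_zsmul]
      exact L.sub_mem hx.2 (L.zsmul_mem hv z)
  · rcases ((hΓ.coneAdd hv).coneProj hv hcv hc).mem_coneMon.1 hx with rfl | ⟨⟨-, q, hq⟩, hxL⟩
    · exact ⟨0, by simp⟩
    · obtain ⟨N, hN⟩ := exists_nat_ge q
      refine ⟨N, AddSubmonoid.subset_closure (.inl ⟨?_, L.add_mem (L.nsmul_mem hv N) hxL.1⟩)⟩
      have := hΓ.add_qsmul_mem_coneAdd hq (sub_nonneg.2 hN)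
      rwa [add_assoc, ← add_smul, add_sub_cancel, Nat.cast_smul_eq_nsmul, add_comm] at this

theorem splitIn_of_dirMon [IsDomain R] [IsPrincipalIdealRing R]
    (hΩ : OpenCone L Ω) (h0 : (0 : V) ∉ Ω)
    (hΓ : OpenCone L Γ) (hΓΩ : Γ ⊆ Ω) (hv : v ∈ L) (hvΩ : v ∈ Ω) (hvΓ : v ∉ Γ)
    {c : V →ₗ[ℚ] ℚ} (hcv : c v = 1) (hc : ∀ x ∈ L, ∃ z : ℤ, c x = z)
    (hD : SubIdemFree (MonicLoc R)
      (coneMon (L ⊓ c.toAddMonoidHom.ker) (coneProj (coneAdd Γ v) v c)))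
    (H : ∀ (n : ℕ) (e : Matrix (Fin n) (Fin n) (AddMonoidAlgebra R V)),
      MatIn (alg R (coneMon L Γ)) e → e * e = e → SplitIn (alg R (coneMon L Ω)) e)
    {m : Type*} [Fintype m] {e : Matrix m m (AddMonoidAlgebra R V)}
    (heS : MatIn (alg R (dirMon L Γ v)) e) (he : e * e = e) : SplitIn (alg R (coneMon L Ω)) e := by
  classical
  obtain ⟨k₀, s, U₀, W₀, hs, hU₀, hW₀, hUW₀, hWU₀, -, hWe₀⟩ :=
    exists_split_of_coneProj hΓ hv hcv hc hD heS he
  have hcone := hΓ.coneAdd hv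
  have hDΩ := hΩ.coneAdd_subset hΓΩ hvΩ
  have hnot : ∀ j : ℕ, j • v ∉ coneAdd Γ v := fun j hj => by
    rcases j.eq_zero_or_pos with rfl | hj'
    · exact h0 (hDΩ (by rwa [zero_nsmul] at hj))
    · exact hΩ.notMem_coneAdd h0 hΓ hΓΩ hvΩ hvΓ ((hcone.nsmul_mem_iff hj').1 hj)
  set N : Set V := SetLike.coe (AddSubmonoid.multiples v) with hN
  have hNM : AddSubmonoid.multiples v ≤ dirMon L Γ v :=
    AddSubmonoid.multiples_le.2 (AddSubmonoid.subset_closure (.inr rfl))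
  have hcase : ∀ x ∈ dirMon L Γ v, x ∈ N ∨ x ∈ coneAdd Γ v ∩ L := fun x hx => by
    rcases (mem_dirMon hΓ hv).1 hx with ⟨j, rfl⟩ | hx
    · exact .inl ⟨j, rfl⟩
    · exact .inr hx
  have hdisj : ∀ x ∈ coneAdd Γ v, x ∉ N := by
    rintro x hx ⟨j, rfl⟩
    exact hnot j hx
  have hadd : ∀ x ∈ dirMon L Γ v, ∀ y ∈ coneAdd Γ v, x + y ∉ N := fun x hx y hy h => by
    rcases hcase x hx with ⟨j, rfl⟩ | hx
    · have := hΓ.add_qsmul_mem_coneAdd hy (Nat.cast_nonneg j)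
      rw [Nat.cast_smul_eq_nsmul, add_comm] at this
      exact hdisj _ this h
    · exact hdisj _ (hcone.add_mem hx.1 hy) h
  have hmul : ∀ x ∈ (dirMon L Γ v : Set V), ∀ y ∈ (dirMon L Γ v : Set V),
      x + y ∈ N ↔ x ∈ N ∧ y ∈ N := by
    refine fun x hx y hy => ⟨fun h => ⟨?_, ?_⟩, fun h => add_mem h.1 h.2⟩
    · exact (hcase x hx).resolve_right fun hx' => hadd y hy x hx'.1 (by rwa [add_comm])
    · exact (hcase y hy).resolve_right fun hy' => hadd x hx y hy'.1 h
  set σ := aeval (single v 1 : AddMonoidAlgebra R V) s with hσ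
  have hσN : σ ∈ alg R (AddSubmonoid.multiples v) :=
    aeval_single_mem_alg (AddSubmonoid.mem_multiples v) s
  have hv0 : v ≠ 0 := by
    rintro rfl
    exact h0 hvΩ
  have hfree : SubIdemFree R (AddSubmonoid.multiples v) := by
    rw [multiples_eq_laurentMon]
    exact subIdemFree_laurentMon (LinearIndependent.of_subsingleton () hv0) ∅ Finset.univ R
  have hT : ∀ {x}, x ∈ alg R (AddSubmonoid.multiples v) → x ∈ alg R (dirMon L Γ v) :=
    fun hx => alg_mono hNM hx
  have heπ : MatIn (alg R (AddSubmonoid.multiples v)) (e.map (filt N)) := matIn_map_filt heS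
  have hUπ : MatIn (alg R (AddSubmonoid.multiples v)) (U₀.map (filt N)) := matIn_map_filt hU₀
  have hWπ : MatIn (alg R (AddSubmonoid.multiples v)) (W₀.map (filt N)) := matIn_map_filt hW₀
  obtain ⟨k, U₁, W₁, hU₁, hW₁, hUW₁, hWU₁⟩ := hfree.splitIn (e.map (filt N)) heπ
    (by rw [← map_filt_mul hmul heS heS, he])
  have hσe : (σ • e).map (filt N) = σ • e.map (filt N) := by
    ext1 i j
    change filt N (σ * e i j) = _
    rw [filt_mul hmul (hT hσN) (heS i j), filt_eq_self hσN]
    rfl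
  have hσ1 : MatIn (alg R (AddSubmonoid.multiples v))
      (σ • (1 : Matrix (Fin k₀) (Fin k₀) (AddMonoidAlgebra R V))) := MatIn.smul hσN MatIn.one
  have hσ1' : MatIn (alg R (AddSubmonoid.multiples v))
      (σ • (1 : Matrix (Fin k) (Fin k) (AddMonoidAlgebra R V))) := MatIn.smul hσN MatIn.one
  have hqp : U₀.map (filt N) * W₀.map (filt N) = σ • e.map (filt N) := by
    rw [← map_filt_mul hmul hU₀ hW₀, hUW₀, hσe]
  have hpq : W₀.map (filt N) * U₀.map (filt N) = σ • 1 := by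
    rw [← map_filt_mul hmul hW₀ hU₀, hWU₀, map_filt_eq_self hσ1]
  have hpe : W₀.map (filt N) * e.map (filt N) = W₀.map (filt N) := by
    rw [← map_filt_mul hmul hW₀ heS, hWe₀]
  have hGH : W₀.map (filt N) * U₁ * (W₁ * U₀.map (filt N)) = σ • 1 := by
    rw [Matrix.mul_assoc, ← Matrix.mul_assoc U₁, hUW₁, ← Matrix.mul_assoc, hpe, hpq]
  have hHG : W₁ * U₀.map (filt N) * (W₀.map (filt N) * U₁) = σ • 1 := by
    rw [Matrix.mul_assoc, ← Matrix.mul_assoc (U₀.map _), hqp, Matrix.smul_mul, ← hUW₁,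
      Matrix.mul_smul, Matrix.mul_assoc, hWU₁, Matrix.mul_one, hWU₁]
  set G := W₀.map (filt N) * U₁ with hG
  set H' := W₁ * U₀.map (filt N) with hH'
  have hGN : MatIn (alg R (AddSubmonoid.multiples v)) G := hWπ.mul hU₁
  have hHN : MatIn (alg R (AddSubmonoid.multiples v)) H' := hW₁.mul hUπ
  have hS : ∀ x ∈ (dirMon L Γ v : Set V) \ N, x ∈ coneAdd Γ v ∩ L :=
    fun x hx => (hcase x hx.1).resolve_left hx.2
  have hU₁' := hU₁.mono (T := alg R (dirMon L Γ v)) fun x hx => hT hx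
  have hW₁' := hW₁.mono (T := alg R (dirMon L Γ v)) fun x hx => hT hx
  have hU₂ : MatIn (alg R (dirMon L Γ v)) (U₀ * G) := hU₀.mul (hGN.mono fun x hx => hT hx)
  have hW₂ : MatIn (alg R (dirMon L Γ v)) (H' * W₀) := MatIn.mul (hHN.mono fun x hx => hT hx) hW₀
  obtain ⟨f, hf, U, W, hU, hW, hUW, hWU⟩ := exists_split_one_add hΓ
    (fun h => h0 (hΓΩ h)) hv c hcv hc hs heS hU₁' hW₁' hU₂ hW₂ (by
      rw [Matrix.mul_assoc, ← Matrix.mul_assoc G, hGH, Matrix.smul_mul, Matrix.one_mul,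
        Matrix.mul_smul, hUW₀, smul_smul, pow_two]) (by
      rw [Matrix.mul_assoc, ← Matrix.mul_assoc W₀, hWU₀, Matrix.smul_mul, Matrix.one_mul,
        Matrix.mul_smul, hHG, smul_smul, pow_two])
    (MatIn.mono (S := supp R ((dirMon L Γ v : Set V) \ N))
      (matIn_supp_sdiff heS (hU₁'.mul hW₁') (by
        rw [map_filt_mul hmul hU₁' hW₁', map_filt_eq_self hU₁, map_filt_eq_self hW₁, hUW₁]))
      fun x hx => supp_mono hS hx)
    (MatIn.mono (S := supp R ((dirMon L Γ v : Set V) \ N))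
      (matIn_supp_sdiff (hW₂.mul hU₁') (MatIn.smul (hT hσN) MatIn.one) (by
        rw [map_filt_mul hmul hW₂ hU₁', map_filt_mul hmul (hHN.mono fun x hx => hT hx) hW₀,
          map_filt_eq_self hHN, map_filt_eq_self hU₁, map_filt_eq_self hσ1', Matrix.mul_assoc,
          hHG]))
      fun x hx => supp_mono hS hx)
  exact splitIn_of_one_add hΩ h0 hΓ hΓΩ hv hvΩ H heS he hf hU hW hUW hWU

end ConeAdd

end

section

open Matrix

/-! ### Lattice bases inside cones -/

section LatticeBasis

variable {V : Type*} [AddCommGroup V] [Module ℚ V] {L : AddSubgroup V}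

theorem exists_primitive (hL : L.FG) {y : V} (hy : y ∈ L) (hy0 : y ≠ 0) :
    ∃ t ∈ L, ∃ k : ℕ, 0 < k ∧ y = k • t ∧
      ∃ c : V →ₗ[ℚ] ℚ, c t = 1 ∧ ∀ x ∈ L, ∃ z : ℤ, c x = z := by
  obtain ⟨r, w, hw, rfl⟩ := exists_linearIndependent_closure_eq hL
  obtain ⟨a, rfl⟩ := AddSubgroup.exists_of_mem_closure_range _ _ hy
  obtain ⟨k, hk⟩ := (IsPrincipalIdealRing.principal (Ideal.span (Set.range a))).principal
  have hka : ∀ i, ∃ b, a i = k * b := fun i => by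
    have : a i ∈ Ideal.span (Set.range a) := Ideal.subset_span ⟨i, rfl⟩
    rw [hk] at this
    exact Ideal.mem_span_singleton.1 this
  choose b hb using hka
  have hkm : k ∈ Ideal.span (Set.range a) := hk ▸ Ideal.mem_span_singleton_self k
  obtain ⟨u, hu⟩ := Ideal.mem_span_range_iff_exists_fun.1 hkm
  have hk0 : k ≠ 0 := by
    rintro rfl
    exact hy0 (by simp [hb])
  have hub : ∑ i, u i * b i = 1 := by
    refine mul_left_cancel₀ hk0 ?_
    rw [mul_one, Finset.mul_sum]
    conv_rhs => rw [← hu]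
    exact Finset.sum_congr rfl fun i _ => by rw [hb]; ring
  obtain ⟨c, hc⟩ := exists_dual_of_linearIndependent hw fun i => (u i : ℚ)
  have ht : ∑ i, b i • w i ∈ AddSubgroup.closure (Set.range w) :=
    AddSubgroup.sum_mem _ fun i _ => AddSubgroup.zsmul_mem _
      (AddSubgroup.subset_closure (k := Set.range w) ⟨i, rfl⟩) _
  have hsum : ∀ z : Fin r → ℤ, c (∑ i, z i • w i) = ((∑ i, u i * z i : ℤ) : ℚ) := fun z => by
    rw [map_sum]
    push_cast
    exact Finset.sum_congr rfl fun i _ => by rw [map_zsmul, hc, zsmul_eq_mul, mul_comm]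
  have hct : c (∑ i, b i • w i) = 1 := by rw [hsum, hub, Int.cast_one]
  have hyt : ∑ i, a i • w i = k • ∑ i, b i • w i := by
    rw [Finset.smul_sum]
    exact Finset.sum_congr rfl fun i _ => by rw [hb, mul_smul]
  have hcL : ∀ x ∈ AddSubgroup.closure (Set.range w), ∃ z : ℤ, c x = z := fun x hx => by
    obtain ⟨z, rfl⟩ := AddSubgroup.exists_of_mem_closure_range _ _ hx
    exact ⟨_, hsum z⟩
  rcases lt_or_gt_of_ne hk0 with h | h
  · refine ⟨_, AddSubgroup.neg_mem _ ht, (-k).toNat, by omega, ?_, -c, by simpa using hct,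
      fun x hx => ?_⟩
    · rw [hyt, ← natCast_zsmul, Int.toNat_of_nonneg (by omega), neg_smul_neg]
    · obtain ⟨z, hz⟩ := hcL x hx
      exact ⟨-z, by simp [hz]⟩
  · refine ⟨_, ht, k.toNat, by omega, ?_, c, hct, hcL⟩
    rw [hyt, ← natCast_zsmul, Int.toNat_of_nonneg h.le]

theorem exists_basis_mem_cone (hL : L.FG) {Ω : Set V} (hΩ : OpenCone L Ω) (h0 : (0 : V) ∉ Ω)
    (hne : Ω.Nonempty) : ∃ (r : ℕ) (w : Fin (r + 1) → V), LinearIndependent ℚ w ∧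
      AddSubgroup.closure (Set.range w) = L ∧ ∀ i, w i ∈ Ω := by
  obtain ⟨x, hx⟩ := hne
  obtain ⟨n, hn, hnx⟩ := hΩ.exists_nsmul_mem hx
  have hnΩ := hΩ.nsmul_mem hn hx
  obtain ⟨t, ht, k, hk, hkt, c, hct, hc⟩ := exists_primitive hL hnx (fun h => h0 (h ▸ hnΩ))
  have htΩ : t ∈ Ω := (hΩ.nsmul_mem_iff hk).1 (hkt ▸ hnΩ)
  obtain ⟨r, b, hb, hbL⟩ := exists_linearIndependent_closure_eq
    (AddSubgroup.FG.of_le hL (inf_le_left (b := c.toAddMonoidHom.ker)))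
  have hbmem : ∀ i, b i ∈ L ⊓ c.toAddMonoidHom.ker := fun i =>
    hbL ▸ AddSubgroup.subset_closure ⟨i, rfl⟩
  have hcb : ∀ i, c (b i) = 0 := fun i => (hbmem i).2
  choose N hN hNΩ using fun i => hΩ.exists_nsmul_add_mem htΩ (hbmem i).1
  refine ⟨r, Fin.cons t fun i => N i • t + b i, ?_, ?_, ?_⟩
  · rw [Fintype.linearIndependent_iff]
    intro g hg
    rw [Fin.sum_univ_succ] at hg
    simp only [Fin.cons_zero, Fin.cons_succ] at hg
    have h := congrArg (LinearMap.id - c.smulRight t : V →ₗ[ℚ] V) hg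
    simp only [map_add, map_sum, map_smul, map_nsmul, LinearMap.sub_apply, LinearMap.id_apply,
      LinearMap.smulRight_apply, hct, hcb, one_smul, zero_smul, sub_self, sub_zero, smul_zero,
      zero_add, map_zero] at h
    have hg1 := Fintype.linearIndependent_iff.1 hb _ h
    simp only [hg1, zero_smul, Finset.sum_const_zero, add_zero] at hg
    have hg0 : g 0 = 0 := by simpa [hct] using congrArg c hg
    exact Fin.cases hg0 hg1
  · refine le_antisymm ((AddSubgroup.closure_le _).2 ?_) fun x hx => ?_
    · rintro _ ⟨i, rfl⟩
      refine Fin.cases ht (fun i => ?_) i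
      exact L.add_mem (L.nsmul_mem ht _) (hbmem i).1
    · set L' := AddSubgroup.closure (Set.range (Fin.cons t fun i => N i • t + b i : Fin (r + 1) → V))
      have ht' : t ∈ L' := AddSubgroup.subset_closure ⟨0, rfl⟩
      have hle : L ⊓ c.toAddMonoidHom.ker ≤ L' := by
        rw [← hbL, AddSubgroup.closure_le]
        rintro _ ⟨i, rfl⟩
        have h : N i • t + b i ∈ L' := AddSubgroup.subset_closure ⟨i.succ, rfl⟩
        simpa using L'.sub_mem h (L'.nsmul_mem ht' (N i))
      obtain ⟨z, hz⟩ := hc x hx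
      have h : x - z • t ∈ L ⊓ c.toAddMonoidHom.ker :=
        ⟨L.sub_mem hx (L.zsmul_mem ht z), by
          change c (x - z • t) = 0
          simp [hz, hct]⟩
      simpa using L'.add_mem (hle h) (L'.zsmul_mem ht' z)
  · exact Fin.cases htΩ hNΩ

theorem exists_simplicial_cone (hL : L.FG) {Ω : Set V} (hΩ : OpenCone L Ω) (h0 : (0 : V) ∉ Ω)
    (hne : Ω.Nonempty) (R : Type*) [CommRing R] [IsDomain R] [IsPrincipalIdealRing R] :
    ∃ Γ, OpenCone L Γ ∧ Γ ⊆ Ω ∧ Γ.Nonempty ∧ ∃ τ, SubIdemFree R τ ∧ coneMon L Γ ≤ τ ∧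
      τ ≤ coneMon L Ω := by
  obtain ⟨r, w, hw, hwL, hwΩ⟩ := exists_basis_mem_cone hL hΩ h0 hne
  have hwmem : ∀ i, w i ∈ L := fun i => hwL ▸ AddSubgroup.subset_closure ⟨i, rfl⟩
  choose c hc using fun i => exists_dual_of_linearIndependent hw (Pi.single i (1 : ℚ))
  have hcz : ∀ i (z : Fin (r + 1) → ℤ), c i (∑ j, z j • w j) = z i := fun i z => by
    simp [map_sum, hc, Pi.single_apply]
  have hτ : ∀ x ∈ L, (∀ i, 0 < c i x) → x ∈ laurentMon w Finset.univ ∅ := fun x hx hpos => by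
    rw [← hwL] at hx
    obtain ⟨z, rfl⟩ := AddSubgroup.exists_of_mem_closure_range _ _ hx
    refine AddSubmonoid.sum_mem _ fun i _ => ?_
    have hz := hpos i
    rw [hcz, Int.cast_pos] at hz
    rw [← Int.toNat_of_nonneg hz.le, natCast_zsmul]
    exact AddSubmonoid.nsmul_mem _ (AddSubmonoid.subset_closure (.inl ⟨i, Finset.mem_univ i, rfl⟩)) _
  have hτΩ : laurentMon w Finset.univ ∅ ≤ coneMon L Ω := by
    refine AddSubmonoid.closure_le.2 ?_
    rintro x (⟨i, _, rfl⟩ | ⟨i, hi, -⟩)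
    · exact AddSubmonoid.subset_closure (s := Ω ∩ L) ⟨hwΩ i, hwmem i⟩
    · simp at hi
  have hcn : ∀ (n : ℕ) x, 0 < n → ((∀ i, 0 < c i (n • x)) ↔ ∀ i, 0 < c i x) := fun n x hn =>
    forall_congr' fun i => by
      rw [map_nsmul, nsmul_eq_mul]
      exact mul_pos_iff_of_pos_left (by exact_mod_cast hn)
  refine ⟨{x | (∃ n : ℕ, 0 < n ∧ n • x ∈ L) ∧ ∀ i, 0 < c i x}, ⟨?_, ?_, fun hx => hx.1, ?_⟩,
    ?_, ⟨∑ i, w i, ⟨1, one_pos, ?_⟩, fun i => ?_⟩, _, subIdemFree_laurentMon hw ∅ Finset.univ R,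
    ?_, hτΩ⟩
  · rintro x y ⟨⟨m, hm, hmx⟩, hx⟩ ⟨⟨n, hn, hny⟩, hy⟩
    refine ⟨⟨m * n, Nat.mul_pos hm hn, ?_⟩, fun i => ?_⟩
    · rw [smul_add]
      nth_rw 1 [mul_comm]
      rw [mul_smul, mul_smul]
      exact L.add_mem (L.nsmul_mem hmx n) (L.nsmul_mem hny m)
    · rw [map_add]
      exact add_pos (hx i) (hy i)
  · intro n x hn
    refine and_congr ⟨?_, ?_⟩ (hcn n x hn)
    · rintro ⟨m, hm, h⟩
      exact ⟨m * n, Nat.mul_pos hm hn, by rwa [mul_smul]⟩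
    · rintro ⟨m, hm, h⟩
      exact ⟨m, hm, by rw [smul_comm]; exact L.nsmul_mem h n⟩
  · rintro x y ⟨⟨m, hm, hmx⟩, hx⟩ hy
    obtain ⟨N, hN⟩ := exists_common_nat (fun N i => 0 < c i (N • x + y)) (fun i => by
      obtain ⟨N, hN⟩ := exists_nat_gt (-c i y / c i x)
      refine ⟨N, fun n hn => ?_⟩
      have hn' : (N : ℚ) ≤ n := by exact_mod_cast hn
      have := (div_lt_iff₀ (hx i)).1 (hN.trans_le hn')
      rw [map_add, map_nsmul, nsmul_eq_mul]
      linarith)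
    refine ⟨N + 1, N.succ_pos, ⟨m, hm, ?_⟩, hN (N + 1) N.le_succ⟩
    rw [smul_add, smul_comm]
    exact L.add_mem (L.nsmul_mem hmx _) (L.nsmul_mem hy m)
  · rintro x ⟨⟨n, hn, hnx⟩, hx⟩
    have h := hτΩ (hτ _ hnx ((hcn n x hn).2 hx))
    rcases hΩ.mem_coneMon.1 h with h | h
    · have := (hcn n x hn).2 hx 0
      simp [h] at this
    · exact (hΩ.nsmul_mem_iff hn).1 h.1
  · rw [one_smul]
    exact L.sum_mem fun i _ => hwmem i
  · have := hcz i 1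
    simp only [Pi.one_apply, one_smul, Int.cast_one] at this
    simp [this]
  · exact AddSubmonoid.closure_le.2 fun x hx => hτ x hx.2 hx.1.2

end LatticeBasis

end

section

open Matrix

/-! ### Idempotents over the lattice points of an open cone -/

section ConeMain

variable {V : Type*} [AddCommGroup V] [Module ℚ V] {L : AddSubgroup V} {Ω : Set V}

theorem OpenCone.sUnion {C : Set (Set V)} (hC : IsChain (· ⊆ ·) C)
    (h : ∀ D ∈ C, OpenCone L D) : OpenCone L (⋃₀ C) where
  add_mem := by
    rintro x y ⟨D, hD, hx⟩ ⟨D', hD', hy⟩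
    rcases hC.total hD hD' with hle | hle
    · exact ⟨D', hD', (h D' hD').add_mem (hle hx) hy⟩
    · exact ⟨D, hD, (h D hD).add_mem hx (hle hy)⟩
  nsmul_mem_iff hn := exists_congr fun D => and_congr_right fun hD => (h D hD).nsmul_mem_iff hn
  exists_nsmul_mem := by
    rintro x ⟨D, hD, hx⟩
    exact (h D hD).exists_nsmul_mem hx
  exists_nsmul_add_mem := by
    rintro x y ⟨D, hD, hx⟩ hy
    obtain ⟨n, hn, h'⟩ := (h D hD).exists_nsmul_add_mem hx hy
    exact ⟨n, hn, D, hD, h'⟩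

theorem exists_matIn_coneMon_of_sUnion {R : Type*} [CommRing R] {C : Set (Set V)}
    (hC : IsChain (· ⊆ ·) C) (hne : C.Nonempty) (h : ∀ D ∈ C, OpenCone L D) {m n : Type*}
    [Finite m] [Finite n] {X : Matrix m n (AddMonoidAlgebra R V)}
    (hX : MatIn (alg R (coneMon L (⋃₀ C))) X) : ∃ D ∈ C, MatIn (alg R (coneMon L D)) X := by
  let S : Set V := ⋃ i, ⋃ j, ((X i j).coeff.support : Set V)
  have hS : S.Finite := Set.finite_iUnion fun i => Set.finite_iUnion fun j => Finset.finite_toSet _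
  have hmem : ∀ x ∈ S, x = 0 ∨ x ∈ ⋃₀ C ∧ x ∈ L := fun x hx => by
    obtain ⟨i, hx⟩ := Set.mem_iUnion.1 hx
    obtain ⟨j, hx⟩ := Set.mem_iUnion.1 hx
    exact (OpenCone.sUnion hC h).mem_coneMon.1 (hX i j x (Finsupp.mem_support_iff.1 hx))
  obtain ⟨D, hD, hSD⟩ := hC.directedOn.exists_mem_subset_of_finite_of_subset_sUnion hne
    (hS.subset (Set.sdiff_subset (t := {0}))) (fun x hx => ((hmem x hx.1).resolve_left hx.2).1)
  refine ⟨D, hD, fun i j x hx => (h D hD).mem_coneMon.2 ?_⟩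
  have hxS : x ∈ S := Set.mem_iUnion.2 ⟨i, Set.mem_iUnion.2 ⟨j, Finsupp.mem_support_iff.2 hx⟩⟩
  by_cases hx0 : x = 0
  · exact .inl hx0
  · exact .inr ⟨hSD ⟨hxS, hx0⟩, ((hmem x hxS).resolve_left hx0).2⟩

theorem exists_direction {Γ : Set V} (hL : L.FG) (hΩ : OpenCone L Ω) (h0 : (0 : V) ∉ Ω)
    (hΓ : OpenCone L Γ) (hΓΩ : Γ ⊆ Ω) (hne : Γ.Nonempty) (h : Γ ≠ Ω) :
    ∃ v ∈ L, v ∈ Ω ∧ v ∉ Γ ∧ (∃ x ∈ coneAdd Γ v, x ∉ Γ) ∧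
      ∃ c : V →ₗ[ℚ] ℚ, c v = 1 ∧ ∀ x ∈ L, ∃ z : ℤ, c x = z := by
  obtain ⟨x, hxΩ, hxΓ⟩ := Set.exists_of_ssubset (hΓΩ.ssubset_of_ne h)
  obtain ⟨g, hg⟩ := hne
  obtain ⟨p, hp, hpx⟩ := hΩ.exists_nsmul_mem hxΩ
  obtain ⟨q, hq, hqg⟩ := hΓ.exists_nsmul_mem hg
  have hqΓ := hΓ.nsmul_mem hq hg
  obtain ⟨N, hN, hNΩ⟩ := hΩ.exists_nsmul_add_mem (hΩ.nsmul_mem hp hxΩ) (L.neg_mem hqg)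
  have hNL := L.add_mem (L.nsmul_mem hpx N) (L.neg_mem hqg)
  obtain ⟨v, hv, k, hk, hkv, c, hcv, hc⟩ := exists_primitive hL hNL (fun h => h0 (h ▸ hNΩ))
  have hx : (N * p) • x = q • g + k • v := by
    rw [← hkv, mul_smul]
    abel
  refine ⟨v, hv, (hΩ.nsmul_mem_iff hk).1 (hkv ▸ hNΩ), fun hvΓ => hxΓ ?_, ⟨x, ⟨N * p,
    Nat.mul_pos hN hp, k, ?_⟩, hxΓ⟩, c, hcv, hc⟩
  · rw [← hΓ.nsmul_mem_iff (Nat.mul_pos hN hp), hx]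
    exact hΓ.add_mem hqΓ (hΓ.nsmul_mem hk hvΓ)
  · rwa [hx, add_sub_cancel_right]

theorem subIdemFree_coneMon_of_finrank (d : ℕ) : ∀ {L : AddSubgroup V}, L.FG →
    Module.finrank ℚ (Submodule.span ℚ (L : Set V)) < d → ∀ {Ω : Set V}, OpenCone L Ω →
    (0 : V) ∉ Ω → ∀ (R : Type*) [CommRing R] [IsDomain R] [IsPrincipalIdealRing R],
    SubIdemFree R (coneMon L Ω) := by
  induction d with
  | zero => exact fun _ h => absurd h (Nat.not_lt_zero _)
  | succ d ih =>
    intro L hL hd Ω hΩ h0 R _ _ _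
    rcases Ω.eq_empty_or_nonempty with rfl | hne
    · have h : coneMon L ∅ = ⊥ := by simp [coneMon]
      rw [h]
      exact subIdemFree_bot
    obtain ⟨Γ₀, hΓ₀, hΓ₀Ω, hΓ₀ne, τ, hτ, hΓ₀τ, hτΩ⟩ := exists_simplicial_cone hL hΩ h0 hne R
    let P : Set (Set V) := {D | OpenCone L D ∧ D ⊆ Ω ∧
      ∀ (n : ℕ) (e : Matrix (Fin n) (Fin n) (AddMonoidAlgebra R V)),
        MatIn (alg R (coneMon L D)) e → e * e = e → SplitIn (alg R (coneMon L Ω)) e}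
    obtain ⟨Γ, hΓ₀Γ, hmax⟩ := zorn_subset_nonempty P
      (fun C hCP hC hCne => ⟨⋃₀ C, ⟨OpenCone.sUnion hC fun D hD => (hCP hD).1,
        Set.sUnion_subset fun D hD => (hCP hD).2.1, fun n e he hee => by
          obtain ⟨D, hD, heD⟩ := exists_matIn_coneMon_of_sUnion hC hCne
            (fun D hD => (hCP hD).1) he
          exact (hCP hD).2.2 n e heD hee⟩, fun D hD => Set.subset_sUnion_of_mem hD⟩) Γ₀
      ⟨hΓ₀, hΓ₀Ω, fun n e he hee =>
        (hτ n e (he.mono fun x hx => alg_mono hΓ₀τ hx) hee).mono fun x hx => alg_mono hτΩ hx⟩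
    obtain ⟨hΓ, hΓΩ, hΓsplit⟩ := hmax.prop
    by_cases h : Γ = Ω
    · rw [← h] at hΓsplit ⊢
      exact hΓsplit
    exfalso
    obtain ⟨v, hv, hvΩ, hvΓ, ⟨x, hx, hxΓ⟩, c, hcv, hc⟩ :=
      exists_direction hL hΩ h0 hΓ hΓΩ (hΓ₀ne.mono hΓ₀Γ) h
    have hcone := hΓ.coneAdd hv
    have hconeΩ := hΩ.coneAdd_subset hΓΩ hvΩ
    have hD := ih (AddSubgroup.FG.of_le hL (inf_le_left (b := c.toAddMonoidHom.ker)))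
      ((finrank_span_inf_ker_lt hL hv (by simp [hcv])).trans_le (Nat.lt_succ_iff.1 hd))
      (hcone.coneProj hv hcv hc)
      (hcone.zero_notMem_coneProj hΩ h0 hconeΩ hvΩ (hΩ.notMem_coneAdd h0 hΓ hΓΩ hvΩ hvΓ) c)
      (MonicLoc R)
    exact hxΓ (hmax.le_of_ge (y := coneAdd Γ v) ⟨hcone, hconeΩ, fun n e he hee =>
      splitIn_of_dirMon hΩ h0 hΓ hΓΩ hv hvΩ hvΓ hcv hc hD hΓsplit
        (he.mono fun x hx => alg_mono coneMon_coneAdd_le_dirMon hx) hee⟩ (subset_coneAdd Γ v) hx)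

theorem subIdemFree_coneMon (hL : L.FG) (hΩ : OpenCone L Ω) (h0 : (0 : V) ∉ Ω) (R : Type*)
    [CommRing R] [IsDomain R] [IsPrincipalIdealRing R] : SubIdemFree R (coneMon L Ω) :=
  subIdemFree_coneMon_of_finrank _ hL (Nat.lt_succ_self _) hΩ h0 R

end ConeMain

end

section

open Matrix

/-! ### Archimedean classes of a seminormal monoid -/

section Classes

variable {V : Type*} [AddCommGroup V] {M : AddSubmonoid V} {G : Finset V} {L : AddSubgroup V}

open Classical in
/-- The elements of `G` dividing some multiple of `x` in `M`. -/
noncomputable def divisorClass (M : AddSubmonoid V) (G : Finset V) (x : V) : Finset V :=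
  G.filter fun g => ∃ n : ℕ, 0 < n ∧ n • x - g ∈ M

theorem mem_divisorClass {x g : V} :
    g ∈ divisorClass M G x ↔ g ∈ G ∧ ∃ n : ℕ, 0 < n ∧ n • x - g ∈ M := by
  classical
  rw [divisorClass, Finset.mem_filter]

theorem exists_nsmul_sub_mem_of_mem_closure {x : V} (hx : x ∈ M) {z : V}
    (hz : z ∈ AddSubmonoid.closure (divisorClass M G x : Set V)) :
    ∃ n : ℕ, 0 < n ∧ n • x - z ∈ M := by
  refine AddSubmonoid.closure_induction (motive := fun z _ => ∃ n : ℕ, 0 < n ∧ n • x - z ∈ M)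
    (fun z hz => (mem_divisorClass.1 hz).2) ⟨1, one_pos, by simpa using hx⟩ ?_ hz
  rintro y z - - ⟨n, hn, h1⟩ ⟨m, hm, h2⟩
  refine ⟨n + m, by lia, ?_⟩
  rw [show (n + m) • x - (y + z) = (n • x - y) + (m • x - z) by rw [add_nsmul]; abel]
  exact M.add_mem h1 h2

theorem mem_closure_divisorClass (hG : ∀ g ∈ G, g ∈ M) {x : V} {m : ℕ} (hm : 0 < m)
    {z : V} (hz : z ∈ AddSubmonoid.closure (G : Set V)) (h : m • x - z ∈ M) :
    z ∈ AddSubmonoid.closure (divisorClass M G x : Set V) := by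
  induction hz using AddSubmonoid.closure_induction with
  | mem z hz => exact AddSubmonoid.subset_closure (mem_divisorClass.2 ⟨hz, m, hm, h⟩)
  | zero => exact zero_mem _
  | add y z hy hz ihy ihz =>
    have hle := AddSubmonoid.closure_le.2 (fun g hg => hG g hg : (G : Set V) ⊆ M)
    refine add_mem (ihy ?_) (ihz ?_)
    · rw [show m • x - y = (m • x - (y + z)) + z by abel]
      exact M.add_mem h (hle hz)
    · rw [show m • x - z = (m • x - (y + z)) + y by abel]
      exact M.add_mem h (hle hy)

theorem divisorClass_subset_iff (hG : ∀ g ∈ G, g ∈ M)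
    (harch : ∀ x ∈ M, ∃ n : ℕ, 0 < n ∧ n • x ∈ AddSubmonoid.closure (G : Set V)) {x y : V}
    (hx : x ∈ M) (hy : y ∈ M) :
    divisorClass M G x ⊆ divisorClass M G y ↔ ∃ n : ℕ, 0 < n ∧ n • y - x ∈ M := by
  constructor
  · intro h
    obtain ⟨k, hk, hkx⟩ := harch x hx
    have h1 := mem_closure_divisorClass hG hk hkx (by rw [sub_self]; exact M.zero_mem)
    obtain ⟨n, hn, h2⟩ := exists_nsmul_sub_mem_of_mem_closure hy
      (AddSubmonoid.closure_mono (Finset.coe_subset.2 h) h1)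
    refine ⟨n, hn, ?_⟩
    obtain ⟨l, rfl⟩ : ∃ l, k = l + 1 := ⟨k - 1, by lia⟩
    rw [show n • y - x = (n • y - (l + 1) • x) + l • x by rw [add_nsmul, one_nsmul]; abel]
    exact M.add_mem h2 (M.nsmul_mem hx l)
  · rintro ⟨n, hn, h⟩ g hg
    obtain ⟨hgG, m, hm, h1⟩ := mem_divisorClass.1 hg
    refine mem_divisorClass.2 ⟨hgG, m * n, Nat.mul_pos hm hn, ?_⟩
    rw [show (m * n) • y - g = m • (n • y - x) + (m • x - g) by rw [mul_nsmul', nsmul_sub]; abel]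
    exact M.add_mem (M.nsmul_mem h m) h1

/-- The elements of `M` of a given class. -/
def classSet (M : AddSubmonoid V) (G c : Finset V) : Set V := {x | x ∈ M ∧ divisorClass M G x = c}

/-- A monoid `M` in a group `L`, seminormal in `L` and finitely generated up to multiples. -/
structure IsTameMonoid (M : AddSubmonoid V) (G : Finset V) (L : AddSubgroup V) : Prop where
  gen_mem : ∀ g ∈ G, g ∈ M
  le : ∀ x ∈ M, x ∈ L
  arch : ∀ x ∈ M, ∃ n : ℕ, 0 < n ∧ n • x ∈ AddSubmonoid.closure (G : Set V)
  seminormal : ∀ x ∈ L, 2 • x ∈ M → 3 • x ∈ M → x ∈ M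

namespace IsTameMonoid

variable {c : Finset V} {x y : V}

theorem class_subset_iff (h : IsTameMonoid M G L) (hx : x ∈ M) (hy : y ∈ M) :
    divisorClass M G x ⊆ divisorClass M G y ↔ ∃ n : ℕ, 0 < n ∧ n • y - x ∈ M :=
  divisorClass_subset_iff h.gen_mem h.arch hx hy

theorem class_subset_add (h : IsTameMonoid M G L) (hx : x ∈ M) (hy : y ∈ M) :
    divisorClass M G x ⊆ divisorClass M G (x + y) :=
  (h.class_subset_iff hx (M.add_mem hx hy)).2 ⟨1, one_pos, by simpa using hy⟩

theorem class_zero_subset (h : IsTameMonoid M G L) (hx : x ∈ M) :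
    divisorClass M G 0 ⊆ divisorClass M G x :=
  (h.class_subset_iff M.zero_mem hx).2 ⟨1, one_pos, by simpa using hx⟩

theorem add_mem_classSet (h : IsTameMonoid M G L) (hx : x ∈ M)
    (hxc : divisorClass M G x ⊆ c) (hy : y ∈ classSet M G c) : x + y ∈ classSet M G c := by
  obtain ⟨hy, rfl⟩ := hy
  refine ⟨M.add_mem hx hy, subset_antisymm ?_ ?_⟩
  · obtain ⟨n, hn, h1⟩ := (h.class_subset_iff hx hy).1 hxc
    refine (h.class_subset_iff (M.add_mem hx hy) hy).2 ⟨n + 1, by lia, ?_⟩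
    rwa [show (n + 1) • y - (x + y) = n • y - x by rw [add_nsmul, one_nsmul]; abel]
  · rw [add_comm]
    exact h.class_subset_add hy hx

theorem class_nsmul (h : IsTameMonoid M G L) (hx : x ∈ M) {n : ℕ} (hn : 0 < n) :
    divisorClass M G (n • x) = divisorClass M G x := by
  refine subset_antisymm ?_ ?_
  · exact (h.class_subset_iff (M.nsmul_mem hx n) hx).2 ⟨n, hn, by rw [sub_self]; exact M.zero_mem⟩
  · obtain ⟨l, rfl⟩ : ∃ l, n = l + 1 := ⟨n - 1, by lia⟩
    refine (h.class_subset_iff hx (M.nsmul_mem hx _)).2 ⟨1, one_pos, ?_⟩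
    rw [show 1 • (l + 1) • x - x = l • x by rw [one_nsmul, add_nsmul, one_nsmul]; abel]
    exact M.nsmul_mem hx l

theorem nsmul_mem_classSet (h : IsTameMonoid M G L) (hx : x ∈ classSet M G c) {n : ℕ}
    (hn : 0 < n) : n • x ∈ classSet M G c :=
  ⟨M.nsmul_mem hx.1 n, (h.class_nsmul hx.1 hn).trans hx.2⟩

theorem add_mem_classSet' (h : IsTameMonoid M G L) (hx : x ∈ classSet M G c)
    (hy : y ∈ classSet M G c) : x + y ∈ classSet M G c :=
  h.add_mem_classSet hx.1 hx.2.le hy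

theorem exists_nsmul_sub_mem_classSet (h : IsTameMonoid M G L) (hx : x ∈ classSet M G c)
    (hy : y ∈ classSet M G c) : ∃ n : ℕ, 0 < n ∧ n • x - y ∈ classSet M G c := by
  obtain ⟨n, hn, h1⟩ := (h.class_subset_iff hy.1 hx.1).1 (hy.2.trans hx.2.symm).le
  have h2 : divisorClass M G (n • x - y) ⊆ divisorClass M G x :=
    (h.class_subset_iff h1 hx.1).2 ⟨n, hn, by simpa using hy.1⟩
  refine ⟨n + 1, by lia, ?_⟩
  rw [show (n + 1) • x - y = (n • x - y) + x by rw [add_nsmul, one_nsmul]; abel]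
  exact h.add_mem_classSet h1 (h2.trans hx.2.le) hx

theorem exists_nsmul_add_mem_classSet (h : IsTameMonoid M G L) (hx : x ∈ classSet M G c)
    (hy : y ∈ AddSubgroup.closure (classSet M G c)) :
    ∃ n : ℕ, 0 < n ∧ n • x + y ∈ classSet M G c := by
  suffices H : (∃ n : ℕ, 0 < n ∧ n • x + y ∈ classSet M G c) ∧
      ∃ n : ℕ, 0 < n ∧ n • x - y ∈ classSet M G c from H.1
  refine AddSubgroup.closure_induction (p := fun y _ =>
    (∃ n : ℕ, 0 < n ∧ n • x + y ∈ classSet M G c) ∧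
      ∃ n : ℕ, 0 < n ∧ n • x - y ∈ classSet M G c) ?_ ?_ ?_ ?_ hy
  · intro y hy
    exact ⟨⟨1, one_pos, by rw [one_nsmul]; exact h.add_mem_classSet' hx hy⟩,
      h.exists_nsmul_sub_mem_classSet hx hy⟩
  · exact ⟨⟨1, one_pos, by simpa using hx⟩, 1, one_pos, by simpa using hx⟩
  · rintro y z - - ⟨⟨n, hn, h1⟩, n', hn', h1'⟩ ⟨⟨m, hm, h2⟩, m', hm', h2'⟩
    refine ⟨⟨n + m, by lia, ?_⟩, n' + m', by lia, ?_⟩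
    · rw [show (n + m) • x + (y + z) = (n • x + y) + (m • x + z) by rw [add_nsmul]; abel]
      exact h.add_mem_classSet' h1 h2
    · rw [show (n' + m') • x - (y + z) = (n' • x - y) + (m' • x - z) by rw [add_nsmul]; abel]
      exact h.add_mem_classSet' h1' h2'
  · rintro y - ⟨⟨n, hn, h1⟩, n', hn', h1'⟩
    exact ⟨⟨n', hn', by rwa [← sub_eq_add_neg]⟩, n, hn, by rwa [sub_neg_eq_add]⟩

theorem mem_of_nsmul_mem (h : IsTameMonoid M G L) (hx : x ∈ L) {K : ℕ}
    (hK : ∀ k, K ≤ k → k • x ∈ M) : x ∈ M := by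
  induction K with
  | zero => simpa using hK 1 (Nat.zero_le _)
  | succ K ih =>
    rcases Nat.eq_zero_or_pos K with rfl | hK0
    · simpa using hK 1 le_rfl
    refine ih fun k hk => ?_
    rcases hk.eq_or_lt with rfl | hk
    · refine h.seminormal _ (L.nsmul_mem hx K) ?_ ?_
      · rw [← mul_nsmul']; exact hK _ (by lia)
      · rw [← mul_nsmul']; exact hK _ (by lia)
    · exact hK k hk

theorem mem_classSet_of_nsmul_mem (h : IsTameMonoid M G L)
    (hx : x ∈ AddSubgroup.closure (classSet M G c)) {n : ℕ} (hn : 0 < n)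
    (hnx : n • x ∈ classSet M G c) : x ∈ classSet M G c := by
  have hxL : x ∈ L := (AddSubgroup.closure_le L).2 (fun y hy => h.le y hy.1) hx
  obtain ⟨N, hN⟩ := exists_common_nat (fun N (r : Fin n) => N • n • x + (r : ℕ) • x ∈ M) (by
    intro r
    obtain ⟨N, -, h1⟩ := h.exists_nsmul_add_mem_classSet hnx
      ((AddSubgroup.closure (classSet M G c)).nsmul_mem hx r)
    refine ⟨N, fun k hk => ?_⟩
    obtain ⟨l, rfl⟩ := Nat.exists_eq_add_of_le hk
    rw [add_nsmul, add_right_comm]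
    exact M.add_mem h1.1 (M.nsmul_mem hnx.1 l))
  have hxM : x ∈ M := h.mem_of_nsmul_mem hxL (K := N * n) fun k hk => by
    have h1 := hN (k / n) ((Nat.le_div_iff_mul_le hn).2 hk) ⟨k % n, Nat.mod_lt k hn⟩
    rwa [← mul_nsmul', ← add_nsmul, Nat.div_add_mod'] at h1
  exact ⟨hxM, (h.class_nsmul hxM hn).symm.trans hnx.2⟩

theorem openCone (h : IsTameMonoid M G L) (c : Finset V) :
    OpenCone (AddSubgroup.closure (classSet M G c)) {x | ∃ n : ℕ, 0 < n ∧ n • x ∈ classSet M G c}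
    where
  add_mem := by
    rintro x y ⟨n, hn, hx⟩ ⟨m, hm, hy⟩
    refine ⟨m * n, Nat.mul_pos hm hn, ?_⟩
    rw [nsmul_add, mul_nsmul', mul_comm m n, mul_nsmul']
    exact h.add_mem_classSet' (h.nsmul_mem_classSet hx hm) (h.nsmul_mem_classSet hy hn)
  nsmul_mem_iff := by
    intro n x hn
    constructor
    · rintro ⟨m, hm, hx⟩
      exact ⟨m * n, Nat.mul_pos hm hn, by rwa [mul_nsmul']⟩
    · rintro ⟨m, hm, hx⟩
      refine ⟨m, hm, ?_⟩
      rw [← mul_nsmul', mul_comm, mul_nsmul']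
      exact h.nsmul_mem_classSet hx hn
  exists_nsmul_mem := by
    rintro x ⟨n, hn, hx⟩
    exact ⟨n, hn, AddSubgroup.subset_closure hx⟩
  exists_nsmul_add_mem := by
    rintro x y ⟨n, hn, hx⟩ hy
    obtain ⟨m, hm, h1⟩ := h.exists_nsmul_add_mem_classSet hx hy
    exact ⟨m * n, Nat.mul_pos hm hn, 1, one_pos, by rwa [one_nsmul, mul_nsmul']⟩

variable [Module ℚ V]

theorem exists_subIdemFree (h : IsTameMonoid M G L) (hL : L.FG) (c : Finset V) (R : Type*)
    [CommRing R] [IsDomain R] [IsPrincipalIdealRing R] :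
    ∃ N : AddSubmonoid V, SubIdemFree R N ∧ ∀ x, x ∈ N ↔ x = 0 ∨ x ∈ classSet M G c := by
  have hΩ := h.openCone c
  have hLc : (AddSubgroup.closure (classSet M G c)).FG :=
    AddSubgroup.FG.of_le hL ((AddSubgroup.closure_le L).2 fun y hy => h.le y hy.1)
  by_cases h0 : (0 : V) ∈ classSet M G c
  · refine ⟨_, subIdemFree_addSubgroup hLc R, fun x => ⟨fun hx => .inr ?_, ?_⟩⟩
    · obtain ⟨n, -, h1⟩ := h.exists_nsmul_add_mem_classSet h0 hx
      rwa [nsmul_zero, zero_add] at h1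
    · rintro (rfl | hx)
      · exact AddSubgroup.zero_mem _
      · exact AddSubgroup.subset_closure hx
  · refine ⟨_, subIdemFree_coneMon hLc hΩ ?_ R, fun x => hΩ.mem_coneMon.trans
      (or_congr Iff.rfl ⟨?_, ?_⟩)⟩
    · rintro ⟨n, -, h1⟩
      exact h0 (by rwa [nsmul_zero] at h1)
    · rintro ⟨⟨n, hn, h1⟩, h2⟩
      exact h.mem_classSet_of_nsmul_mem h2 hn h1
    · intro hx
      exact ⟨⟨1, one_pos, by rwa [one_nsmul]⟩, AddSubgroup.subset_closure hx⟩

end IsTameMonoid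

end Classes

end

section

open Matrix

/-! ### Reduction to cones -/

section Seminormal

variable {V : Type*} [AddCommGroup V] {R : Type*} [CommRing R]

theorem splitIn_of_filt {M N S S' : AddSubmonoid V} (hSM : S ≤ M) (hNS : N ≤ S)
    (hN : ∀ x ∈ S, ∀ y ∈ S, x + y ∈ N ↔ x ∈ N ∧ y ∈ N)
    (hS' : ∀ x ∈ S, x ∉ N → x ∈ S') (hfree : SubIdemFree R N)
    (H : ∀ (n : ℕ) (e : Matrix (Fin n) (Fin n) (AddMonoidAlgebra R V)), MatIn (alg R S') e →
      e * e = e → SplitIn (alg R M) e)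
    {n : ℕ} {e : Matrix (Fin n) (Fin n) (AddMonoidAlgebra R V)} (he : MatIn (alg R S) e)
    (hee : e * e = e) : SplitIn (alg R M) e := by
  have hmul : ∀ x ∈ (S : Set V), ∀ y ∈ (S : Set V),
      x + y ∈ (N : Set V) ↔ x ∈ (N : Set V) ∧ y ∈ (N : Set V) := hN
  obtain ⟨k, U, W, hU, hW, hUW, hWU⟩ := hfree n (e.map (filt (N : Set V)))
    (matIn_map_filt (T := (S : Set V)) he) (by rw [← map_filt_mul hmul he he, hee])
  have hUS : MatIn (supp R (S : Set V)) U := hU.mono fun x hx => alg_mono hNS hx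
  have hWS : MatIn (supp R (S : Set V)) W := hW.mono fun x hx => alg_mono hNS hx
  have hU' : MatIn (alg R S) (e * U) := he.mul hUS
  have hW' : MatIn (alg R S) (W * e) := MatIn.mul (S := alg R S) hWS he
  have h1 : (e * U).map (filt (N : Set V)) = U := by
    rw [map_filt_mul hmul he hUS, map_filt_eq_self hU, ← hUW, Matrix.mul_assoc, hWU,
      Matrix.mul_one]
  have h2 : (W * e).map (filt (N : Set V)) = W := by
    rw [map_filt_mul hmul hWS he, map_filt_eq_self hW, ← hUW, ← Matrix.mul_assoc, hWU,
      Matrix.one_mul]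
  have hone : MatIn (supp R (N : Set V)) (1 : Matrix (Fin k) (Fin k) (AddMonoidAlgebra R V)) :=
    MatIn.one (S := alg R N)
  refine splitIn_of_split_mod (A := alg R S') (S := alg R S) (alg_mono hSM)
    (supp R ((S : Set V) \ N)).toAddSubgroup
    (fun x hx => supp_mono (fun y hy => hS' y hy.1 hy.2) hx)
    (fun x hx y hy => mul_mem_supp (T₁ := (S : Set V)) (T₂ := (S : Set V) \ N)
      (T₃ := (S : Set V) \ N) (fun a ha b hb => ⟨S.add_mem ha hb.1, fun hab => hb.2 ((hN a ha b hb.1).1 hab).2⟩) hx hy)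
    H hee he (e * U) (W * e) hU' hW' ?_ ?_ ?_ ?_
  · exact matIn_supp_sdiff he (hU'.mul hW') (by rw [map_filt_mul hmul hU' hW', h1, h2, hUW])
  · exact matIn_supp_sdiff (hW'.mul hU') (hone.mono fun x hx => alg_mono hNS hx) (by
      rw [map_filt_mul hmul hW' hU', h1, h2, hWU, map_filt_eq_self hone])
  · rw [← Matrix.mul_assoc, hee]
  · rw [Matrix.mul_assoc, hee]

variable [Module ℚ V] [IsDomain R] [IsPrincipalIdealRing R]

theorem IsTameMonoid.splitIn_of_upset {M : AddSubmonoid V} {G : Finset V} {L : AddSubgroup V}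
    (h : IsTameMonoid M G L) (hL : L.FG) (𝒰 : Finset (Finset V))
    (h𝒰 : ∀ x ∈ M, ∀ y ∈ M, divisorClass M G x ∈ 𝒰 → divisorClass M G (x + y) ∈ 𝒰)
    (S : AddSubmonoid V) (hS : ∀ x, x ∈ S ↔ x = 0 ∨ x ∈ M ∧ divisorClass M G x ∈ 𝒰)
    (n : ℕ) (e : Matrix (Fin n) (Fin n) (AddMonoidAlgebra R V)) (he : MatIn (alg R S) e)
    (hee : e * e = e) : SplitIn (alg R M) e := by
  induction 𝒰 using Finset.strongInduction generalizing S n e with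
  | H 𝒰 ih =>
    have hSM : S ≤ M := fun x hx => by
      rcases (hS x).1 hx with rfl | hx
      · exact M.zero_mem
      · exact hx.1
    rcases 𝒰.eq_empty_or_nonempty with rfl | hne
    · have hbot : S = ⊥ := by
        ext x
        simp [hS]
      subst hbot
      exact (subIdemFree_bot n e he hee).mono fun x hx => alg_mono hSM hx
    classical
    obtain ⟨c, hc⟩ := 𝒰.exists_minimal hne
    obtain ⟨N, hNfree, hN⟩ := h.exists_subIdemFree hL c R
    have hmin : ∀ x ∈ M, divisorClass M G x ∈ 𝒰 → divisorClass M G x ⊆ c →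
        divisorClass M G x = c := fun x hx hx𝒰 hxc => subset_antisymm hxc (hc.le_of_le hx𝒰 hxc)
    have hup : ∀ x ∈ M, ∀ y ∈ M, divisorClass M G x ∈ 𝒰.erase c →
        divisorClass M G (x + y) ∈ 𝒰.erase c := by
      intro x hx y hy hxc
      rw [Finset.mem_erase] at hxc ⊢
      refine ⟨fun hxy => hxc.1 (hmin x hx hxc.2 ?_), h𝒰 x hx y hy hxc.2⟩
      rw [← hxy]
      exact h.class_subset_add hx hy
    by_cases hcM : ∃ z ∈ M, divisorClass M G z = c
    swap
    · refine ih _ (Finset.erase_ssubset hc.prop) hup S (fun x => ?_) n e he hee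
      rw [hS, Finset.mem_erase]
      exact or_congr Iff.rfl ⟨fun hx => ⟨hx.1, fun hxc => hcM ⟨x, hx.1, hxc⟩, hx.2⟩,
        fun hx => ⟨hx.1, hx.2.2⟩⟩
    obtain ⟨z, hz, hzc⟩ := hcM
    let S' : AddSubmonoid V :=
      { carrier := {x | x = 0 ∨ x ∈ M ∧ divisorClass M G x ∈ 𝒰.erase c}
        zero_mem' := .inl rfl
        add_mem' := by
          rintro x y (rfl | hx) (rfl | hy)
          · exact .inl (add_zero _)
          · exact .inr (by rwa [zero_add])
          · exact .inr (by rwa [add_zero])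
          · exact .inr ⟨M.add_mem hx.1 hy.1, hup x hx.1 y hy.1 hx.2⟩ }
    have hNS : N ≤ S := fun x hx => by
      rcases (hN x).1 hx with rfl | hx
      · exact S.zero_mem
      · exact (hS x).2 (.inr ⟨hx.1, hx.2.symm ▸ hc.prop⟩)
    have key : ∀ x ∈ S, ∀ y ∈ S, x + y ∈ N → x ∈ N := by
      intro x hx y hy hxy
      rcases (hS x).1 hx with rfl | hx'
      · exact N.zero_mem
      refine (hN x).2 (.inr ⟨hx'.1, hmin x hx'.1 hx'.2 ?_⟩)
      have hle := h.class_subset_add hx'.1 (hSM hy)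
      rcases (hN _).1 hxy with h0 | hxy
      · rw [h0] at hle
        exact hle.trans (hzc ▸ h.class_zero_subset hz)
      · exact hle.trans hxy.2.le
    refine splitIn_of_filt (S' := S') hSM hNS (fun x hx y hy => ⟨fun hxy => ⟨key x hx y hy hxy,
      key y hy x hx (by rwa [add_comm])⟩, fun hxy => N.add_mem hxy.1 hxy.2⟩) ?_ hNfree
      (fun m f hf hff => ih _ (Finset.erase_ssubset hc.prop) hup S' (fun x => Iff.rfl) m f hf hff)
      he hee
    intro x hx hxN
    rcases (hS x).1 hx with rfl | hx
    · exact absurd N.zero_mem hxN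
    · exact .inr ⟨hx.1, Finset.mem_erase.2 ⟨fun hxc => hxN ((hN x).2 (.inr ⟨hx.1, hxc⟩)), hx.2⟩⟩

theorem IsTameMonoid.splitIn {M : AddSubmonoid V} {G : Finset V} {L : AddSubgroup V}
    (h : IsTameMonoid M G L) (hL : L.FG) : SubIdemFree R M := by
  intro n e he hee
  refine h.splitIn_of_upset hL G.powerset (fun x _ y _ _ => ?_) M (fun x => ?_) n e he hee
  · exact Finset.mem_powerset.2 fun g hg => (mem_divisorClass.1 hg).1
  · refine ⟨fun hx => .inr ⟨hx, Finset.mem_powerset.2 fun g hg => (mem_divisorClass.1 hg).1⟩, ?_⟩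
    rintro (rfl | hx)
    · exact M.zero_mem
    · exact hx.1

/-- The part of `M` commensurable with the monoid generated by `G`. -/
def saturatedPart (M : AddSubmonoid V) (G : Finset V) : AddSubmonoid V where
  carrier := {x | x ∈ M ∧ x ∈ AddSubgroup.closure (G : Set V) ∧
    ∃ n : ℕ, 0 < n ∧ n • x ∈ AddSubmonoid.closure (G : Set V)}
  zero_mem' := ⟨zero_mem _, zero_mem _, 1, one_pos, by rw [nsmul_zero]; exact zero_mem _⟩
  add_mem' := by
    rintro x y ⟨h1, h2, n, hn, h3⟩ ⟨h1', h2', m, hm, h3'⟩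
    refine ⟨add_mem h1 h1', add_mem h2 h2', m * n, Nat.mul_pos hm hn, ?_⟩
    rw [nsmul_add, mul_nsmul', mul_comm m n, mul_nsmul']
    exact add_mem (nsmul_mem h3 m) (nsmul_mem h3' n)

theorem isTameMonoid_saturatedPart {M : AddSubmonoid V} {G : Finset V} (hG : ∀ g ∈ G, g ∈ M)
    (hM : ∀ x ∈ AddSubgroup.closure (M : Set V), 2 • x ∈ M → 3 • x ∈ M → x ∈ M) :
    IsTameMonoid (saturatedPart M G) G (AddSubgroup.closure (G : Set V)) where
  gen_mem g hg := ⟨hG g hg, AddSubgroup.subset_closure hg, 1, one_pos, by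
    rw [one_nsmul]; exact AddSubmonoid.subset_closure hg⟩
  le x hx := hx.2.1
  arch x hx := hx.2.2
  seminormal := by
    rintro x hx ⟨h1, -, n, hn, h2⟩ ⟨h3, -⟩
    exact ⟨hM x (AddSubgroup.closure_mono hG hx) h1 h3, hx, n * 2, by lia, by rwa [mul_nsmul']⟩

theorem subIdemFree_of_seminormal {M : AddSubmonoid V}
    (hM : ∀ x ∈ AddSubgroup.closure (M : Set V), 2 • x ∈ M → 3 • x ∈ M → x ∈ M) :
    SubIdemFree R M := by
  classical
  intro n e he hee
  set G : Finset V := Finset.univ.biUnion fun i => Finset.univ.biUnion fun j =>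
    (e i j).coeff.support with hGdef
  have hmem : ∀ {x}, x ∈ G ↔ ∃ i j, (e i j).coeff x ≠ 0 := by
    intro x
    simp [hGdef]
  have hG : ∀ g ∈ G, g ∈ M := by
    intro g hg
    obtain ⟨i, j, h⟩ := hmem.1 hg
    exact he i j g h
  have h := isTameMonoid_saturatedPart hG hM
  exact (h.splitIn ⟨G, rfl⟩ n e (fun i j x hx => h.gen_mem x (hmem.2 ⟨i, j, hx⟩)) hee).mono
    fun x hx => alg_mono (M := saturatedPart M G) (fun y hy => hy.1) hx

end Seminormal

end

section

section MonoidAlgebra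

open Algebra in
/-- The canonical map from `Q` to the divisible hull of its Grothendieck group. -/
noncomputable def toHull (Q : Type*) [AddCommMonoid Q] :
    Q →+ DivisibleHull (GrothendieckAddGroup Q) :=
  (DivisibleHull.coeAddMonoidHom _).comp GrothendieckAddGroup.of

theorem toHull_injective {Q : Type*} [AddCommMonoid Q] (hcanc : IsCancellativeAddMonoid Q)
    (htf : IsTorsionFreeAddMonoid Q) : Function.Injective (toHull Q) := by
  have : IsLeftCancelAdd Q := ⟨fun a x y h => hcanc a x y h⟩
  have : IsCancelAdd Q := AddCommMagma.IsLeftCancelAdd.toIsCancelAdd Q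
  intro a b h
  obtain ⟨s, hs⟩ := DivisibleHull.mk_eq_mk.1 h
  refine htf s s.pos a b (Algebra.GrothendieckAddGroup.of_injective ?_)
  simpa [← map_nsmul] using hs

theorem exists_eq_sub_of_mem_closure_range {Q V : Type*} [AddCommMonoid Q] [AddCommGroup V]
    (j : Q →+ V) {x : V} (hx : x ∈ AddSubgroup.closure (AddMonoidHom.mrange j : Set V)) :
    ∃ a b, x = j a - j b := by
  refine AddSubgroup.closure_induction (p := fun x _ => ∃ a b, x = j a - j b) ?_ ?_ ?_ ?_ hx
  · rintro _ ⟨a, rfl⟩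
    exact ⟨a, 0, by simp⟩
  · exact ⟨0, 0, by simp⟩
  · rintro _ _ - - ⟨a, b, rfl⟩ ⟨c, d, rfl⟩
    exact ⟨a + c, b + d, by rw [map_add, map_add]; abel⟩
  · rintro _ - ⟨a, b, rfl⟩
    exact ⟨b, a, by abel⟩

theorem idemFree_addMonoidAlgebra {Q : Type*} [AddCommMonoid Q]
    (hcanc : IsCancellativeAddMonoid Q) (htf : IsTorsionFreeAddMonoid Q)
    (hsn : IsSeminormalAddMonoid Q) (R : Type*) [CommRing R] [IsDomain R]
    [IsPrincipalIdealRing R] : IdemFree (AddMonoidAlgebra R Q) := by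
  have hinj := toHull_injective hcanc htf
  refine (subIdemFree_iff (toHull Q) hinj (M := AddMonoidHom.mrange (toHull Q))
    fun x => Iff.rfl).1 (subIdemFree_of_seminormal ?_)
  intro x hx h2 h3
  obtain ⟨a, b, rfl⟩ := exists_eq_sub_of_mem_closure_range _ hx
  obtain ⟨y, hy⟩ := h2
  obtain ⟨z, hz⟩ := h3
  obtain ⟨w, hw⟩ := hsn a b
    ⟨y, hinj (by rw [map_add, map_add, map_add, hy]; abel)⟩
    ⟨z, hinj (by simp only [map_add]; rw [hz]; abel)⟩
  exact ⟨w, by rw [hw, map_add]; abel⟩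

end MonoidAlgebra

section Kernel

variable {Q P : Type*} [AddCommMonoid Q]

theorem IsCancellativeAddMonoid.addSubmonoid (h : IsCancellativeAddMonoid Q)
    (S : AddSubmonoid Q) : IsCancellativeAddMonoid S :=
  fun a x y hxy => Subtype.ext (h a x y (congrArg Subtype.val hxy))

theorem IsTorsionFreeAddMonoid.addSubmonoid (h : IsTorsionFreeAddMonoid Q)
    (S : AddSubmonoid Q) : IsTorsionFreeAddMonoid S :=
  fun n hn x y hxy => Subtype.ext (h n hn x y (congrArg Subtype.val hxy))

theorem IsSeminormalAddMonoid.kerSubmonoid [AddCommGroup P] (h : IsSeminormalAddMonoid Q)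
    (u : Q →+ P) : IsSeminormalAddMonoid (kerSubmonoid u) := by
  rintro ⟨a, ha⟩ ⟨b, hb⟩ ⟨y, hy⟩ ⟨z, hz⟩
  obtain ⟨w, hw⟩ := h a b ⟨y, congrArg Subtype.val hy⟩ ⟨z, congrArg Subtype.val hz⟩
  refine ⟨⟨w, ?_⟩, Subtype.ext hw⟩
  change u a = 0 at ha
  change u b = 0 at hb
  change u w = 0
  rwa [hw, map_add, hb, zero_add] at ha

end Kernel

end

/-!
STATEMENT 7 (Corollary `Free-G-inv-L`):
Let `R` be a principal ideal domain, `Q` a cancellative, torsion-free, seminormal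
commutative monoid (possibly with nontrivial units), `P` a finitely generated abelian
group and `u : Q → P` a monoid homomorphism (inducing the `P`-grading of `A = R[Q]`).
Then every finitely generated projective module over `A = R[Q]` is free, and every
finitely generated projective module over the degree-zero subring
`A^G = A_0 = R[ker u]` is free.
-/
theorem projectives_free_over_monoid_algebra_and_invariants_over_PID
    (R : Type u) [CommRing R] [IsDomain R] [IsPrincipalIdealRing R]
    (Q : Type u) [AddCommMonoid Q]
    (hcanc : IsCancellativeAddMonoid Q) (htf : IsTorsionFreeAddMonoid Q)
    (hsn : IsSeminormalAddMonoid Q)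
    (P : Type u) [AddCommGroup P] [AddGroup.FG P] (u : Q →+ P) :
    AllFGProjectiveFree (AddMonoidAlgebra R Q) ∧
    AllFGProjectiveFree (AddMonoidAlgebra R ↥(kerSubmonoid u)) := by
  exact ⟨fun M _ _ _ _ => (idemFree_addMonoidAlgebra hcanc htf hsn R).allFGProjectiveFree,
    fun M _ _ _ _ => (idemFree_addMonoidAlgebra (hcanc.addSubmonoid _) (htf.addSubmonoid _)
      (hsn.kerSubmonoid u) R).allFGProjectiveFree⟩
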